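/- Let X ⊂ ℙ³ be a smooth cubic surface and a ≥ 2 an integer. Then the ideal I_{Z_{m(a)},X} ⊂ R_X of a general set of m(a) = (3/2)a(a−1) + a points on X has graded minimal free resolution over R given by 0 → R(−a−3)^{a−1} → R(−a−1)^{3a} → R(−a)^{2a+1} → I_{Z_{m(a)},X} → 0. -/

import Mathlib

/-!
Common definitions for formalizing "The minimal resolution conjecture for points
on the cubic surface" (arXiv:math/0611137).

We work with `R = k[x₀,x₁,x₂,x₃]`, closed points of `ℙ³` modeled by
`Projectivization k (Fin 4 → k)`, saturated ideals of sets of points as vanishing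
ideals, genericity expressed by a nonempty basic open subset of the configuration
space, and graded minimal free resolutions expressed by explicit homogeneous
matrices whose entries have zero constant term (no nonzero scalar entries).
-/

open MvPolynomial

noncomputable section

/-- The polynomial ring `R = k[x₀,x₁,x₂,x₃]` in four variables over `k`. -/
abbrev R4 (k : Type) [Field k] : Type := MvPolynomial (Fin 4) k

/-- The (closed) points of the projective space `ℙ³` over `k`. -/
abbrev P3 (k : Type) [Field k] : Type := Projectivization k (Fin 4 → k)

variable (k : Type) [Field k]

/-- A polynomial vanishes at a projective point if it vanishes at every
representative vector of that point. -/
def VanishesAt (f : R4 k) (p : P3 k) : Prop :=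
  ∀ (v : Fin 4 → k) (hv : v ≠ 0), Projectivization.mk k v hv = p → eval v f = 0

/-- The saturated homogeneous ideal `I_Z ⊆ R` of a set `Z` of (reduced) points of
`ℙ³`: all polynomials vanishing at every point of `Z`. -/
def pointsIdeal (Zs : Set (P3 k)) : Ideal (R4 k) where
  carrier := {f | ∀ p ∈ Zs, VanishesAt k f p}
  zero_mem' := by
    intro p _ v hv _
    simp
  add_mem' := by
    intro a b ha hb p hp v hv hmk
    have h1 := ha p hp v hv hmk
    have h2 := hb p hp v hv hmk
    simp [h1, h2]
  smul_mem' := by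
    intro c a ha p hp v hv hmk
    have h1 := ha p hp v hv hmk
    simp [smul_eq_mul, h1]

/-- An ideal of `R` is homogeneous if it is generated by homogeneous elements. -/
def IsHomogIdeal (I : Ideal (R4 k)) : Prop :=
  ∃ G : Set (R4 k), (∀ g ∈ G, ∃ d : ℕ, g.IsHomogeneous d) ∧ I = Ideal.span G

/-- Saturation of an ideal with respect to the irrelevant maximal ideal
`(x₀,…,x₃)`. -/
def satIdeal (I : Ideal (R4 k)) : Ideal (R4 k) where
  carrier := {g | ∀ i : Fin 4, ∃ N : ℕ, (X i : R4 k) ^ N * g ∈ I}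
  zero_mem' := by
    intro i
    exact ⟨0, by simp⟩
  add_mem' := by
    intro a b ha hb i
    obtain ⟨N, hN⟩ := ha i
    obtain ⟨M, hM⟩ := hb i
    refine ⟨N + M, ?_⟩
    have h1 : (X i : R4 k) ^ (N + M) * (a + b)
        = X i ^ M * (X i ^ N * a) + X i ^ N * (X i ^ M * b) := by ring
    rw [h1]
    exact Ideal.add_mem _ (Ideal.mul_mem_left _ _ hN) (Ideal.mul_mem_left _ _ hM)
  smul_mem' := by
    intro c a ha i
    obtain ⟨N, hN⟩ := ha i
    refine ⟨N, ?_⟩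
    have h1 : (X i : R4 k) ^ N * (c • a) = c * (X i ^ N * a) := by
      rw [smul_eq_mul]; ring
    rw [h1]
    exact Ideal.mul_mem_left _ _ hN

/-- The colon ideal `(I : J) = {r | r·J ⊆ I}`. -/
def icolon (I J : Ideal (R4 k)) : Ideal (R4 k) where
  carrier := {r | ∀ x ∈ J, r * x ∈ I}
  zero_mem' := by
    intro x hx
    rw [zero_mul]; exact I.zero_mem
  add_mem' := by
    intro a b ha hb x hx
    rw [add_mul]
    exact Ideal.add_mem _ (ha x hx) (hb x hx)
  smul_mem' := by
    intro c a ha x hx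
    rw [smul_eq_mul, mul_assoc]
    exact Ideal.mul_mem_left _ _ (ha x hx)

/-- A smooth cubic surface `X ⊂ ℙ³`: an irreducible homogeneous cubic form with
no singular zero (Jacobian criterion). -/
structure SmoothCubicSurface (k : Type) [Field k] : Type where
  f : MvPolynomial (Fin 4) k
  homog : f.IsHomogeneous 3
  irred : Irreducible f
  smooth : ∀ v : Fin 4 → k, v ≠ 0 → eval v f = 0 →
    ∃ i : Fin 4, eval v (pderiv i f) ≠ 0

/-- A configuration of `t` distinct points lying on `X`. -/
def ConfigOn (S : SmoothCubicSurface k) {t : ℕ} (Z : Fin t → P3 k) : Prop :=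
  Function.Injective Z ∧ ∀ i, VanishesAt k S.f (Z i)

/-- A configuration avoids the (closed locus of the) polynomial `g` on the
product of the affine cones: some choice of representatives does not annihilate `g`. -/
def Avoids {t : ℕ} (g : MvPolynomial (Fin t × Fin 4) k) (Z : Fin t → P3 k) : Prop :=
  ∃ v : Fin t → Fin 4 → k,
    (∀ i, ∃ hv : v i ≠ 0, Projectivization.mk k (v i) hv = Z i) ∧
    eval (fun q : Fin t × Fin 4 => v q.1 q.2) g ≠ 0

/-- `P` holds for a *general* set of `t` points on `X`: it holds on a nonempty
(basic) Zariski-open subset of the family of all sets of `t` points of `X`. -/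
def GeneralPointsSatisfy (S : SmoothCubicSurface k) (t : ℕ)
    (P : (Fin t → P3 k) → Prop) : Prop :=
  ∃ g : MvPolynomial (Fin t × Fin 4) k,
    (∃ Z : Fin t → P3 k, ConfigOn k S Z ∧ Avoids k g Z) ∧
    (∀ Z : Fin t → P3 k, ConfigOn k S Z → Avoids k g Z → P Z)

/-- An admissible entry of a matrix in a graded **minimal** free resolution,
mapping a generator of degree `d` into a generator of degree `e`: the entry is
homogeneous of degree `d - e`, and it is not a nonzero scalar (zero constant
coefficient). -/
def EntryOk (d e : ℕ) (q : R4 k) : Prop :=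
  (q = 0 ∨ ∃ c : ℕ, d = e + c ∧ q.IsHomogeneous c) ∧ coeff 0 q = 0

/-- Integer-degree version of `EntryOk` (for modules with generators of
arbitrary integer degrees). -/
def EntryOkZ (d e : ℤ) (q : R4 k) : Prop :=
  (q = 0 ∨ ∃ c : ℕ, d = e + (c : ℤ) ∧ q.IsHomogeneous c) ∧ coeff 0 q = 0

/-- The body of a graded minimal free resolution of length 2 over `R` of the
`R`-module `I/J`:
`0 → ⊕ R(-d2 i) --M2--> ⊕ R(-d1 j) --g--> I/J → 0`.
The generators `g j ∈ I` are homogeneous of degree `d1 j` and generate `I` mod `J`;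
`M2` is a homogeneous matrix with no nonzero scalar entries whose rows generate the
kernel, and which is injective. -/
def Res2Body (J I : Ideal (R4 k)) {n1 n2 : ℕ}
    (d1 : Fin n1 → ℕ) (d2 : Fin n2 → ℕ)
    (g : Fin n1 → R4 k) (M2 : Fin n2 → Fin n1 → R4 k) : Prop :=
  (∀ j, g j ∈ I ∧ (g j).IsHomogeneous (d1 j)) ∧
  (∀ x ∈ I, ∃ w : Fin n1 → R4 k, x - ∑ j, w j * g j ∈ J) ∧
  (∀ i j, EntryOk k (d2 i) (d1 j) (M2 i j)) ∧
  (∀ w : Fin n1 → R4 k,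
    ((∑ j, w j * g j) ∈ J) ↔ ∃ u : Fin n2 → R4 k, ∀ j, w j = ∑ i, u i * M2 i j) ∧
  (∀ u : Fin n2 → R4 k, (∀ j, (∑ i, u i * M2 i j) = 0) → u = 0)

/-- `I/J` has a graded minimal free resolution
`0 → ⊕ R(-d2 i) → ⊕ R(-d1 j) → I/J → 0` over `R`. -/
def HasMinFreeRes2 (J I : Ideal (R4 k)) {n1 n2 : ℕ}
    (d1 : Fin n1 → ℕ) (d2 : Fin n2 → ℕ) : Prop :=
  ∃ (g : Fin n1 → R4 k) (M2 : Fin n2 → Fin n1 → R4 k), Res2Body k J I d1 d2 g M2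

/-- The body of a graded minimal free resolution of length 3 over `R` of the
`R`-module `I/J`:
`0 → ⊕ R(-d3 l) --M3--> ⊕ R(-d2 i) --M2--> ⊕ R(-d1 j) --g--> I/J → 0`. -/
def Res3Body (J I : Ideal (R4 k)) {n1 n2 n3 : ℕ}
    (d1 : Fin n1 → ℕ) (d2 : Fin n2 → ℕ) (d3 : Fin n3 → ℕ)
    (g : Fin n1 → R4 k) (M2 : Fin n2 → Fin n1 → R4 k)
    (M3 : Fin n3 → Fin n2 → R4 k) : Prop :=
  (∀ j, g j ∈ I ∧ (g j).IsHomogeneous (d1 j)) ∧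
  (∀ x ∈ I, ∃ w : Fin n1 → R4 k, x - ∑ j, w j * g j ∈ J) ∧
  (∀ i j, EntryOk k (d2 i) (d1 j) (M2 i j)) ∧
  (∀ i j, EntryOk k (d3 i) (d2 j) (M3 i j)) ∧
  (∀ w : Fin n1 → R4 k,
    ((∑ j, w j * g j) ∈ J) ↔ ∃ u : Fin n2 → R4 k, ∀ j, w j = ∑ i, u i * M2 i j) ∧
  (∀ u : Fin n2 → R4 k,
    (∀ j, (∑ i, u i * M2 i j) = 0) ↔ ∃ t : Fin n3 → R4 k, ∀ i, u i = ∑ l, t l * M3 l i) ∧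
  (∀ t : Fin n3 → R4 k, (∀ i, (∑ l, t l * M3 l i) = 0) → t = 0)

/-- `I/J` has a graded minimal free resolution
`0 → ⊕ R(-d3 l) → ⊕ R(-d2 i) → ⊕ R(-d1 j) → I/J → 0` over `R`.
Taking `J = ⊥` this is a resolution of the ideal `I ⊆ R`; taking `J = (f)` it is a
resolution of `I/(f) ⊆ R_X = R/(f)`; taking `J = I_C` a resolution of `I/I_C`. -/
def HasMinFreeRes3 (J I : Ideal (R4 k)) {n1 n2 n3 : ℕ}
    (d1 : Fin n1 → ℕ) (d2 : Fin n2 → ℕ) (d3 : Fin n3 → ℕ) : Prop :=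
  ∃ (g : Fin n1 → R4 k) (M2 : Fin n2 → Fin n1 → R4 k) (M3 : Fin n3 → Fin n2 → R4 k),
    Res3Body k J I d1 d2 d3 g M2 M3

/-- The Betti numbers read off from a minimal free resolution
`0 → F₃ → F₂ → F₁ → I_Z → 0` of the ideal of `Z` (so that
`F_i = ⊕_j R(-i-j)^{b_{i,j}}` in the resolution of `R/I_Z`, with `F₀ = R`). -/
def bettiCount {n1 n2 n3 : ℕ} (d1 : Fin n1 → ℕ) (d2 : Fin n2 → ℕ) (d3 : Fin n3 → ℕ)
    (i j : ℕ) : ℕ :=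
  if i = 0 then (if j = 0 then 1 else 0)
  else if i = 1 then (Finset.univ.filter fun l => d1 l = 1 + j).card
  else if i = 2 then (Finset.univ.filter fun l => d2 l = 2 + j).card
  else if i = 3 then (Finset.univ.filter fun l => d3 l = 3 + j).card
  else 0

/-- The Hilbert polynomial `P_X(t) = (3/2)t(t+1) + 1` of the cubic surface. -/
def PXcubic (t : ℕ) : ℕ := 3 * (t * (t + 1) / 2) + 1

/-- The saturated homogeneous ideal of an integral curve lying on `X`. -/
def IsCurveIdealOn (S : SmoothCubicSurface k) (I : Ideal (R4 k)) : Prop :=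
  IsHomogIdeal k I ∧ I.IsPrime ∧ S.f ∈ I ∧
    ringKrullDim (R4 k ⧸ I) = ((2 : ℕ∞) : WithBot ℕ∞)

/-- The Jacobian criterion at a point of the cone: some 2×2 minor of the Jacobian
matrix of elements of `I` is nonzero, i.e. the curve is smooth there. -/
def CurveSmoothAt (I : Ideal (R4 k)) (v : Fin 4 → k) : Prop :=
  ∃ g₁ ∈ I, ∃ g₂ ∈ I, ∃ i j : Fin 4,
    eval v (pderiv i g₁) * eval v (pderiv j g₂)
      - eval v (pderiv j g₁) * eval v (pderiv i g₂) ≠ 0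

/-- A smooth (integral) curve on `X`. -/
def IsSmoothCurveIdealOn (S : SmoothCubicSurface k) (I : Ideal (R4 k)) : Prop :=
  IsCurveIdealOn k S I ∧
  ∀ v : Fin 4 → k, v ≠ 0 → (∀ g ∈ I, eval v g = 0) → CurveSmoothAt k I v

/-- The coordinate ring `R/I` of a curve has depth 2 (a regular sequence of two
positive-degree homogeneous elements), i.e. the curve is arithmetically
Cohen–Macaulay. -/
def IsACMIdeal (I : Ideal (R4 k)) : Prop :=
  ∃ r₁ r₂ : R4 k,
    (∃ d₁ : ℕ, 0 < d₁ ∧ r₁.IsHomogeneous d₁) ∧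
    (∃ d₂ : ℕ, 0 < d₂ ∧ r₂.IsHomogeneous d₂) ∧
    (∀ x : R4 k, r₁ * x ∈ I → x ∈ I) ∧
    (∀ x : R4 k, r₂ * x ∈ I ⊔ Ideal.span {r₁} → x ∈ I ⊔ Ideal.span {r₁})

/-- The Hilbert function `t ↦ dim_k (R/I)_t`. -/
def hilbFn (I : Ideal (R4 k)) (t : ℕ) : ℕ :=
  Module.finrank k ↥(homogeneousSubmodule (Fin 4) k t) -
    Module.finrank k ↥(homogeneousSubmodule (Fin 4) k t ⊓
      Submodule.restrictScalars k I)

/-- The subscheme with saturated ideal `I` has degree `d` and (arithmetic) genus `g`,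
read off from the Hilbert polynomial `P(t) = d·t + 1 - g`. -/
def HasDegreeGenus (I : Ideal (R4 k)) (d : ℕ) (g : ℤ) : Prop :=
  ∃ N : ℕ, ∀ t : ℕ, N ≤ t → (hilbFn k I t : ℤ) = d * t + 1 - g

/-- Linear equivalence of divisors on `X`: the divisor with (divisorial) ideal `I`
is linearly equivalent to (divisor of `J`) + `a·H`, where `H` is the hyperplane
class.  Concretely, there are homogeneous forms `q, p` with `deg p = deg q + a`,
nonzero on `X`, with `q·I = p·J` in `R_X = R/(f)`.  (Taking `J = ⊤` expresses
that the divisor of `I` is linearly equivalent to `aH`.) -/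
def LinEquivOnX (S : SmoothCubicSurface k) (I J : Ideal (R4 k)) (a : ℤ) : Prop :=
  ∃ (mq mp : ℕ) (q p : R4 k), (mp : ℤ) = (mq : ℤ) + a ∧
    q.IsHomogeneous mq ∧ p.IsHomogeneous mp ∧
    q ∉ Ideal.span {S.f} ∧ p ∉ Ideal.span {S.f} ∧
    Ideal.span {q} * I ⊔ Ideal.span {S.f} = Ideal.span {p} * J ⊔ Ideal.span {S.f}

/-- Linear equivalence, on the curve `C` with ideal `IC`, of the divisor with
ideal `IG` to `r·H_C` (`H_C` the hyperplane section of `C`): there are homogeneous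
forms `q, p`, nonzero on `C`, with `deg p = deg q + r` and `q·I_{G,C} = (p)` in
`R/I_C`. -/
def DivOnCurveEquivH (IC IG : Ideal (R4 k)) (r : ℤ) : Prop :=
  ∃ (mq mp : ℕ) (q p : R4 k), (mp : ℤ) = (mq : ℤ) + r ∧
    q.IsHomogeneous mq ∧ p.IsHomogeneous mp ∧ q ∉ IC ∧ p ∉ IC ∧
    Ideal.span {q} * IG ⊔ IC = Ideal.span {p} ⊔ IC

/-- The saturated homogeneous ideal of a zero-dimensional subscheme of `ℙ³`. -/
def IsZeroDimIdeal (I : Ideal (R4 k)) : Prop :=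
  IsHomogIdeal k I ∧ satIdeal k I = I ∧
    ringKrullDim (R4 k ⧸ I) = ((1 : ℕ∞) : WithBot ℕ∞)

/-- An arithmetically Gorenstein zero-dimensional subscheme of `ℙ³`: its ideal has a
graded minimal free resolution of length 3 whose last free module has rank one. -/
def IsAGPointsIdeal (I : Ideal (R4 k)) : Prop :=
  IsZeroDimIdeal k I ∧
  ∃ (n1 n2 : ℕ) (d1 : Fin n1 → ℕ) (d2 : Fin n2 → ℕ) (s : ℕ),
    HasMinFreeRes3 k ⊥ I d1 d2 (fun _ : Fin 1 => s)

/-- `V₁` and `V₂` are directly Gorenstein linked by the arithmetically Gorenstein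
scheme with ideal `IG`: `I_G ⊆ I_{V₁} ∩ I_{V₂}`, `I_G : I_{V₁} = I_{V₂}` and
`I_G : I_{V₂} = I_{V₁}`. -/
def IsGLinked (IG I1 I2 : Ideal (R4 k)) : Prop :=
  IG ≤ I1 ⊓ I2 ∧ icolon k IG I1 = I2 ∧ icolon k IG I2 = I1

/-- The divisor `G` (with ideal `IG`) on the curve `C ⊂ X` (with ideal `IC`) is
linearly equivalent to `m·H_C - K_C`.  By adjunction on the cubic surface
(`K_X = -H`) this says `G + C|_C ∼ (m+1)·H_C` on `C`, where `C|_C` is realized as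
the scheme-theoretic intersection `C ∩ C'` with any curve `C' ∼ C`, `C' ≠ C`,
chosen disjoint from `G`. -/
def EquivHminusKC (S : SmoothCubicSurface k) (IC IG : Ideal (R4 k)) (m : ℤ) : Prop :=
  ∃ IC' : Ideal (R4 k), IsCurveIdealOn k S IC' ∧ IC' ≠ IC ∧
    LinEquivOnX k S IC' IC 0 ∧
    satIdeal k (satIdeal k (IC ⊔ IC') ⊔ IG) = ⊤ ∧
    DivOnCurveEquivH k IC (IG ⊓ satIdeal k (IC ⊔ IC')) (m + 1)

/-- A line on `X`: a smooth integral curve of degree 1, genus 0 on `X`. -/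
def IsLineOn (S : SmoothCubicSurface k) (I : Ideal (R4 k)) : Prop :=
  IsSmoothCurveIdealOn k S I ∧ HasDegreeGenus k I 1 0

/-- A smooth conic on `X`: a smooth integral curve of degree 2, genus 0 on `X`. -/
def IsConicOn (S : SmoothCubicSurface k) (I : Ideal (R4 k)) : Prop :=
  IsSmoothCurveIdealOn k S I ∧ HasDegreeGenus k I 2 0

/-- A twisted cubic on `X`: a smooth integral curve of degree 3, genus 0 on `X`. -/
def IsTwistedCubicOn (S : SmoothCubicSurface k) (I : Ideal (R4 k)) : Prop :=
  IsSmoothCurveIdealOn k S I ∧ HasDegreeGenus k I 3 0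

/-- The curve `C ⊂ X` moves in a linear system of (projective) dimension `dim`,
i.e. `h⁰(O_X(C)) = dim + 1`.  Global sections of `O_X(C)` are computed, for any
homogeneous `q ∈ I_C` of degree `s` not divisible by `f`, as the degree-`s` part of
the colon ideal `((q, f) : I_C)` modulo `(f)`. -/
def MovesInLinSysOfDim (S : SmoothCubicSurface k) (IC : Ideal (R4 k)) (dim : ℤ) : Prop :=
  ∀ (s : ℕ) (q : R4 k), q.IsHomogeneous s → q ∈ IC → q ∉ Ideal.span {S.f} →
    (Module.finrank k ↥(homogeneousSubmodule (Fin 4) k s ⊓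
        Submodule.restrictScalars k (icolon k (Ideal.span {q} ⊔ Ideal.span {S.f}) IC)) : ℤ)
      - (Module.finrank k ↥(homogeneousSubmodule (Fin 4) k s ⊓
        Submodule.restrictScalars k (icolon k (Ideal.span {q} ⊔ Ideal.span {S.f}) IC) ⊓
        Submodule.restrictScalars k (Ideal.span {S.f})) : ℤ) = dim + 1

/-- `I/(f₀)` is a maximal Cohen–Macaulay module over `R/(f₀)` (3-dimensional):
it admits a regular sequence of three positive-degree homogeneous elements. -/
def IsMCMQuotient (f0 : R4 k) (I : Ideal (R4 k)) : Prop :=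
  ∃ r₁ r₂ r₃ : R4 k,
    (∃ d : ℕ, 0 < d ∧ r₁.IsHomogeneous d) ∧
    (∃ d : ℕ, 0 < d ∧ r₂.IsHomogeneous d) ∧
    (∃ d : ℕ, 0 < d ∧ r₃.IsHomogeneous d) ∧
    (∀ x ∈ I, r₁ * x ∈ Ideal.span {f0} → x ∈ Ideal.span {f0}) ∧
    (∀ x ∈ I, r₂ * x ∈ Ideal.span {r₁} * I ⊔ Ideal.span {f0} →
      x ∈ Ideal.span {r₁} * I ⊔ Ideal.span {f0}) ∧
    (∀ x ∈ I, r₃ * x ∈ Ideal.span {r₁} * I ⊔ Ideal.span {r₂} * I ⊔ Ideal.span {f0} →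
      x ∈ Ideal.span {r₁} * I ⊔ Ideal.span {r₂} * I ⊔ Ideal.span {f0}) ∧
    (∃ x ∈ I, x ∉ Ideal.span {r₁} * I ⊔ Ideal.span {r₂} * I ⊔ Ideal.span {r₃} * I
      ⊔ Ideal.span {f0})

end

namespace CubicPoints

section

variable {k : Type} [Field k]

/-- Forms of integer degree `d`; the space is zero for negative `d`. -/
def forms (k : Type) [Field k] (d : ℤ) : Submodule k (R4 k) where
  carrier := {p | ∀ m, coeff m p ≠ 0 → (m.degree : ℤ) = d}
  zero_mem' := by intro m h; simp at h
  add_mem' := by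
    intro p q hp hq m h
    by_cases h1 : coeff m p = 0
    · exact hq m (by rwa [coeff_add, h1, zero_add] at h)
    · exact hp m h1
  smul_mem' := by
    intro c p hp m h
    refine hp m fun h1 => h ?_
    rw [coeff_smul, h1, smul_zero]

theorem mem_forms_natCast {p : R4 k} {n : ℕ} : p ∈ forms k n ↔ p.IsHomogeneous n := by
  constructor
  · intro h m hm
    have := h m hm
    rw [Nat.cast_inj] at this
    rw [← this, Finsupp.degree_eq_weight_one]
    rfl
  · intro h m hm
    have := h hm
    rw [Nat.cast_inj, ← this, Finsupp.degree_eq_weight_one]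
    rfl

theorem eq_zero_of_mem_forms_neg {p : R4 k} {d : ℤ} (hd : d < 0) (h : p ∈ forms k d) :
    p = 0 := by
  ext m
  by_contra hm
  have := h m (by simpa using hm)
  lia

theorem mul_mem_forms {p q : R4 k} {c d e : ℤ} (hp : p ∈ forms k c) (hq : q ∈ forms k d)
    (h : c + d = e) : p * q ∈ forms k e := by
  rcases lt_or_ge c 0 with hc | hc
  · rw [eq_zero_of_mem_forms_neg hc hp, zero_mul]; exact Submodule.zero_mem _
  rcases lt_or_ge d 0 with hd | hd
  · rw [eq_zero_of_mem_forms_neg hd hq, mul_zero]; exact Submodule.zero_mem _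
  lift c to ℕ using hc
  lift d to ℕ using hd
  subst h
  rw [mem_forms_natCast] at hp hq
  have := hp.mul hq
  exact_mod_cast mem_forms_natCast.mpr this

theorem X_mem_forms (i : Fin 4) : (X i : R4 k) ∈ forms k 1 := by
  exact_mod_cast mem_forms_natCast.mpr (isHomogeneous_X k i)

theorem C_mem_forms (c : k) : (C c : R4 k) ∈ forms k 0 := by
  exact_mod_cast mem_forms_natCast.mpr (isHomogeneous_C (Fin 4) c)

theorem exists_C_of_mem_forms_zero {p : R4 k} (h : p ∈ forms k 0) : ∃ c : k, p = C c := by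
  refine ⟨coeff 0 p, ?_⟩
  ext m
  rw [coeff_C]
  split_ifs with h0
  · rw [h0]
  · by_contra hm
    have := h m hm
    have h1 : m.degree = 0 := by exact_mod_cast this
    rw [Finsupp.degree_eq_zero_iff] at h1
    exact h0 h1.symm

/-- The component of integer degree `d`. -/
noncomputable def comp (k : Type) [Field k] (d : ℤ) : R4 k →ₗ[k] R4 k :=
  if 0 ≤ d then homogeneousComponent d.toNat else 0

theorem coeff_comp (d : ℤ) (p : R4 k) (m : Fin 4 →₀ ℕ) :
    coeff m (comp k d p) = if (m.degree : ℤ) = d then coeff m p else 0 := by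
  unfold comp
  by_cases hd : 0 ≤ d
  · lift d to ℕ using hd
    simp [coeff_homogeneousComponent]
  · rw [if_neg hd, if_neg (by lia)]
    simp

theorem comp_mem (d : ℤ) (p : R4 k) : comp k d p ∈ forms k d := by
  intro m hm
  rw [coeff_comp] at hm
  by_contra h
  simp [h] at hm

theorem comp_eq_self {d : ℤ} {p : R4 k} (h : p ∈ forms k d) : comp k d p = p := by
  ext m
  rw [coeff_comp]
  split_ifs with h1
  · rfl
  · by_contra h2
    exact h1 (h m (fun h3 => h2 h3.symm))

theorem comp_eq_zero {d e : ℤ} {p : R4 k} (h : p ∈ forms k e) (hne : e ≠ d) :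
    comp k d p = 0 := by
  ext m
  rw [coeff_comp, coeff_zero]
  split_ifs with h1
  · by_contra h2
    exact hne ((h m h2).symm.trans h1)
  · rfl

theorem sum_comp (p : R4 k) {N : ℕ} (hN : p.totalDegree < N) :
    ∑ d ∈ Finset.range N, comp k (d : ℤ) p = p := by
  ext m
  rw [coeff_sum]
  simp only [coeff_comp, Nat.cast_inj]
  rw [Finset.sum_ite_eq]
  split_ifs with h
  · rfl
  · by_contra h2
    apply h
    rw [Finset.mem_range]
    refine lt_of_le_of_lt ?_ hN
    have := le_totalDegree (mem_support_iff.mpr (fun h3 => h2 h3.symm))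
    exact this

theorem comp_mul {c : ℤ} {p : R4 k} (hp : p ∈ forms k c) (d : ℤ) (q : R4 k) :
    comp k d (p * q) = p * comp k (d - c) q := by
  set N := q.totalDegree + 1
  have hq := sum_comp q (N := N) (Nat.lt_succ_self _)
  conv_lhs => rw [← hq, Finset.mul_sum, map_sum]
  have h1 : ∀ i ∈ Finset.range N, comp k d (p * comp k (i : ℤ) q)
      = p * comp k (d - c) (comp k (i : ℤ) q) := by
    intro i _
    have hm := mul_mem_forms hp (comp_mem (i : ℤ) q) rfl
    by_cases h : c + i = d
    · rw [h] at hm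
      rw [comp_eq_self hm]
      have : d - c = i := by lia
      rw [this, comp_eq_self (comp_mem _ _)]
    · rw [comp_eq_zero hm h, comp_eq_zero (comp_mem _ _) (by lia), mul_zero]
  rw [Finset.sum_congr rfl h1, ← Finset.mul_sum, ← map_sum, hq]

theorem exists_form_of_dvd {c d e : ℤ} {p q : R4 k} (hp : p ∈ forms k c) (hq : q ∈ forms k d)
    (h : p ∣ q) (he : d - c = e) : ∃ s ∈ forms k e, q = p * s := by
  obtain ⟨s, hs⟩ := h
  refine ⟨comp k (d - c) s, he ▸ comp_mem _ _, ?_⟩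
  rw [← comp_mul hp, ← hs, comp_eq_self hq]

/-- The first Koszul map `F ↦ F ∧ x`, in coordinates `01, 02, 03, 12, 13, 23`. -/
def wedge {A : Type*} [CommRing A] (x F : Fin 4 → A) : Fin 6 → A :=
  ![F 0 * x 1 - F 1 * x 0, F 0 * x 2 - F 2 * x 0, F 0 * x 3 - F 3 * x 0,
    F 1 * x 2 - F 2 * x 1, F 1 * x 3 - F 3 * x 1, F 2 * x 3 - F 3 * x 2]

/-- The second Koszul map `W ↦ *(W ∧ x)`. -/
def wedge₂ {A : Type*} [CommRing A] (x : Fin 4 → A) (W : Fin 6 → A) : Fin 4 → A :=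
  ![W 3 * x 3 - W 4 * x 2 + W 5 * x 1, -(W 1 * x 3 - W 2 * x 2 + W 5 * x 0),
    W 0 * x 3 - W 2 * x 1 + W 4 * x 0, -(W 0 * x 2 - W 1 * x 1 + W 3 * x 0)]

section CommRing

variable {A : Type*} [CommRing A]

theorem sum_mul_wedge₂ (x : Fin 4 → A) (W : Fin 6 → A) : ∑ i, x i * wedge₂ x W i = 0 := by
  simp [wedge₂, Fin.sum_univ_four]
  ring

theorem wedge₂_wedge (x F : Fin 4 → A) : wedge₂ x (wedge x F) = 0 := by
  funext i
  fin_cases i <;> simp [wedge₂, wedge] <;> ring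

theorem wedge_eq_zero_iff {x F : Fin 4 → A} :
    wedge x F = 0 ↔ ∀ i j, F i * x j = F j * x i := by
  constructor
  · intro h i j
    have h0 := congrFun h 0
    have h1 := congrFun h 1
    have h2 := congrFun h 2
    have h3 := congrFun h 3
    have h4 := congrFun h 4
    have h5 := congrFun h 5
    simp [wedge] at h0 h1 h2 h3 h4 h5
    fin_cases i <;> fin_cases j <;> simp <;> grind
  · intro h
    funext i
    fin_cases i <;> simp [wedge, sub_eq_zero] <;> exact h _ _

theorem wedge_sub (x F G : Fin 4 → A) : wedge x (F - G) = wedge x F - wedge x G := by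
  funext i
  fin_cases i <;> simp [wedge] <;> ring

theorem wedge_smul_self (x : Fin 4 → A) (c : A) : wedge x (fun i => c * x i) = 0 := by
  rw [wedge_eq_zero_iff]
  intro i j
  ring

theorem wedge_add (x F G : Fin 4 → A) : wedge x (F + G) = wedge x F + wedge x G := by
  funext i
  fin_cases i <;> simp [wedge] <;> ring

theorem wedge_smul (x F : Fin 4 → A) (c : A) : wedge x (c • F) = c • wedge x F := by
  funext i
  fin_cases i <;> simp [wedge] <;> ring

theorem wedge₂_sub (x : Fin 4 → A) (V W : Fin 6 → A) :
    wedge₂ x (V - W) = wedge₂ x V - wedge₂ x W := by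
  funext i
  fin_cases i <;> simp [wedge₂] <;> ring

theorem wedge₂_add (x : Fin 4 → A) (V W : Fin 6 → A) :
    wedge₂ x (V + W) = wedge₂ x V + wedge₂ x W := by
  funext i
  fin_cases i <;> simp [wedge₂] <;> ring

theorem wedge₂_smul (x : Fin 4 → A) (c : A) (W : Fin 6 → A) :
    wedge₂ x (c • W) = c • wedge₂ x W := by
  funext i
  fin_cases i <;> simp [wedge₂] <;> ring

theorem map_wedge {B : Type*} [CommRing B] (φ : A →+* B) (x F : Fin 4 → A) (i : Fin 6) :
    φ (wedge x F i) = wedge (fun j => φ (x j)) (fun j => φ (F j)) i := by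
  fin_cases i <;> simp [wedge]

theorem map_wedge₂ {B : Type*} [CommRing B] (φ : A →+* B) (x : Fin 4 → A) (W : Fin 6 → A)
    (i : Fin 4) :
    φ (wedge₂ x W i) = wedge₂ (fun j => φ (x j)) (fun j => φ (W j)) i := by
  fin_cases i <;> simp [wedge₂]

end CommRing

theorem exists_wedge_of_wedge₂_eq_zero {v : Fin 4 → k} (hv : v ≠ 0) {W : Fin 6 → k}
    (h : wedge₂ v W = 0) : ∃ F, W = wedge v F := by
  have h0 := congrFun h 0
  have h1 := congrFun h 1
  have h2 := congrFun h 2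
  have h3 := congrFun h 3
  simp [wedge₂] at h0 h1 h2 h3
  obtain ⟨j, hj⟩ := Function.ne_iff.mp hv
  fin_cases j <;> simp at hj
  · refine ⟨![0, -W 0 / v 0, -W 1 / v 0, -W 2 / v 0], ?_⟩
    funext i
    fin_cases i <;> simp [wedge] <;> field_simp <;> grind
  · refine ⟨![W 0 / v 1, 0, -W 3 / v 1, -W 4 / v 1], ?_⟩
    funext i
    fin_cases i <;> simp [wedge] <;> field_simp <;> grind
  · refine ⟨![W 1 / v 2, W 3 / v 2, 0, -W 5 / v 2], ?_⟩
    funext i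
    fin_cases i <;> simp [wedge] <;> field_simp <;> grind
  · refine ⟨![W 2 / v 3, W 4 / v 3, W 5 / v 3, 0], ?_⟩
    funext i
    fin_cases i <;> simp [wedge] <;> field_simp <;> grind

theorem exists_wedge₂_of_sum_eq_zero {v : Fin 4 → k} (hv : v ≠ 0) {z : Fin 4 → k}
    (h : ∑ i, v i * z i = 0) : ∃ W, z = wedge₂ v W := by
  rw [Fin.sum_univ_four] at h
  obtain ⟨j, hj⟩ := Function.ne_iff.mp hv
  fin_cases j <;> simp at hj
  · refine ⟨![0, 0, 0, -z 3 / v 0, z 2 / v 0, -z 1 / v 0], ?_⟩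
    funext i
    fin_cases i <;> simp [wedge₂] <;> field_simp <;> grind
  · refine ⟨![0, z 3 / v 1, -z 2 / v 1, 0, 0, z 0 / v 1], ?_⟩
    funext i
    fin_cases i <;> simp [wedge₂] <;> field_simp <;> grind
  · refine ⟨![-z 3 / v 2, 0, z 1 / v 2, 0, -z 0 / v 2, 0], ?_⟩
    funext i
    fin_cases i <;> simp [wedge₂] <;> field_simp <;> grind
  · refine ⟨![z 2 / v 3, -z 1 / v 3, 0, z 0 / v 3, 0, 0], ?_⟩
    funext i
    fin_cases i <;> simp [wedge₂] <;> field_simp <;> grind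

end

section

variable {k : Type} [Field k]

theorem mem_span_X_of_X_mul_mem {s : Set (Fin 4)} {i : Fin 4} (hi : i ∉ s) {p : R4 k}
    (h : X i * p ∈ Ideal.span (X '' s : Set (R4 k))) :
    p ∈ Ideal.span (X '' s : Set (R4 k)) := by
  rw [mem_ideal_span_X_image] at h ⊢
  intro m hm
  obtain ⟨j, hj, hj0⟩ := h (m + Finsupp.single i 1) (by
    rw [mem_support_iff, add_comm, coeff_X_mul]
    exact mem_support_iff.mp hm)
  refine ⟨j, hj, ?_⟩
  have hij : i ≠ j := fun hh => hi (hh ▸ hj)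
  simpa [Finsupp.single_apply, hij] using hj0

theorem X_dvd_of_X_dvd_mul {i j : Fin 4} (hij : i ≠ j) {p : R4 k}
    (h : (X i : R4 k) ∣ X j * p) : (X i : R4 k) ∣ p := by
  have h1 := mem_span_X_of_X_mul_mem (k := k) (s := {i}) (i := j) (p := p)
    (by simpa using hij.symm)
    (by rw [Set.image_singleton]; exact Ideal.mem_span_singleton.mpr h)
  rw [Set.image_singleton] at h1
  exact Ideal.mem_span_singleton.mp h1

theorem exists_of_mem_span_X_pair {i j : Fin 4} {p : R4 k}
    (h : p ∈ Ideal.span (X '' {i, j} : Set (R4 k))) :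
    ∃ a b, p = a * X i + b * X j := by
  rw [Set.image_pair, Ideal.mem_span_pair] at h
  obtain ⟨a, b, h⟩ := h
  exact ⟨a, b, h.symm⟩

theorem exists_of_mem_span_X_triple {i j l : Fin 4} {p : R4 k}
    (h : p ∈ Ideal.span (X '' {i, j, l} : Set (R4 k))) :
    ∃ a b c, p = a * X i + b * X j + c * X l := by
  rw [Set.image_insert_eq, Set.image_pair, Ideal.mem_span_insert] at h
  obtain ⟨a, z, hz, h⟩ := h
  rw [Ideal.mem_span_pair] at hz
  obtain ⟨b, c, hz⟩ := hz
  exact ⟨a, b, c, by rw [h, ← hz]; ring⟩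

theorem mem_span_X_pair (i j : Fin 4) (a b : R4 k) :
    a * X i + b * X j ∈ Ideal.span (X '' {i, j} : Set (R4 k)) := by
  rw [Set.image_pair, Ideal.mem_span_pair]
  exact ⟨a, b, rfl⟩

theorem mem_span_X_triple (i j l : Fin 4) (a b c : R4 k) :
    a * X i + b * X j + c * X l ∈ Ideal.span (X '' {i, j, l} : Set (R4 k)) := by
  rw [Set.image_insert_eq, Set.image_pair, Ideal.mem_span_insert]
  exact ⟨a, b * X j + c * X l, Ideal.mem_span_pair.mpr ⟨b, c, rfl⟩, by ring⟩

theorem X_ne_zero' (i : Fin 4) : (X i : R4 k) ≠ 0 := X_ne_zero i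

theorem exists_wedge_X_of_wedge₂_eq_zero {W : Fin 6 → R4 k} (h : wedge₂ X W = 0) :
    ∃ F, W = wedge X F := by
  have h0 := congrFun h 0
  have h1 := congrFun h 1
  have h2 := congrFun h 2
  have h3 := congrFun h 3
  simp [wedge₂] at h0 h1 h2 h3
  obtain ⟨a, b, hab⟩ := exists_of_mem_span_X_pair (k := k) (i := 0) (j := 1) (p := W 0)
    (mem_span_X_of_X_mul_mem (i := 2) (by decide) (by
      have : (X 2 : R4 k) * W 0 = (-W 3) * X 0 + W 1 * X 1 := by linear_combination (-h3)
      rw [this]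
      exact mem_span_X_pair _ _ _ _))
  obtain ⟨F2, hF2⟩ := X_dvd_of_X_dvd_mul (k := k) (i := 0) (j := 1) (p := b * X 2 - W 1)
    (by decide) ⟨-a * X 2 - W 3, by linear_combination (-1 : R4 k) * h3 - X 2 * hab⟩
  have hW3 : W 3 = -a * X 2 - F2 * X 1 :=
    mul_left_cancel₀ (X_ne_zero' (k := k) 0) (by
      linear_combination (-1 : R4 k) * h3 - X 2 * hab - X 1 * hF2)
  obtain ⟨F3, hF3⟩ := X_dvd_of_X_dvd_mul (k := k) (i := 0) (j := 1) (p := b * X 3 - W 2)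
    (by decide) ⟨-a * X 3 - W 4, by linear_combination h2 - X 3 * hab⟩
  have hW4 : W 4 = -a * X 3 - F3 * X 1 :=
    mul_left_cancel₀ (X_ne_zero' (k := k) 0) (by
      linear_combination h2 - X 3 * hab - X 1 * hF3)
  have hW5 : W 5 = F2 * X 3 - F3 * X 2 :=
    mul_left_cancel₀ (X_ne_zero' (k := k) 0) (by
      linear_combination (-1 : R4 k) * h1 + X 3 * hF2 - X 2 * hF3)
  refine ⟨![b, -a, F2, F3], ?_⟩
  funext i
  fin_cases i <;> simp [wedge]
  · linear_combination hab
  · linear_combination (-1 : R4 k) * hF2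
  · linear_combination (-1 : R4 k) * hF3
  · linear_combination hW3
  · linear_combination hW4
  · linear_combination hW5

theorem exists_wedge₂_X_of_sum_eq_zero {z : Fin 4 → R4 k} (h : ∑ i, X i * z i = 0) :
    ∃ W, z = wedge₂ X W := by
  rw [Fin.sum_univ_four] at h
  obtain ⟨a, b, c, h3⟩ := exists_of_mem_span_X_triple (k := k) (i := 0) (j := 1) (l := 2)
    (p := z 3)
    (mem_span_X_of_X_mul_mem (i := 3) (by decide) (by
      have : (X 3 : R4 k) * z 3 = (-z 0) * X 0 + (-z 1) * X 1 + (-z 2) * X 2 := by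
        linear_combination h
      rw [this]
      exact mem_span_X_triple _ _ _ _ _ _))
  obtain ⟨d, e, h2⟩ := exists_of_mem_span_X_pair (k := k) (i := 0) (j := 1)
    (p := z 2 + c * X 3)
    (mem_span_X_of_X_mul_mem (i := 2) (by decide) (by
      have : (X 2 : R4 k) * (z 2 + c * X 3)
          = (-(z 0 + a * X 3)) * X 0 + (-(z 1 + b * X 3)) * X 1 := by
        linear_combination h - X 3 * h3
      rw [this]
      exact mem_span_X_pair _ _ _ _))
  obtain ⟨g, h1⟩ := X_dvd_of_X_dvd_mul (k := k) (i := 0) (j := 1)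
    (p := z 1 + b * X 3 + e * X 2) (by decide)
    ⟨-(z 0 + a * X 3 + d * X 2), by linear_combination h - X 3 * h3 - X 2 * h2⟩
  have h0 : z 0 = -a * X 3 - d * X 2 - X 1 * g :=
    mul_left_cancel₀ (X_ne_zero' (k := k) 0) (by
      linear_combination h - X 3 * h3 - X 2 * h2 - X 1 * h1)
  refine ⟨![-c, b, -e, -a, d, -g], ?_⟩
  funext i
  fin_cases i <;> simp [wedge₂]
  · linear_combination h0
  · linear_combination h1
  · linear_combination h2
  · linear_combination h3

/-- Tuples of forms. -/
def FormTuple {ι : Type*} (d : ℤ) (F : ι → R4 k) : Prop := ∀ i, F i ∈ forms k d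

theorem FormTuple.wedge {d e : ℤ} {F : Fin 4 → R4 k} (hF : FormTuple d F) (h : d + 1 = e) :
    FormTuple e (wedge X F) := by
  intro i
  have hm := fun i j => mul_mem_forms (hF i) (X_mem_forms (k := k) j) h
  fin_cases i <;> exact Submodule.sub_mem _ (hm _ _) (hm _ _)

theorem FormTuple.wedge₂ {d e : ℤ} {W : Fin 6 → R4 k} (hW : FormTuple d W) (h : d + 1 = e) :
    FormTuple e (wedge₂ X W) := by
  intro i
  have hm := fun i j => mul_mem_forms (hW i) (X_mem_forms (k := k) j) h
  fin_cases i <;> simp only [CubicPoints.wedge₂]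
  · exact Submodule.add_mem _ (Submodule.sub_mem _ (hm _ _) (hm _ _)) (hm _ _)
  · exact Submodule.neg_mem _
      (Submodule.add_mem _ (Submodule.sub_mem _ (hm _ _) (hm _ _)) (hm _ _))
  · exact Submodule.add_mem _ (Submodule.sub_mem _ (hm _ _) (hm _ _)) (hm _ _)
  · exact Submodule.neg_mem _
      (Submodule.add_mem _ (Submodule.sub_mem _ (hm _ _) (hm _ _)) (hm _ _))

theorem comp_mul_X (d : ℤ) (i : Fin 4) (p : R4 k) :
    comp k d (p * X i) = comp k (d - 1) p * X i := by
  rw [mul_comm, comp_mul (X_mem_forms i), mul_comm]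

theorem comp_wedge (d : ℤ) (F : Fin 4 → R4 k) (i : Fin 6) :
    comp k d (wedge X F i) = wedge X (fun j => comp k (d - 1) (F j)) i := by
  fin_cases i <;> simp [wedge, comp_mul_X]

theorem comp_wedge₂ (d : ℤ) (W : Fin 6 → R4 k) (i : Fin 4) :
    comp k d (wedge₂ X W i) = wedge₂ X (fun j => comp k (d - 1) (W j)) i := by
  fin_cases i <;> simp [wedge₂, comp_mul_X]

theorem exists_forms_wedge {d e : ℤ} {W : Fin 6 → R4 k} (hW : FormTuple d W)
    (h : wedge₂ X W = 0) (he : d - 1 = e) : ∃ F, FormTuple e F ∧ W = wedge X F := by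
  obtain ⟨F, hF⟩ := exists_wedge_X_of_wedge₂_eq_zero h
  refine ⟨fun j => comp k e (F j), fun j => comp_mem _ _, funext fun i => ?_⟩
  rw [← he, ← comp_wedge, ← hF, comp_eq_self (hW i)]

theorem exists_forms_wedge₂ {d e : ℤ} {z : Fin 4 → R4 k} (hz : FormTuple d z)
    (h : ∑ i, X i * z i = 0) (he : d - 1 = e) : ∃ W, FormTuple e W ∧ z = wedge₂ X W := by
  obtain ⟨W, hW⟩ := exists_wedge₂_X_of_sum_eq_zero h
  refine ⟨fun j => comp k e (W j), fun j => comp_mem _ _, funext fun i => ?_⟩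
  rw [← he, ← comp_wedge₂, ← hW, comp_eq_self (hz i)]

theorem exists_sum_X_of_forms {d e : ℤ} (hd : 0 < d) {p : R4 k} (hp : p ∈ forms k d)
    (he : d - 1 = e) : ∃ z : Fin 4 → R4 k, FormTuple e z ∧ p = ∑ i, X i * z i := by
  have h : p ∈ Ideal.span (X '' Set.univ : Set (R4 k)) := by
    rw [mem_ideal_span_X_image]
    intro m hm
    have h1 := hp m (mem_support_iff.mp hm)
    by_contra hne
    push Not at hne
    have : m = 0 := by
      ext i
      simpa using hne i
    rw [this] at h1
    simp at h1
    lia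
  rw [Set.image_univ, Ideal.mem_span_range_iff_exists_fun] at h
  obtain ⟨c, hc⟩ := h
  refine ⟨fun i => comp k e (c i), fun i => comp_mem _ _, ?_⟩
  conv_lhs => rw [← comp_eq_self hp, ← hc, map_sum]
  refine Finset.sum_congr rfl fun i _ => ?_
  rw [comp_mul_X, he, mul_comm]

end

section

variable {k : Type} [Field k]

theorem forms_natCast_eq_span (n : ℕ) : forms k (n : ℤ) =
    Submodule.span k (Set.range fun s : (Finset.univ : Finset (Fin 4)).finsuppAntidiag n =>
      (monomial s.1 1 : R4 k)) := by
  apply le_antisymm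
  · intro p hp
    rw [p.as_sum]
    refine Submodule.sum_mem _ fun m hm => ?_
    have h1 : (m.degree : ℤ) = n := hp m (mem_support_iff.mp hm)
    rw [Nat.cast_inj, Finsupp.degree_eq_sum] at h1
    have h2 : monomial m (coeff m p) = coeff m p • (monomial m 1 : R4 k) := by
      rw [smul_monomial, smul_eq_mul, mul_one]
    rw [h2]
    exact Submodule.smul_mem _ _ (Submodule.subset_span
      ⟨⟨m, Finset.mem_finsuppAntidiag.mpr ⟨h1, Finset.subset_univ _⟩⟩, rfl⟩)
  · rw [Submodule.span_le]
    rintro _ ⟨⟨s, hs⟩, rfl⟩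
    intro m hm
    rw [coeff_monomial] at hm
    have : s = m := by
      by_contra h
      simp [h] at hm
    subst this
    rw [Finset.mem_finsuppAntidiag] at hs
    rw [Finsupp.degree_eq_sum]
    exact_mod_cast hs.1

instance finiteDimensional_forms (d : ℤ) : FiniteDimensional k (forms k d) := by
  rcases lt_or_ge d 0 with hd | hd
  · have : forms k d = ⊥ := by
      rw [eq_bot_iff]
      intro p hp
      exact eq_zero_of_mem_forms_neg hd hp
    rw [this]
    infer_instance
  · lift d to ℕ using hd
    rw [forms_natCast_eq_span]
    exact FiniteDimensional.span_of_finite k (Set.finite_range _)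

theorem finrank_forms (d : ℤ) : Module.finrank k (forms k d) = (d + 3).toNat.choose 3 := by
  rcases lt_or_ge d 0 with hd | hd
  · have : forms k d = ⊥ := by
      rw [eq_bot_iff]
      intro p hp
      exact eq_zero_of_mem_forms_neg hd hp
    rw [this, finrank_bot, Nat.choose_eq_zero_of_lt]
    lia
  · lift d to ℕ using hd
    rw [forms_natCast_eq_span, finrank_span_eq_card]
    · rw [Fintype.card_coe, Finset.card_finsuppAntidiag_nat_eq_choose, Finset.card_univ,
        Fintype.card_fin]
      have h1 : 4 + d - 1 = d + 3 := by lia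
      have h2 : ((d : ℤ) + 3).toNat = d + 3 := by lia
      rw [h1, h2, Nat.choose_symm_add]
    · have := (basisMonomials (Fin 4) k).linearIndependent
      rw [coe_basisMonomials] at this
      exact this.comp _ Subtype.val_injective

theorem finrank_formTuple (r : ℕ) (d : ℤ) :
    Module.finrank k (Fin r → forms k d) = r * (d + 3).toNat.choose 3 := by
  rw [Module.finrank_pi_fintype]
  simp [finrank_forms]

/-- Forgetting homogeneity of tuples. -/
noncomputable def inclTuple (k : Type) [Field k] (r : ℕ) (d : ℤ) : (Fin r → forms k d) →ₗ[k] (Fin r → R4 k) :=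
  LinearMap.pi fun i => (forms k d).subtype ∘ₗ LinearMap.proj i

theorem inclTuple_apply {r : ℕ} {d : ℤ} (F : Fin r → forms k d) (i : Fin r) :
    inclTuple k r d F i = F i := rfl

theorem inclTuple_injective (r : ℕ) (d : ℤ) : Function.Injective (inclTuple k r d) := by
  intro F G h
  funext i
  exact Subtype.ext (congrFun h i)

/-- Vector fields of degree `n` that are radial modulo `f`. -/
def radial (f : R4 k) (n : ℤ) : Submodule k (Fin 4 → forms k n) where
  carrier := {F | ∃ A : R4 k, ∀ i, f ∣ (F i : R4 k) - A * X i}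
  zero_mem' := ⟨0, fun i => by simp⟩
  add_mem' := by
    rintro F G ⟨A, hA⟩ ⟨B, hB⟩
    refine ⟨A + B, fun i => ?_⟩
    have := dvd_add (hA i) (hB i)
    simp only [Pi.add_apply, Submodule.coe_add]
    convert this using 1
    ring
  smul_mem' := by
    rintro c F ⟨A, hA⟩
    refine ⟨C c * A, fun i => ?_⟩
    have := Dvd.dvd.mul_left (hA i) (C c)
    simp only [Pi.smul_apply, Submodule.coe_smul, smul_eq_C_mul]
    convert this using 1
    ring

theorem dvd_comp {f : R4 k} {c : ℤ} (hf : f ∈ forms k c) {p : R4 k} (h : f ∣ p) (d : ℤ) :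
    f ∣ comp k d p := by
  obtain ⟨q, rfl⟩ := h
  rw [comp_mul hf]
  exact dvd_mul_right _ _

theorem exists_form_radial {f : R4 k} (hf : f ∈ forms k 3) {n : ℤ} {F : Fin 4 → R4 k}
    (hF : FormTuple n F) (h : ∃ A : R4 k, ∀ i, f ∣ F i - A * X i) :
    ∃ A ∈ forms k (n - 1), ∀ i, f ∣ F i - A * X i := by
  obtain ⟨A, hA⟩ := h
  refine ⟨comp k (n - 1) A, comp_mem _ _, fun i => ?_⟩
  have := dvd_comp hf (hA i) n
  rwa [map_sub, comp_eq_self (hF i), comp_mul_X] at this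

theorem finrank_radial_add_le {f : R4 k} (hf : f ∈ forms k 3) (hf0 : f ≠ 0) (n : ℤ) :
    Module.finrank k (radial f n) + (n - 1).toNat.choose 3
      ≤ (n + 2).toNat.choose 3 + 4 * n.toNat.choose 3 := by
  let φ : (forms k (n - 1)) × (Fin 4 → forms k (n - 3)) →ₗ[k] (Fin 4 → R4 k) :=
    LinearMap.coprod
      (LinearMap.pi fun i => LinearMap.mulLeft k (X i) ∘ₗ (forms k (n - 1)).subtype)
      (LinearMap.pi fun i => LinearMap.mulLeft k f ∘ₗ (forms k (n - 3)).subtype ∘ₗ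
        LinearMap.proj i)
  have hφ : ∀ A s i, φ (A, s) i = X i * (A : R4 k) + f * (s i : R4 k) := fun A s i => rfl
  have h1 : (radial f n).map (inclTuple k 4 n) ≤ LinearMap.range φ := by
    rintro _ ⟨F, hF, rfl⟩
    obtain ⟨A, hA, h⟩ := exists_form_radial hf (F := fun i => F i) (fun i => (F i).2) hF
    have h2 : ∀ i, ∃ s ∈ forms k (n - 3), (F i : R4 k) - A * X i = f * s := fun i =>
      exists_form_of_dvd hf (Submodule.sub_mem _ (F i).2
        (mul_mem_forms hA (X_mem_forms i) (by ring))) (h i) rfl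
    choose s hs hs' using h2
    refine ⟨(⟨A, hA⟩, fun i => ⟨s i, hs i⟩), funext fun i => ?_⟩
    rw [hφ, inclTuple_apply, ← hs' i]
    ring
  let ψ : forms k (n - 4) →ₗ[k] (forms k (n - 1)) × (Fin 4 → forms k (n - 3)) :=
    { toFun := fun B => (⟨f * (B : R4 k), mul_mem_forms hf B.2 (by ring)⟩,
        fun i => ⟨-((B : R4 k) * X i), Submodule.neg_mem _ (mul_mem_forms B.2 (X_mem_forms i) (by ring))⟩)
      map_add' := by
        intro B B'
        ext : 1
        · ext : 1
          simp [mul_add]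
        · funext i
          ext : 1
          simp [add_mul]
          ring
      map_smul' := by
        intro c B
        ext : 1
        · ext : 1
          simp
        · funext i
          ext : 1
          simp }
  have h2 : LinearMap.range ψ ≤ LinearMap.ker φ := by
    rintro _ ⟨B, rfl⟩
    rw [LinearMap.mem_ker]
    funext i
    rw [hφ]
    simp only [ψ, LinearMap.coe_mk, AddHom.coe_mk, Pi.zero_apply]
    ring
  have h3 : Function.Injective ψ := by
    intro B B' h
    have := congrArg (fun z => (z.1 : R4 k)) h
    exact Subtype.ext (mul_left_cancel₀ hf0 this)
  have e1 := Submodule.finrank_mono h1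
  have e2 := Submodule.finrank_mono h2
  rw [LinearMap.finrank_range_of_inj h3, finrank_forms] at e2
  rw [(Submodule.equivMapOfInjective _ (inclTuple_injective 4 n) (radial f n)).symm.finrank_eq]
    at e1
  have e3 := φ.finrank_range_add_finrank_ker
  rw [Module.finrank_prod, finrank_forms, finrank_formTuple] at e3
  have a1 : n - 1 + 3 = n + 2 := by ring
  have a2 : n - 3 + 3 = n := by ring
  have a3 : n - 4 + 3 = n - 1 := by ring
  rw [a1, a2] at e3
  rw [a3] at e2
  lia

/-- A set of vectors is `n`-rigid on `f = 0` if a vector field of degree `n` for which all of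
them are eigenvectors is radial modulo `f`. -/
def Rigid (f : R4 k) (n : ℤ) (Z : Set (Fin 4 → k)) : Prop :=
  ∀ F : Fin 4 → R4 k, FormTuple n F → (∀ v ∈ Z, wedge v (fun i => eval v (F i)) = 0) →
    ∃ A : R4 k, ∀ i, f ∣ F i - A * X i

theorem exists_smul_of_wedge_eq_zero {v τ : Fin 4 → k} (hv : v ≠ 0) (h : wedge v τ = 0) :
    ∃ c : k, τ = c • v := by
  rw [wedge_eq_zero_iff] at h
  obtain ⟨j, hj⟩ := Function.ne_iff.mp hv
  refine ⟨τ j / v j, funext fun i => ?_⟩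
  have := h i j
  simp at hj ⊢
  field_simp
  exact this

/-- Evaluation of a vector field at the points, modulo the points themselves. -/
noncomputable def evalField (k : Type) [Field k] (n : ℤ) {t : ℕ} (v : Fin t → Fin 4 → k) :
    ((Fin 4 → forms k n) × (Fin t → k)) →ₗ[k] (Fin t → Fin 4 → k) where
  toFun q := fun p i => eval (v p) (q.1 i : R4 k) - q.2 p * v p i
  map_add' := by
    intro q q'
    funext p i
    simp
    ring
  map_smul' := by
    intro c q
    funext p i
    simp [smul_eval]
    ring

theorem finrank_ker_evalField_le {f : R4 k} {n : ℤ} {t : ℕ} {v : Fin t → Fin 4 → k}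
    (hv : ∀ p, v p ≠ 0) (hR : Rigid f n (Set.range v)) :
    Module.finrank k (LinearMap.ker (evalField k n v)) ≤ Module.finrank k (radial f n) := by
  have hmem : ∀ q ∈ LinearMap.ker (evalField k n v), ∀ p i,
      eval (v p) (q.1 i : R4 k) = q.2 p * v p i := fun q hq p i =>
    sub_eq_zero.mp (congrFun (congrFun hq p) i)
  let φ : LinearMap.ker (evalField k n v) →ₗ[k] radial f n :=
    LinearMap.codRestrict _ (LinearMap.fst k _ _ ∘ₗ Submodule.subtype _) (by
      rintro ⟨q, hq⟩
      refine hR (fun i => q.1 i) (fun i => (q.1 i).2) ?_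
      rintro _ ⟨p, rfl⟩
      simp only [hmem q hq]
      exact wedge_smul_self _ _)
  refine LinearMap.finrank_le_finrank_of_injective (f := φ) ?_
  rintro ⟨q, hq⟩ ⟨q', hq'⟩ h
  have h1 : q.1 = q'.1 := congrArg Subtype.val h
  ext : 1
  refine Prod.ext h1 (funext fun p => ?_)
  obtain ⟨j, hj⟩ := Function.ne_iff.mp (hv p)
  have e1 := hmem q hq p j
  have e2 := hmem q' hq' p j
  rw [h1, e2] at e1
  exact (mul_right_cancel₀ hj e1).symm

theorem four_mul_choose_le {f : R4 k} (hf : f ∈ forms k 3) (hf0 : f ≠ 0)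
    {n : ℤ} {t : ℕ} {v : Fin t → Fin 4 → k}
    (hv : ∀ p, v p ≠ 0) (hR : Rigid f n (Set.range v)) :
    4 * (n + 3).toNat.choose 3 + (n - 1).toNat.choose 3
      ≤ 3 * t + (n + 2).toNat.choose 3 + 4 * n.toNat.choose 3 := by
  have e1 := finrank_ker_evalField_le hv hR
  have e2 := finrank_radial_add_le hf hf0 n
  have e3 := (evalField k n v).finrank_range_add_finrank_ker
  have e4 := Submodule.finrank_le (LinearMap.range (evalField k n v))
  rw [Module.finrank_prod, finrank_formTuple, Module.finrank_fin_fun] at e3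
  simp only [Module.finrank_pi_fintype, Module.finrank_self, Finset.sum_const, Finset.card_univ,
    Fintype.card_fin, smul_eq_mul, mul_one] at e4
  lia

theorem evalField_surjective {f : R4 k} (hf : f ∈ forms k 3) (hf0 : f ≠ 0)
    {n : ℤ} {t : ℕ} {v : Fin t → Fin 4 → k}
    (hv : ∀ p, v p ≠ 0) (hR : Rigid f n (Set.range v))
    (ht : 3 * t + (n + 2).toNat.choose 3 + 4 * n.toNat.choose 3
      ≤ 4 * (n + 3).toNat.choose 3 + (n - 1).toNat.choose 3) :
    Function.Surjective (evalField k n v) := by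
  have e1 := finrank_ker_evalField_le hv hR
  have e2 := finrank_radial_add_le hf hf0 n
  have e3 := (evalField k n v).finrank_range_add_finrank_ker
  rw [← LinearMap.range_eq_top]
  apply Submodule.eq_top_of_finrank_eq
  apply le_antisymm (Submodule.finrank_le _)
  rw [Module.finrank_prod, finrank_formTuple, Module.finrank_fin_fun] at e3
  simp only [Module.finrank_pi_fintype, Module.finrank_self, Finset.sum_const, Finset.card_univ,
    Fintype.card_fin, smul_eq_mul, mul_one]
  lia

theorem six_mul_choose_three (n : ℕ) : 6 * (n + 2).choose 3 = (n + 2) * (n + 1) * n := by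
  induction n with
  | zero => rfl
  | succ n ih =>
    have h1 : (n + 1 + 2).choose 3 = (n + 2).choose 2 + (n + 2).choose 3 := rfl
    have h2 := Nat.triangle_succ (n + 1)
    have h3 : 2 * (n + 2).choose 2 = (n + 2) * (n + 1) := by
      rw [Nat.choose_two_right]
      exact Nat.mul_div_cancel' (Nat.even_mul_pred_self (n + 2)).two_dvd
    rw [h1]
    linear_combination ih + 3 * h3

end

section

variable {k : Type} [Field k]

/-- Rigid point sets of the expected cardinality on a cubic surface. -/
structure PointData (f : R4 k) (n : ℕ) {m : ℕ} (v : Fin m → Fin 4 → k) : Prop where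
  mem : f ∈ forms k 3
  prime : Prime f
  pos : 1 ≤ n
  ne_zero : ∀ p, v p ≠ 0
  eval_eq : ∀ p, eval (v p) f = 0
  rigid : Rigid f n (Set.range v)
  card : m = 3 * ((n + 1) * n / 2) + (n + 1)

/-- Vanishing at all the given points. -/
def VanishOn {m : ℕ} (v : Fin m → Fin 4 → k) (x : R4 k) : Prop := ∀ p, eval (v p) x = 0

theorem VanishOn.add {m : ℕ} {v : Fin m → Fin 4 → k} {x y : R4 k} (hx : VanishOn v x)
    (hy : VanishOn v y) : VanishOn v (x + y) := fun p => by rw [map_add, hx p, hy p, add_zero]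

theorem VanishOn.mul_left {m : ℕ} {v : Fin m → Fin 4 → k} {x : R4 k} (hx : VanishOn v x)
    (y : R4 k) : VanishOn v (y * x) := fun p => by rw [map_mul, hx p, mul_zero]

theorem VanishOn.sum {m : ℕ} {v : Fin m → Fin 4 → k} {ι : Type*} {s : Finset ι}
    {x : ι → R4 k} (hx : ∀ i ∈ s, VanishOn v (x i)) : VanishOn v (∑ i ∈ s, x i) := fun p => by
  rw [map_sum]
  exact Finset.sum_eq_zero fun i hi => hx i hi p

theorem not_dvd_X {f : R4 k} (hf : f ∈ forms k 3) (i : Fin 4) : ¬ f ∣ X i := by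
  intro h
  obtain ⟨s, hs, h1⟩ := exists_form_of_dvd hf (X_mem_forms i) h rfl
  rw [eq_zero_of_mem_forms_neg (by norm_num) hs, mul_zero] at h1
  exact X_ne_zero i h1

theorem choose_three_identity {n m : ℕ} (hn : 1 ≤ n) (hm : m = 3 * ((n + 1) * n / 2) + (n + 1)) :
    3 * m + ((n : ℤ) + 2).toNat.choose 3 + 4 * (n : ℤ).toNat.choose 3
      = 4 * ((n : ℤ) + 3).toNat.choose 3 + ((n : ℤ) - 1).toNat.choose 3 := by
  obtain ⟨d, rfl⟩ := Nat.exists_eq_add_of_le' hn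
  have a1 : (((d + 1 : ℕ) : ℤ) + 2).toNat = d + 1 + 2 := by lia
  have a2 : (((d + 1 : ℕ) : ℤ) + 3).toNat = d + 2 + 2 := by lia
  have a3 : (((d + 1 : ℕ) : ℤ) - 1).toNat = d := by lia
  have a4 : (((d + 1 : ℕ) : ℤ)).toNat = d + 1 := by lia
  rw [a1, a2, a3, a4]
  have e1 := six_mul_choose_three (d + 1)
  have e2 := six_mul_choose_three (d + 2)
  have e5 : 2 * ((d + 1 + 1) * (d + 1) / 2) = (d + 1 + 1) * (d + 1) :=
    Nat.mul_div_cancel' (by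
      have := Nat.even_mul_succ_self (d + 1)
      rw [mul_comm]
      exact this.two_dvd)
  have e6 := hm
  rcases d with _ | _ | d
  · simp at e1 e2 e5 e6 ⊢
    simp [Nat.choose]
    lia
  · simp at e1 e2 e5 e6 ⊢
    simp [Nat.choose]
    lia
  have e3 := six_mul_choose_three d
  have e4 := six_mul_choose_three (d + 1)
  zify at *
  rw [← mul_right_inj' (show (6 : ℤ) ≠ 0 by norm_num)]
  linear_combination e1 + 4 * e4 - 4 * e2 - e3 + 18 * e6 + 27 * e5

namespace PointData

variable {f : R4 k} {n m : ℕ} {v : Fin m → Fin 4 → k}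

theorem card_bound (h : PointData f n v) :
    3 * m + ((n : ℤ) + 2).toNat.choose 3 + 4 * (n : ℤ).toNat.choose 3
      = 4 * ((n : ℤ) + 3).toNat.choose 3 + ((n : ℤ) - 1).toNat.choose 3 :=
  choose_three_identity h.pos h.card

theorem exists_field (h : PointData f n v) {d : ℤ} (hd : n ≤ d) (τ : Fin m → Fin 4 → k) :
    ∃ F, FormTuple d F ∧ ∀ p, wedge (v p) (fun i => eval (v p) (F i)) = wedge (v p) (τ p) := by
  induction d, hd using Int.leInduction generalizing τ with
  | base =>
    obtain ⟨⟨F, c⟩, hF⟩ := evalField_surjective h.mem h.prime.ne_zero h.ne_zero h.rigid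
      h.card_bound.le τ
    refine ⟨fun i => F i, fun i => (F i).2, fun p => ?_⟩
    have h1 : (fun i => eval (v p) (F i : R4 k)) = τ p + fun i => c p * v p i := by
      funext i
      have := congrFun (congrFun hF p) i
      simp only [evalField, LinearMap.coe_mk, AddHom.coe_mk] at this
      simp [← this]
    rw [h1, wedge_add, wedge_smul_self, add_zero]
  | succ d hd ih =>
    have h1 : ∀ q, ∃ j, v q j ≠ 0 := fun q => Function.ne_iff.mp (h.ne_zero q)
    choose j hj using h1
    have h2 := fun q => ih (fun p => if p = q then (v q (j q))⁻¹ • τ q else 0)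
    choose F hF hF' using h2
    refine ⟨fun i => ∑ q, X (j q) * F q i, fun i => Submodule.sum_mem _ fun q _ =>
      mul_mem_forms (X_mem_forms _) (hF q i) (by ring), fun p => ?_⟩
    have h3 : (fun i => eval (v p) (∑ q, X (j q) * F q i))
        = ∑ q, v p (j q) • fun i => eval (v p) (F q i) := by
      funext i
      simp
    let L : (Fin 4 → k) →ₗ[k] (Fin 6 → k) :=
      { toFun := wedge (v p), map_add' := wedge_add _, map_smul' := fun c F => wedge_smul _ F c }
    have h4 : ∀ F, wedge (v p) F = L F := fun _ => rfl
    rw [h3, h4, map_sum, Finset.sum_eq_single p]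
    · rw [map_smul, ← h4, hF' p p, if_pos rfl, h4, map_smul, smul_smul, mul_inv_cancel₀ (hj p),
        one_smul]
      rfl
    · intro q _ hq
      rw [map_smul, ← h4, hF' q p, if_neg (Ne.symm hq), h4, map_zero, smul_zero]
    · simp

theorem exists_form (h : PointData f n v) {d : ℤ} (hd : n + 1 ≤ d) (c : Fin m → k) :
    ∃ q ∈ forms k d, ∀ p, eval (v p) q = c p := by
  have h1 : ∀ q, ∃ i j, v q j ≠ 0 ∧ i ≠ j := fun q => by
    obtain ⟨j, hj⟩ := Function.ne_iff.mp (h.ne_zero q)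
    exact ⟨j + 1, j, hj, by fin_cases j <;> decide⟩
  choose i j hj hij using h1
  have h2 := fun q => h.exists_field (d := d - 1) (by lia)
    (fun p => if p = q then Pi.single (i q) (c q / v q (j q)) else 0)
  choose F hF hF' using h2
  refine ⟨∑ q, (F q (i q) * X (j q) - F q (j q) * X (i q)), Submodule.sum_mem _ fun q _ =>
    Submodule.sub_mem _ (mul_mem_forms (hF _ _) (X_mem_forms _) (by ring))
      (mul_mem_forms (hF _ _) (X_mem_forms _) (by ring)), fun p => ?_⟩
  rw [map_sum]
  have h3 : ∀ q, eval (v p) (F q (i q) * X (j q) - F q (j q) * X (i q))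
      = if p = q then c q else 0 := by
    intro q
    have h4 := hF' q p
    rw [← sub_eq_zero, ← wedge_sub, wedge_eq_zero_iff] at h4
    have h5 := h4 (i q) (j q)
    simp only [Pi.sub_apply] at h5
    simp only [map_sub, map_mul, eval_X]
    split_ifs with hpq
    · subst hpq
      simp [(hij p).symm] at h5
      have := hj p
      field_simp at h5
      linear_combination h5
    · simp [hpq] at h5
      linear_combination h5
  simp [h3]

theorem exists_koszul (h : PointData f n v) {d : ℤ} (hd : n + 1 ≤ d) (ξ : Fin m → Fin 4 → k)
    (hξ : ∀ p, ∑ i, v p i * ξ p i = 0) :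
    ∃ G, FormTuple d G ∧ ∑ i, X i * G i = 0 ∧ ∀ p i, eval (v p) (G i) = ξ p i := by
  have h1 := fun p => exists_wedge₂_of_sum_eq_zero (h.ne_zero p) (hξ p)
  choose ω hω using h1
  obtain ⟨F₁, hF₁, e₁⟩ := h.exists_field (d := d - 1) (by lia) (fun p => ![ω p 0, 0, 0, 0])
  obtain ⟨F₂, hF₂, e₂⟩ := h.exists_field (d := d - 1) (by lia) (fun p => ![ω p 1, ω p 3, 0, 0])
  obtain ⟨F₃, hF₃, e₃⟩ := h.exists_field (d := d - 1) (by lia)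
    (fun p => ![ω p 2, ω p 4, ω p 5, 0])
  let W : Fin 6 → R4 k := ![F₁ 0 - 0, F₂ 0, F₃ 0, F₂ 1 - F₁ 2, F₃ 1 - F₁ 3, F₃ 2 - F₂ 3]
  have hW : FormTuple (d - 1) W := by
    intro i
    fin_cases i
    · exact Submodule.sub_mem _ (hF₁ 0) (Submodule.zero_mem _)
    · exact hF₂ 0
    · exact hF₃ 0
    · exact Submodule.sub_mem _ (hF₂ 1) (hF₁ 2)
    · exact Submodule.sub_mem _ (hF₃ 1) (hF₁ 3)
    · exact Submodule.sub_mem _ (hF₃ 2) (hF₂ 3)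
  refine ⟨wedge₂ X W, hW.wedge₂ (by ring), sum_mul_wedge₂ _ _, fun p i => ?_⟩
  rw [map_wedge₂, hω p]
  have g₁ := e₁ p
  have g₂ := e₂ p
  have g₃ := e₃ p
  rw [← sub_eq_zero, ← wedge_sub] at g₁ g₂ g₃
  obtain ⟨c₁, g₁⟩ := exists_smul_of_wedge_eq_zero (h.ne_zero p) g₁
  obtain ⟨c₂, g₂⟩ := exists_smul_of_wedge_eq_zero (h.ne_zero p) g₂
  obtain ⟨c₃, g₃⟩ := exists_smul_of_wedge_eq_zero (h.ne_zero p) g₃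
  rw [sub_eq_iff_eq_add] at g₁ g₂ g₃
  have g₁ := congrFun g₁
  have g₂ := congrFun g₂
  have g₃ := congrFun g₃
  simp only [Pi.add_apply, Pi.smul_apply, smul_eq_mul] at g₁ g₂ g₃
  fin_cases i <;> simp [wedge₂, W, g₁, g₂, g₃] <;> ring

theorem exists_sum_X (h : PointData f n v) {d : ℤ} (hd : n + 2 ≤ d) {x : R4 k}
    (hx : x ∈ forms k d) (hxv : VanishOn v x) :
    ∃ y, FormTuple (d - 1) y ∧ x = ∑ i, X i * y i ∧ ∀ i, VanishOn v (y i) := by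
  obtain ⟨z, hz, e⟩ := exists_sum_X_of_forms (by lia) hx rfl
  obtain ⟨G, hG, hG0, hGz⟩ := h.exists_koszul (d := d - 1) (by lia)
    (fun p i => eval (v p) (z i)) (fun p => by
      have := hxv p
      rw [e] at this
      simpa using this)
  refine ⟨fun i => z i - G i, fun i => Submodule.sub_mem _ (hz i) (hG i), ?_, fun i p => ?_⟩
  · simp only [mul_sub, Finset.sum_sub_distrib]
    rw [hG0, sub_zero, e]
  · rw [map_sub, hGz, sub_self]

theorem dvd_of_vanishOn (h : PointData f n v) {d : ℤ} (hd : d ≤ n) {x : R4 k}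
    (hx : x ∈ forms k d) (hxv : VanishOn v x) : f ∣ x := by
  induction d, hd using Int.leInductionDown generalizing x with
  | base =>
    obtain ⟨A, hA⟩ := h.rigid ![x, 0, 0, 0] (by
      intro i
      fin_cases i
      · exact hx
      all_goals exact Submodule.zero_mem _) (by
      rintro _ ⟨p, rfl⟩
      have : (fun i => eval (v p) ((![x, 0, 0, 0] : Fin 4 → R4 k) i)) = 0 := by
        funext i
        fin_cases i <;> simp [hxv p]
      rw [this]
      funext i
      fin_cases i <;> simp [wedge])
    have h0 := hA 0
    have h1 := hA 1
    simp at h0 h1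
    have h2 := (h.prime.dvd_or_dvd h1).resolve_right (not_dvd_X h.mem 1)
    have := dvd_add h0 (Dvd.dvd.mul_right h2 (X 0))
    simpa using this
  | pred d hd ih =>
    have := ih (x := X 0 * x) (mul_mem_forms (X_mem_forms 0) hx (by ring)) (hxv.mul_left _)
    exact (h.prime.dvd_or_dvd this).resolve_left (not_dvd_X h.mem 0)

end PointData

end

section

variable {k : Type} [Field k]

section CommRing

variable {A : Type*} [CommRing A]

/-- `wedge` as a linear map. -/
def wedgeL (x : Fin 4 → A) : (Fin 4 → A) →ₗ[A] (Fin 6 → A) where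
  toFun := wedge x
  map_add' := wedge_add x
  map_smul' c F := wedge_smul x F c

/-- `wedge₂` as a linear map. -/
def wedge₂L (x : Fin 4 → A) : (Fin 6 → A) →ₗ[A] (Fin 4 → A) where
  toFun := wedge₂ x
  map_add' := wedge₂_add x
  map_smul' c F := wedge₂_smul x c F

theorem map_sum_mul {s t : Type*} {r : ℕ} (L : (s → A) →ₗ[A] (t → A)) (u : s → Fin r → A)
    (g : Fin r → A) (l : t) :
    L (fun α => ∑ j, u α j * g j) l = ∑ j, L (fun α => u α j) l * g j := by
  have : (fun α => ∑ j, u α j * g j) = ∑ j, g j • fun α => u α j := by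
    funext α
    simp [mul_comm]
  rw [this, map_sum, Finset.sum_apply]
  refine Finset.sum_congr rfl fun j _ => ?_
  rw [map_smul, Pi.smul_apply, smul_eq_mul, mul_comm]

theorem dvd_map {s t : Type*} [Finite s] (L : (s → A) →ₗ[A] (t → A)) {f : A} {u : s → A}
    (h : ∀ i, f ∣ u i) (l : t) : f ∣ L u l := by
  choose q hq using h
  have : u = f • q := funext hq
  rw [this, map_smul]
  exact dvd_mul_right _ _

end CommRing

theorem exists_compl_family {E : Type*} [AddCommGroup E] [Module k E] [FiniteDimensional k E]
    {J I : Submodule k E} (hJI : J ≤ I) {r : ℕ}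
    (hr : Module.finrank k I = Module.finrank k J + r) :
    ∃ g : Fin r → E, (∀ j, g j ∈ I) ∧ (∀ x ∈ I, ∃ c : Fin r → k, x - ∑ j, c j • g j ∈ J) ∧
      ∀ c : Fin r → k, ∑ j, c j • g j ∈ J → c = 0 := by
  obtain ⟨D, hD⟩ := Submodule.exists_isCompl (J.comap I.subtype)
  have h1 := Submodule.finrank_add_eq_of_isCompl hD
  have h2 : Module.finrank k (J.comap I.subtype) = Module.finrank k J :=
    (Submodule.comapSubtypeEquivOfLe hJI).finrank_eq
  have h3 : Module.finrank k D = r := by lia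
  let b := Module.finBasisOfFinrankEq k D h3
  refine ⟨fun j => ((b j : I) : E), fun j => (b j : I).2, fun x hx => ?_, fun c hc => ?_⟩
  · have h4 : (⟨x, hx⟩ : I) ∈ J.comap I.subtype ⊔ D := by
      rw [hD.sup_eq_top]; exact Submodule.mem_top
    obtain ⟨y, hy, z, hz, e⟩ := Submodule.mem_sup.mp h4
    refine ⟨b.repr ⟨z, hz⟩, ?_⟩
    have h5 := congrArg (fun z : D => ((z : I) : E)) (b.sum_repr ⟨z, hz⟩)
    simp only [Submodule.coe_sum, Submodule.coe_smul] at h5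
    rw [h5]
    have h6 := congrArg (fun z : I => (z : E)) e
    simp only [Submodule.coe_add] at h6
    rw [← h6, add_sub_cancel_right]
    exact hy
  · have h4 : (∑ j, c j • b j : D).1 ∈ J.comap I.subtype := by
      simpa [Submodule.coe_sum] using hc
    have h5 := (Submodule.disjoint_def.mp hD.disjoint) _ h4 (∑ j, c j • b j : D).2
    have h6 : (∑ j, c j • b j : D) = 0 := Subtype.ext h5
    exact funext fun j => (Fintype.linearIndependent_iff.mp b.linearIndependent) c h6 j

/-- The graded piece of a submodule of a free module. -/
noncomputable def piece {s : ℕ} (N : Submodule (R4 k) (Fin s → R4 k)) (e : ℤ) :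
    Submodule k (Fin s → forms k e) :=
  (N.restrictScalars k).comap (inclTuple k s e)

theorem mem_piece {s : ℕ} {N : Submodule (R4 k) (Fin s → R4 k)} {e : ℤ}
    {w : Fin s → forms k e} : w ∈ piece N e ↔ (fun j => (w j : R4 k)) ∈ N := Iff.rfl

/-- A submodule of a free module that contains the components of its elements. -/
def Graded {s : ℕ} (N : Submodule (R4 k) (Fin s → R4 k)) : Prop :=
  ∀ w ∈ N, ∀ d, (fun j => comp k d (w j)) ∈ N

/-- Relations between the rows of a matrix. -/
def rowRel {r s : ℕ} (M : Fin r → Fin s → R4 k) : Submodule (R4 k) (Fin r → R4 k) where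
  carrier := {u | ∀ j, ∑ i, u i * M i j = 0}
  zero_mem' := by simp
  add_mem' := by
    intro u u' h h' j
    simp [add_mul, Finset.sum_add_distrib, h j, h' j]
  smul_mem' := by
    intro c u h j
    simp [mul_assoc, ← Finset.mul_sum, h j]

theorem mem_rowRel {r s : ℕ} {M : Fin r → Fin s → R4 k} {u : Fin r → R4 k} :
    u ∈ rowRel M ↔ ∀ j, ∑ i, u i * M i j = 0 := Iff.rfl

theorem comp_sum_mul {r : ℕ} {e d d' : ℤ} {u g : Fin r → R4 k} (hg : FormTuple e g)
    (hd : d - e = d') :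
    comp k d (∑ i, u i * g i) = ∑ i, comp k d' (u i) * g i := by
  rw [map_sum]
  refine Finset.sum_congr rfl fun i _ => ?_
  rw [mul_comm, comp_mul (hg i), hd, mul_comm]

theorem graded_rowRel {r s : ℕ} {e : ℤ} {M : Fin r → Fin s → R4 k}
    (hM : ∀ i, FormTuple e (M i)) : Graded (rowRel M) := by
  intro u hu d j
  rw [← comp_sum_mul (d := d + e) (fun i => hM i j) (by ring), hu j, map_zero]

theorem exists_rows {s r : ℕ} {N : Submodule (R4 k) (Fin s → R4 k)} {e₀ : ℤ}
    (hr : Module.finrank k (piece N e₀) = r)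
    (hlow : ∀ e < e₀, ∀ w, FormTuple e w → w ∈ N → w = 0)
    (hstep : ∀ e, e₀ < e → ∀ w, FormTuple e w → w ∈ N → ∃ w' : Fin 4 → Fin s → R4 k,
      (∀ l, FormTuple (e - 1) (w' l) ∧ w' l ∈ N) ∧ ∀ j, w j = ∑ l, X l * w' l j) :
    ∃ M : Fin r → Fin s → R4 k, (∀ i, FormTuple e₀ (M i)) ∧ (∀ i, M i ∈ N) ∧
      (∀ c : Fin r → k, (∀ j, ∑ i, C (c i) * M i j = 0) → c = 0) ∧
      ∀ e w, FormTuple e w → w ∈ N →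
        ∃ u, FormTuple (e - e₀) u ∧ ∀ j, w j = ∑ i, u i * M i j := by
  obtain ⟨b, hb, hspan, hind⟩ := exists_compl_family (k := k) (J := ⊥) (I := piece N e₀) bot_le
    (r := r) (by rw [finrank_bot, hr, zero_add])
  refine ⟨fun i j => b i j, fun i j => (b i j).2, fun i => hb i, fun c hc => hind c ?_, ?_⟩
  · rw [Submodule.mem_bot]
    funext j
    ext : 1
    have := hc j
    simpa [← smul_eq_C_mul] using this
  · intro e w hw hwN
    rcases lt_or_ge e e₀ with he | he
    · refine ⟨0, fun i => Submodule.zero_mem _, fun j => ?_⟩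
      rw [hlow e he w hw hwN]
      simp
    · induction e, he using Int.leInduction generalizing w with
      | base =>
        obtain ⟨c, hc⟩ := hspan (fun j => ⟨w j, hw j⟩) hwN
        refine ⟨fun i => C (c i), fun i => by rw [sub_self]; exact C_mem_forms _, fun j => ?_⟩
        rw [Submodule.mem_bot, sub_eq_zero] at hc
        have := congrArg (fun z => ((z j : forms k e₀) : R4 k)) hc
        simpa [← smul_eq_C_mul] using this
      | succ e he ih =>
        obtain ⟨w', hw', e'⟩ := hstep (e + 1) (by lia) w hw hwN
        have h1 := fun l => ih (w' l) (by simpa using (hw' l).1) (hw' l).2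
        choose u hu hu' using h1
        refine ⟨fun i => ∑ l, X l * u l i, fun i => Submodule.sum_mem _ fun l _ =>
          mul_mem_forms (X_mem_forms l) (hu l i) (by ring), fun j => ?_⟩
        rw [e']
        simp only [hu', Finset.mul_sum, Finset.sum_mul]
        rw [Finset.sum_comm]
        simp only [mul_assoc]

theorem exists_rows_of_mem {s r : ℕ} {N : Submodule (R4 k) (Fin s → R4 k)} (hN : Graded N)
    {e₀ : ℤ} {M : Fin r → Fin s → R4 k}
    (hM : ∀ e w, FormTuple e w → w ∈ N →
        ∃ u, FormTuple (e - e₀) u ∧ ∀ j, w j = ∑ i, u i * M i j)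
    (w : Fin s → R4 k) (hw : w ∈ N) : ∃ u : Fin r → R4 k, ∀ j, w j = ∑ i, u i * M i j := by
  have h1 := fun d : ℕ => hM d (fun j => comp k d (w j)) (fun j => comp_mem _ _) (hN w hw d)
  choose u _ hu using h1
  set B := (Finset.univ.sup fun j => (w j).totalDegree) + 1
  refine ⟨fun i => ∑ d ∈ Finset.range B, u d i, fun j => ?_⟩
  have h2 : (w j).totalDegree < B := Nat.lt_succ_of_le
    (Finset.le_sup (f := fun j => (w j).totalDegree) (Finset.mem_univ j))
  conv_lhs => rw [← sum_comp (w j) h2]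
  simp only [hu, Finset.sum_mul]
  rw [Finset.sum_comm]

/-- Rank-nullity for the rows in a fixed degree. -/
theorem finrank_rowRel {s r : ℕ} {N : Submodule (R4 k) (Fin s → R4 k)}
    {e₀ : ℤ} {M : Fin r → Fin s → R4 k} (hMf : ∀ i, FormTuple e₀ (M i)) (hMN : ∀ i, M i ∈ N)
    (hM : ∀ e w, FormTuple e w → w ∈ N →
        ∃ u, FormTuple (e - e₀) u ∧ ∀ j, w j = ∑ i, u i * M i j) {e e' : ℤ} (he : e + e₀ = e') :
    Module.finrank k (piece (rowRel M) e) + Module.finrank k (piece N e')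
      = r * (e + 3).toNat.choose 3 := by
  let φ : (Fin r → forms k e) →ₗ[k] (Fin s → R4 k) :=
    { toFun := fun u j => ∑ i, (u i : R4 k) * M i j
      map_add' := by
        intro u u'
        funext j
        simp [add_mul, Finset.sum_add_distrib]
      map_smul' := by
        intro c u
        funext j
        simp [Finset.smul_sum] }
  have h1 : LinearMap.ker φ = piece (rowRel M) e := by
    ext u
    rw [LinearMap.mem_ker, mem_piece, mem_rowRel]
    exact funext_iff
  have h2 : LinearMap.range φ = (piece N e').map (inclTuple k s e') := by
    ext w
    constructor
    · rintro ⟨u, rfl⟩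
      refine ⟨fun j => ⟨φ u j, Submodule.sum_mem _ fun i _ =>
        mul_mem_forms (u i).2 (hMf i j) he⟩, ?_, rfl⟩
      change φ u ∈ N
      have : φ u = ∑ i, (u i : R4 k) • M i := by
        funext j
        simp [φ]
      rw [this]
      exact Submodule.sum_mem _ fun i _ => N.smul_mem _ (hMN i)
    · rintro ⟨w, hw, rfl⟩
      obtain ⟨u, hu, e1⟩ := hM e' (fun j => w j) (fun j => (w j).2) hw
      refine ⟨fun i => ⟨u i, by rw [← he, add_sub_cancel_right] at hu; exact hu i⟩, ?_⟩
      funext j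
      exact (e1 j).symm
  have h3 := φ.finrank_range_add_finrank_ker
  rw [h1, h2, (Submodule.equivMapOfInjective _ (inclTuple_injective s e') _).symm.finrank_eq,
    finrank_formTuple] at h3
  lia

end

section

variable {k : Type} [Field k]

/-- Relations modulo `f` between the entries of a row. -/
def relMod {r : ℕ} (f : R4 k) (g : Fin r → R4 k) : Submodule (R4 k) (Fin r → R4 k) where
  carrier := {w | f ∣ ∑ j, w j * g j}
  zero_mem' := by simp
  add_mem' := by
    intro u u' h h'
    simp only [Pi.add_apply, add_mul, Finset.sum_add_distrib, Set.mem_ofPred_eq]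
    exact dvd_add h h'
  smul_mem' := by
    intro c u h
    simp only [Pi.smul_apply, smul_eq_mul, mul_assoc, ← Finset.mul_sum, Set.mem_ofPred_eq]
    exact Dvd.dvd.mul_left h c

theorem mem_relMod {r : ℕ} {f : R4 k} {g w : Fin r → R4 k} :
    w ∈ relMod f g ↔ f ∣ ∑ j, w j * g j := Iff.rfl

theorem graded_relMod {r : ℕ} {f : R4 k} {c e : ℤ} (hf : f ∈ forms k c) {g : Fin r → R4 k}
    (hg : FormTuple e g) : Graded (relMod f g) := by
  intro w hw d
  rw [mem_relMod, ← comp_sum_mul (d := d + e) hg (by ring)]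
  exact dvd_comp hf hw _

/-- Forms vanishing at the points. -/
noncomputable def vanishingForms {m : ℕ} (v : Fin m → Fin 4 → k) (d : ℤ) :
    Submodule k (forms k d) where
  carrier := {x | VanishOn v x}
  zero_mem' := fun p => by simp
  add_mem' := fun hx hy => VanishOn.add hx hy
  smul_mem' := by
    intro c x hx p
    simp [smul_eval, hx p]

theorem mem_vanishingForms {m : ℕ} {v : Fin m → Fin 4 → k} {d : ℤ} {x : forms k d} :
    x ∈ vanishingForms v d ↔ VanishOn v (x : R4 k) := Iff.rfl

/-- Forms divisible by `f`. -/
noncomputable def dividedForms (f : R4 k) (d : ℤ) : Submodule k (forms k d) where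
  carrier := {x | f ∣ (x : R4 k)}
  zero_mem' := dvd_zero _
  add_mem' := fun hx hy => dvd_add hx hy
  smul_mem' := by
    intro c x hx
    simp only [Set.mem_ofPred_eq, Submodule.coe_smul, smul_eq_C_mul]
    exact Dvd.dvd.mul_left hx _

theorem mem_dividedForms {f : R4 k} {d : ℤ} {x : forms k d} :
    x ∈ dividedForms f d ↔ f ∣ (x : R4 k) := Iff.rfl

theorem finrank_dividedForms {f : R4 k} (hf : f ∈ forms k 3) (hf0 : f ≠ 0) (d : ℤ) :
    Module.finrank k (dividedForms f d) = d.toNat.choose 3 := by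
  have h0 : d - 3 + 3 = d := by ring
  let φ : forms k (d - 3) →ₗ[k] forms k d :=
    LinearMap.codRestrict _ (LinearMap.mulLeft k f ∘ₗ (forms k (d - 3)).subtype)
      (fun s => mul_mem_forms hf s.2 (by ring))
  have hφ : ∀ s, (φ s : R4 k) = f * s := fun _ => rfl
  have h1 : LinearMap.range φ = dividedForms f d := by
    ext x
    constructor
    · rintro ⟨s, rfl⟩
      exact ⟨s, hφ s⟩
    · intro hx
      obtain ⟨s, hs, e⟩ := exists_form_of_dvd hf x.2 hx rfl
      exact ⟨⟨s, hs⟩, Subtype.ext e.symm⟩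
  have h2 : Function.Injective φ := fun s s' h =>
    Subtype.ext (mul_left_cancel₀ hf0 (congrArg Subtype.val h))
  rw [← h1, LinearMap.finrank_range_of_inj h2, finrank_forms, h0]

namespace PointData

variable {f : R4 k} {n m : ℕ} {v : Fin m → Fin 4 → k}

theorem finrank_vanishingForms (h : PointData f n v) {d : ℤ} (hd : n + 1 ≤ d) :
    Module.finrank k (vanishingForms v d) + m = (d + 3).toNat.choose 3 := by
  let φ : forms k d →ₗ[k] (Fin m → k) :=
    { toFun := fun x p => eval (v p) (x : R4 k)
      map_add' := by intro x y; funext p; simp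
      map_smul' := by intro c x; funext p; simp [smul_eval] }
  have h1 : LinearMap.ker φ = vanishingForms v d := by
    ext x
    rw [LinearMap.mem_ker, mem_vanishingForms]
    exact funext_iff
  have h2 : LinearMap.range φ = ⊤ := by
    rw [LinearMap.range_eq_top]
    intro c
    obtain ⟨q, hq, e⟩ := h.exists_form hd c
    exact ⟨⟨q, hq⟩, funext e⟩
  have h3 := φ.finrank_range_add_finrank_ker
  rw [h1, h2, finrank_top, Module.finrank_fin_fun, finrank_forms] at h3
  lia

/-- A family of forms that freely generates the forms of degree `n + 1` vanishing at the points,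
modulo the multiples of `f`. -/
structure Gens (f : R4 k) (n : ℕ) {m : ℕ} (v : Fin m → Fin 4 → k)
    (g : Fin (2 * n + 3) → R4 k) : Prop where
  form : FormTuple (n + 1) g
  vanish : ∀ j, VanishOn v (g j)
  span : ∀ x ∈ forms k (n + 1), VanishOn v x → ∃ c : Fin (2 * n + 3) → k,
    f ∣ x - ∑ j, C (c j) * g j
  indep : ∀ c : Fin (2 * n + 3) → k, f ∣ ∑ j, C (c j) * g j → c = 0

theorem choose_add (h : PointData f n v) :
    (n + 4).choose 3 = (n + 1).choose 3 + (2 * n + 3) + m := by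
  obtain ⟨d, rfl⟩ := Nat.exists_eq_add_of_le' h.pos
  have e5 : 2 * ((d + 1 + 1) * (d + 1) / 2) = (d + 1 + 1) * (d + 1) :=
    Nat.mul_div_cancel' (by
      have := Nat.even_mul_succ_self (d + 1)
      rw [mul_comm]
      exact this.two_dvd)
  have e6 := h.card
  have e1 := six_mul_choose_three d
  have e2 := six_mul_choose_three (d + 3)
  have a1 : d + 1 + 4 = d + 3 + 2 := rfl
  have a2 : d + 1 + 1 = d + 2 := rfl
  rw [a1]
  rw [a2] at *
  zify at *
  rw [← mul_right_inj' (show (6 : ℤ) ≠ 0 by norm_num)]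
  linear_combination e2 - e1 - 6 * e6 - 9 * e5

theorem exists_gens (h : PointData f n v) : ∃ g, Gens f n v g := by
  have h1 : dividedForms f (n + 1) ≤ vanishingForms v (n + 1) := by
    rintro x ⟨s, hs⟩ p
    rw [hs, map_mul, h.eval_eq, zero_mul]
  have h2 := h.finrank_vanishingForms le_rfl
  have h3 := finrank_dividedForms h.mem h.prime.ne_zero (n + 1)
  have h4 := h.choose_add
  have a1 : ((n : ℤ) + 1 + 3).toNat = n + 4 := by lia
  have a2 : ((n : ℤ) + 1).toNat = n + 1 := by lia
  rw [a1] at h2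
  rw [a2] at h3
  obtain ⟨g, hg, hspan, hind⟩ := exists_compl_family h1 (r := 2 * n + 3) (by lia)
  refine ⟨fun j => g j, fun j => (g j).2, hg, fun x hx hxv => ?_, fun c hc => hind c ?_⟩
  · obtain ⟨c, hc⟩ := hspan ⟨x, hx⟩ hxv
    refine ⟨c, ?_⟩
    rw [mem_dividedForms] at hc
    simpa [← smul_eq_C_mul] using hc
  · rw [mem_dividedForms]
    simpa [← smul_eq_C_mul] using hc

variable {g : Fin (2 * n + 3) → R4 k}

theorem exists_lift (h : PointData f n v) (hg : Gens f n v g) {d d' : ℤ} (hd : d' + (n + 1) = d)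
    {x : R4 k} (hx : x ∈ forms k d) (hxv : VanishOn v x) :
    ∃ u, FormTuple d' u ∧ f ∣ x - ∑ j, u j * g j := by
  rcases lt_or_ge d (n + 1) with hlt | hge
  · refine ⟨0, fun j => Submodule.zero_mem _, ?_⟩
    simpa using h.dvd_of_vanishOn (by lia) hx hxv
  · induction d, hge using Int.leInduction generalizing x d' with
    | base =>
      obtain ⟨c, hc⟩ := hg.span x hx hxv
      refine ⟨fun j => C (c j), fun j => ?_, hc⟩
      rw [show d' = 0 by lia]
      exact C_mem_forms _
    | succ d hge ih =>
      obtain ⟨y, hy, e, hyv⟩ := h.exists_sum_X (by lia) hx hxv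
      have h1 := fun l => ih (d' := d' - 1) (by lia) (x := y l) (by simpa using hy l) (hyv l)
      choose u hu hu' using h1
      refine ⟨fun j => ∑ l, X l * u l j, fun j => Submodule.sum_mem _ fun l _ =>
        mul_mem_forms (X_mem_forms l) (hu l j) (by ring), ?_⟩
      have h2 : x - ∑ j, (∑ l, X l * u l j) * g j = ∑ l, X l * (y l - ∑ j, u l j * g j) := by
        simp only [mul_sub, Finset.sum_sub_distrib, Finset.mul_sum, Finset.sum_mul]
        rw [e, Finset.sum_comm]
        simp only [mul_assoc]
      rw [h2]
      exact Finset.dvd_sum fun l _ => Dvd.dvd.mul_left (hu' l) _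

theorem exists_lift_tuple (h : PointData f n v) (hg : Gens f n v g) {ι : Type*} {d d' : ℤ}
    (hd : d' + (n + 1) = d)
    {x : ι → R4 k} (hx : FormTuple d x) (hxv : ∀ i, VanishOn v (x i)) :
    ∃ u : ι → Fin (2 * n + 3) → R4 k, (∀ i, FormTuple d' (u i)) ∧
      ∀ i, f ∣ x i - ∑ j, u i j * g j := by
  have h1 := fun i => h.exists_lift hg hd (hx i) (hxv i)
  choose u hu hu' using h1
  exact ⟨u, hu, hu'⟩

theorem sum_mul_vanish (hg : Gens f n v g) (w : Fin (2 * n + 3) → R4 k) :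
    VanishOn v (∑ j, w j * g j) :=
  VanishOn.sum fun j _ => (hg.vanish j).mul_left _

theorem sum_mul_mem (hg : Gens f n v g) {w : Fin (2 * n + 3) → R4 k} {e d : ℤ}
    (hw : FormTuple e w) (hd : e + (n + 1) = d) : ∑ j, w j * g j ∈ forms k d :=
  Submodule.sum_mem _ fun j _ => mul_mem_forms (hw j) (hg.form j) hd

theorem relMod_low (hg : Gens f n v g) {e : ℤ} (he : e < 1)
    {w : Fin (2 * n + 3) → R4 k} (hw : FormTuple e w) (hwN : w ∈ relMod f g) : w = 0 := by
  rcases lt_or_ge e 0 with h0 | h0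
  · exact funext fun j => eq_zero_of_mem_forms_neg h0 (hw j)
  · have : e = 0 := by lia
    subst this
    have h1 := fun j => exists_C_of_mem_forms_zero (hw j)
    choose c hc using h1
    have h2 := hg.indep c (by
      have h3 := mem_relMod.mp hwN
      simpa only [hc] using h3)
    funext j
    rw [hc j, h2]
    simp

theorem exists_forms_sum_X {ι : Type*} {e : ℤ} (he : 0 < e) {w : ι → R4 k} (hw : FormTuple e w) :
    ∃ z : Fin 4 → ι → R4 k, (∀ l, FormTuple (e - 1) (z l)) ∧ ∀ j, w j = ∑ l, X l * z l j := by
  have h1 := fun j => exists_sum_X_of_forms he (hw j) rfl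
  choose z hz hz' using h1
  exact ⟨fun l j => z j l, fun l j => hz j l, hz'⟩

theorem VanishOn.of_dvd_sub (h : PointData f n v) {x y : R4 k} (hy : VanishOn v y)
    (hd : f ∣ y - x) : VanishOn v x := by
  obtain ⟨s, hs⟩ := hd
  intro p
  have h1 := congrArg (eval (v p)) hs
  rw [map_sub, map_mul, h.eval_eq, zero_mul, hy p, zero_sub, neg_eq_zero] at h1
  exact h1

theorem exists_wedge₂_mod (h : PointData f n v) {d : ℤ} (hd : 3 ≤ d) {y : Fin 4 → R4 k}
    (hy : FormTuple d y) (hdvd : f ∣ ∑ l, X l * y l) :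
    ∃ W, FormTuple (d - 1) W ∧ ∀ l, f ∣ y l - wedge₂ X W l := by
  have h1 : ∑ l, X l * y l ∈ forms k (d + 1) :=
    Submodule.sum_mem _ fun l _ => mul_mem_forms (X_mem_forms l) (hy l) (by ring)
  obtain ⟨s, hs, e1⟩ := exists_form_of_dvd h.mem h1 hdvd rfl
  obtain ⟨t, ht, e2⟩ := exists_sum_X_of_forms (by lia) hs rfl
  have h2 : FormTuple d (fun l => y l - f * t l) := fun l =>
    Submodule.sub_mem _ (hy l) (mul_mem_forms h.mem (ht l) (by ring))
  have h3 : ∑ l, X l * (y l - f * t l) = 0 := by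
    have : ∑ l, X l * (y l - f * t l) = ∑ l, X l * y l - f * ∑ l, X l * t l := by
      rw [Finset.mul_sum, ← Finset.sum_sub_distrib]
      exact Finset.sum_congr rfl fun l _ => by ring
    rw [this, ← e2, ← e1, sub_self]
  obtain ⟨W, hW, e3⟩ := exists_forms_wedge₂ h2 h3 rfl
  refine ⟨W, hW, fun l => ⟨t l, ?_⟩⟩
  rw [← e3]
  ring

theorem exists_wedge_mod (h : PointData f n v) {d : ℤ} {W : Fin 6 → R4 k}
    (hW : FormTuple d W) (hdvd : ∀ l, f ∣ wedge₂ X W l) :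
    ∃ F, FormTuple (d - 1) F ∧ ∀ α, f ∣ W α - wedge X F α := by
  have h1 : FormTuple (d + 1) (wedge₂ X W) := hW.wedge₂ rfl
  have h2 := fun l => exists_form_of_dvd h.mem (h1 l) (hdvd l) rfl
  choose s hs hs' using h2
  have h3 : ∑ l, X l * s l = 0 := by
    refine mul_left_cancel₀ h.prime.ne_zero ?_
    rw [mul_zero, ← sum_mul_wedge₂ X W, Finset.mul_sum]
    exact Finset.sum_congr rfl fun l _ => by rw [hs' l]; ring
  obtain ⟨V, hV, e1⟩ := exists_forms_wedge₂ hs h3 rfl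
  have h4 : FormTuple d (W - f • V) := fun α =>
    Submodule.sub_mem _ (hW α) (mul_mem_forms h.mem (hV α) (by ring))
  have h5 : wedge₂ X (W - f • V) = 0 := by
    rw [wedge₂_sub, wedge₂_smul, ← e1]
    funext l
    simp [hs' l]
  obtain ⟨F, hF, e2⟩ := exists_forms_wedge h4 h5 rfl
  refine ⟨F, hF, fun α => ⟨V α, ?_⟩⟩
  rw [← e2]
  simp

theorem exists_wedge_vanishOn (h : PointData f n v) {d : ℤ} (hd : n + 1 ≤ d) {W : Fin 6 → R4 k}
    (hW : ∀ l, VanishOn v (wedge₂ X W l)) :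
    ∃ F, FormTuple (d - 1) F ∧ ∀ α, VanishOn v (W α - wedge X F α) := by
  have h4 : ∀ p, wedge₂ (v p) (fun α => eval (v p) (W α)) = 0 := by
    intro p
    funext l
    have h5 := map_wedge₂ (eval (v p)) X W l
    simp only [eval_X] at h5
    rw [← h5, hW l p]
    rfl
  have h5 := fun p => exists_wedge_of_wedge₂_eq_zero (h.ne_zero p) (h4 p)
  choose τ hτ using h5
  obtain ⟨F, hF, hFτ⟩ := h.exists_field (d := d - 1) (by lia) τ
  refine ⟨F, hF, fun α p => ?_⟩
  rw [map_sub, map_wedge]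
  simp only [eval_X]
  rw [hFτ p, ← hτ p, sub_self]

theorem sub_wedge₂_mem_relMod {z : Fin 4 → Fin (2 * n + 3) → R4 k} {W : Fin 6 → R4 k}
    {F : Fin 4 → R4 k} {u : Fin 6 → Fin (2 * n + 3) → R4 k}
    (hW : ∀ l, f ∣ ∑ j, z l j * g j - wedge₂ X W l)
    (hu : ∀ α, f ∣ W α - wedge X F α - ∑ j, u α j * g j) (l : Fin 4) :
    (fun j => z l j - wedge₂ X (fun α => u α j) l) ∈ relMod f g := by
  rw [mem_relMod]
  have h6 := map_sum_mul (wedge₂L X) u g l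
  have h7 := dvd_map (wedge₂L X) hu l
  have h8 : wedge₂L X (fun α => W α - wedge X F α - ∑ j, u α j * g j)
      = wedge₂ X W - wedge₂L X (fun α => ∑ j, u α j * g j) := by
    have : (fun α => W α - wedge X F α - ∑ j, u α j * g j)
        = W - wedge X F - fun α => ∑ j, u α j * g j := rfl
    rw [this, map_sub, map_sub]
    have : wedge₂L X (wedge X F) = 0 := wedge₂_wedge X F
    rw [this, sub_zero]
    rfl
  rw [h8, Pi.sub_apply, h6] at h7
  have h9 : ∑ j, (z l j - wedge₂ X (fun α => u α j) l) * g j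
      = (∑ j, z l j * g j - wedge₂ X W l)
        + (wedge₂ X W l - ∑ j, wedge₂L X (fun α => u α j) l * g j) := by
    simp only [sub_mul, Finset.sum_sub_distrib]
    have : ∀ j, wedge₂L X (fun α => u α j) l = wedge₂ X (fun α => u α j) l := fun _ => rfl
    simp only [this]
    ring
  rw [h9]
  exact dvd_add (hW l) h7

theorem relMod_step (h : PointData f n v) (hg : Gens f n v g) {e : ℤ} (he : 1 < e)
    {w : Fin (2 * n + 3) → R4 k} (hw : FormTuple e w) (hwN : w ∈ relMod f g) :
    ∃ w' : Fin 4 → Fin (2 * n + 3) → R4 k,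
      (∀ l, FormTuple (e - 1) (w' l) ∧ w' l ∈ relMod f g) ∧ ∀ j, w j = ∑ l, X l * w' l j := by
  have hn := h.pos
  obtain ⟨z, hz, hwz⟩ := exists_forms_sum_X (by lia) hw
  have hy : FormTuple (e + n) (fun l => ∑ j, z l j * g j) := fun l =>
    sum_mul_mem hg (hz l) (by ring)
  have h1 : ∑ l, X l * ∑ j, z l j * g j = ∑ j, w j * g j := by
    simp only [hwz, Finset.mul_sum, Finset.sum_mul]
    rw [Finset.sum_comm]
    simp only [mul_assoc]
  obtain ⟨W, hW, hW'⟩ := h.exists_wedge₂_mod (by lia) hy (by rw [h1]; exact hwN)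
  obtain ⟨F, hF, hF'⟩ := h.exists_wedge_vanishOn (d := e + n - 1) (by lia)
    (fun l => VanishOn.of_dvd_sub h (sum_mul_vanish hg (z l)) (hW' l))
  have hWF : FormTuple (e + n - 1) (fun α => W α - wedge X F α) := fun α =>
    Submodule.sub_mem _ (hW α) (hF.wedge (by ring) α)
  obtain ⟨u, hu, hu'⟩ := h.exists_lift_tuple hg (d' := e - 2) (by ring) hWF hF'
  refine ⟨fun l j => z l j - wedge₂ X (fun α => u α j) l, fun l => ⟨fun j =>
    Submodule.sub_mem _ (hz l j) (FormTuple.wedge₂ (fun α => hu α j) (by ring) l),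
    sub_wedge₂_mem_relMod hW' hu' l⟩, fun j => ?_⟩
  simp only [mul_sub, Finset.sum_sub_distrib]
  rw [sum_mul_wedge₂, sub_zero, hwz]

theorem finrank_relMod (h : PointData f n v) (hg : Gens f n v g) (e : ℕ) :
    Module.finrank k (piece (relMod f g) e) + (e + n + 4).choose 3
      = (2 * n + 3) * (e + 3).choose 3 + (e + n + 1).choose 3 + m := by
  let φ : (Fin (2 * n + 3) → forms k e) →ₗ[k] (R4 k) :=
    { toFun := fun w => ∑ j, (w j : R4 k) * g j
      map_add' := by
        intro u u'
        simp [add_mul, Finset.sum_add_distrib]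
      map_smul' := by
        intro c u
        simp [Finset.smul_sum] }
  let μ : forms k ((e : ℤ) + (n + 1) - 3) →ₗ[k] R4 k :=
    LinearMap.mulLeft k f ∘ₗ (forms k _).subtype
  have hμ : ∀ s, μ s = f * (s : R4 k) := fun _ => rfl
  have hφ : ∀ w, φ w = ∑ j, (w j : R4 k) * g j := fun _ => rfl
  let ψ := φ.coprod μ
  have h1 : LinearMap.range ψ
      = (vanishingForms v ((e : ℤ) + (n + 1))).map (forms k _).subtype := by
    ext x
    constructor
    · rintro ⟨⟨w, s⟩, rfl⟩
      refine ⟨⟨φ w + μ s, Submodule.add_mem _ (sum_mul_mem hg (fun j => (w j).2) rfl)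
        (mul_mem_forms h.mem s.2 (by ring))⟩, VanishOn.add (sum_mul_vanish hg _) ?_, rfl⟩
      intro p
      rw [hμ, map_mul, h.eval_eq, zero_mul]
    · rintro ⟨x, hx, rfl⟩
      obtain ⟨u, hu, hu'⟩ := h.exists_lift hg (d' := e) rfl x.2 hx
      obtain ⟨s, hs, e1⟩ := exists_form_of_dvd h.mem
        (Submodule.sub_mem _ x.2 (sum_mul_mem hg hu rfl)) hu' rfl
      refine ⟨(fun j => ⟨u j, hu j⟩, ⟨s, hs⟩), ?_⟩
      simp only [ψ, LinearMap.coprod_apply, hμ, hφ, Submodule.subtype_apply]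
      rw [← e1]
      ring
  have h2 : Module.finrank k (LinearMap.ker ψ) = Module.finrank k (piece (relMod f g) e) := by
    let π : LinearMap.ker ψ →ₗ[k] (Fin (2 * n + 3) → forms k e) :=
      LinearMap.fst k _ _ ∘ₗ Submodule.subtype _
    have hπ : Function.Injective π := by
      rintro ⟨⟨w, s⟩, hq⟩ ⟨⟨w', s'⟩, hq'⟩ hh
      have hh : w = w' := hh
      subst hh
      rw [LinearMap.mem_ker] at hq hq'
      simp only [ψ, LinearMap.coprod_apply] at hq hq'
      have h3 : μ s = μ s' := by
        rw [← hq'] at hq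
        exact add_left_cancel hq
      have h4 : s = s' := Subtype.ext (mul_left_cancel₀ h.prime.ne_zero h3)
      subst h4
      rfl
    have h3 : LinearMap.range π = piece (relMod f g) e := by
      ext w
      rw [mem_piece, mem_relMod]
      constructor
      · rintro ⟨⟨⟨w, s⟩, hq⟩, rfl⟩
        rw [LinearMap.mem_ker] at hq
        simp only [ψ, LinearMap.coprod_apply] at hq
        refine ⟨-s, ?_⟩
        have := eq_neg_of_add_eq_zero_left hq
        rw [hμ, hφ] at this
        rw [mul_neg, ← this]
        rfl
      · intro hw
        obtain ⟨s, hs, e1⟩ := exists_form_of_dvd h.mem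
          (sum_mul_mem hg (fun j => (w j).2) rfl) hw rfl
        refine ⟨⟨(w, ⟨-s, Submodule.neg_mem _ hs⟩), ?_⟩, rfl⟩
        rw [LinearMap.mem_ker]
        simp only [ψ, LinearMap.coprod_apply, hμ, hφ]
        rw [e1]
        ring
    rw [← h3, LinearMap.finrank_range_of_inj hπ]
  have h3 := ψ.finrank_range_add_finrank_ker
  rw [h1, h2, (Submodule.equivMapOfInjective _ (Submodule.injective_subtype _) _).symm.finrank_eq,
    Module.finrank_prod, finrank_formTuple, finrank_forms] at h3
  have h4 := h.finrank_vanishingForms (d := (e : ℤ) + (n + 1)) (by lia)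
  have a1 : ((e : ℤ) + (n + 1) + 3).toNat = e + n + 4 := by lia
  have a2 : ((e : ℤ) + (n + 1) - 3 + 3).toNat = e + n + 1 := by lia
  have a3 : ((e : ℤ) + 3).toNat = e + 3 := by lia
  rw [a1] at h4
  rw [a2, a3] at h3
  lia

end PointData

end

section

variable {k : Type} [Field k]

namespace PointData

variable {f : R4 k} {n m : ℕ} {v : Fin m → Fin 4 → k} {g : Fin (2 * n + 3) → R4 k}

/-- A matrix of linear forms whose rows minimally generate the relations of `g` modulo `f`. -/
structure Syz (f : R4 k) (n : ℕ) (g : Fin (2 * n + 3) → R4 k)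
    (M : Fin (3 * (n + 1)) → Fin (2 * n + 3) → R4 k) : Prop where
  form : ∀ i, FormTuple 1 (M i)
  mem : ∀ i, M i ∈ relMod f g
  indep : ∀ c : Fin (3 * (n + 1)) → k, (∀ j, ∑ i, C (c i) * M i j = 0) → c = 0
  span : ∀ e w, FormTuple e w → w ∈ relMod f g →
    ∃ u, FormTuple (e - 1) u ∧ ∀ j, w j = ∑ i, u i * M i j

theorem two_mul_card (h : PointData f n v) : (2 * m : ℤ) = 3 * ((n + 1) * n) + 2 * (n + 1) := by
  have e5 : 2 * ((n + 1) * n / 2) = (n + 1) * n :=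
    Nat.mul_div_cancel' (by
      have := Nat.even_mul_succ_self n
      rw [mul_comm]
      exact this.two_dvd)
  have e6 := h.card
  zify at *
  linear_combination 2 * e6 + 3 * e5

theorem six_mul_finrank_relMod (h : PointData f n v) (hg : Gens f n v g) (e : ℕ) :
    (6 : ℤ) * Module.finrank k (piece (relMod f g) ((e + 1 : ℕ) : ℤ)) =
      (2 * n + 3) * ((e + 4) * (e + 3) * (e + 2)) - 9 * e ^ 2 - (18 * n + 45) * e
        - 54 - 30 * n := by
  have e1 := h.finrank_relMod hg (e + 1)
  have e2 := six_mul_choose_three (e + n + 3)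
  have e3 := six_mul_choose_three (e + 2)
  have e4 := six_mul_choose_three (e + n)
  have e5 := h.two_mul_card
  have a1 : e + 1 + n + 4 = e + n + 3 + 2 := by ring
  have a2 : e + 1 + n + 1 = e + n + 2 := by ring
  rw [a1, a2] at e1
  zify at *
  linear_combination 6 * e1 - e2 + (2 * n + 3) * e3 + e4 + 3 * e5

theorem exists_syz (h : PointData f n v) (hg : Gens f n v g) : ∃ M, Syz f n g M := by
  have h1 := h.six_mul_finrank_relMod hg 0
  have h2 : Module.finrank k (piece (relMod f g) 1) = 3 * (n + 1) := by
    have : (((0 + 1 : ℕ)) : ℤ) = 1 := rfl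
    rw [this] at h1
    push_cast at h1
    lia
  obtain ⟨M, hM, hN, hi, hs⟩ := exists_rows h2 (fun e he w hw hwN => relMod_low hg he hw hwN)
    (fun e he w hw hwN => h.relMod_step hg he hw hwN)
  exact ⟨M, hM, hN, hi, hs⟩

variable {M : Fin (3 * (n + 1)) → Fin (2 * n + 3) → R4 k}

theorem exists_rowRel_field (h : PointData f n v) (hg : Gens f n v g) (hM : Syz f n g M)
    {e : ℤ} (he : 0 < e) {u : Fin (3 * (n + 1)) → R4 k} (hu : FormTuple e u)
    (huN : u ∈ rowRel M) :
    ∃ (z : Fin 4 → Fin (3 * (n + 1)) → R4 k) (U : Fin 6 → Fin (2 * n + 3) → R4 k)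
      (F : Fin 4 → R4 k), (∀ l, FormTuple (e - 1) (z l)) ∧ (∀ i, u i = ∑ l, X l * z l i) ∧
      (∀ α, FormTuple (e - 1) (U α)) ∧
      (∀ l j, ∑ i, z l i * M i j = wedge₂ X (fun α => U α j) l) ∧ FormTuple (e + n - 1) F ∧
      (∀ α, f ∣ ∑ j, U α j * g j - wedge X F α) ∧ ∀ α, VanishOn v (wedge X F α) := by
  obtain ⟨z, hz, hz'⟩ := exists_forms_sum_X he hu
  have h1 : ∀ j, FormTuple e (fun l => ∑ i, z l i * M i j) := fun j l =>
    Submodule.sum_mem _ fun i _ => mul_mem_forms (hz l i) (hM.form i j) (by ring)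
  have h2 : ∀ j, ∑ l, X l * ∑ i, z l i * M i j = 0 := by
    intro j
    rw [← huN j]
    simp only [hz', Finset.mul_sum, Finset.sum_mul]
    rw [Finset.sum_comm]
    simp only [mul_assoc]
  have h3 := fun j => exists_forms_wedge₂ (h1 j) (h2 j) rfl
  choose U hU hU' using h3
  have h4 : FormTuple (e + n) (fun α => ∑ j, U j α * g j) := fun α =>
    sum_mul_mem hg (fun j => hU j α) (by ring)
  have h5 : ∀ l, f ∣ wedge₂ X (fun α => ∑ j, U j α * g j) l := by
    intro l
    have h6 := map_sum_mul (wedge₂L X) (fun α j => U j α) g l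
    have h7 : ∀ j, wedge₂L X (fun α => U j α) l = ∑ i, z l i * M i j := fun j =>
      (congrFun (hU' j) l).symm
    have h8 : wedge₂ X (fun α => ∑ j, U j α * g j) l
        = wedge₂L X (fun α => ∑ j, U j α * g j) l := rfl
    rw [h8, h6]
    simp only [h7]
    have h9 : ∑ j, (∑ i, z l i * M i j) * g j = ∑ i, z l i * ∑ j, M i j * g j := by
      simp only [Finset.mul_sum, Finset.sum_mul]
      rw [Finset.sum_comm]
      simp only [mul_assoc]
    rw [h9]
    exact Finset.dvd_sum fun i _ => Dvd.dvd.mul_left (mem_relMod.mp (hM.mem i)) _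
  obtain ⟨F, hF, hF'⟩ := h.exists_wedge_mod h4 h5
  exact ⟨z, fun α j => U j α, F, hz, hz', fun α j => hU j α, fun l j => congrFun (hU' j) l,
    hF, hF', fun α => VanishOn.of_dvd_sub h (sum_mul_vanish hg (fun j => U j α)) (hF' α)⟩

theorem sub_wedge_mem_relMod {U : Fin 6 → Fin (2 * n + 3) → R4 k} {F : Fin 4 → R4 k} {A : R4 k}
    {φ : Fin 4 → Fin (2 * n + 3) → R4 k} (hU : ∀ α, f ∣ ∑ j, U α j * g j - wedge X F α)
    (hF : ∀ l, f ∣ F l - A * X l - ∑ j, φ l j * g j) (α : Fin 6) :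
    (fun j => U α j - wedge X (fun l => φ l j) α) ∈ relMod f g := by
  rw [mem_relMod]
  have h6 := map_sum_mul (wedgeL X) φ g α
  have h7 := dvd_map (wedgeL X) hF α
  have h8 : wedgeL X (fun l => F l - A * X l - ∑ j, φ l j * g j)
      = wedge X F - wedgeL X (fun l => ∑ j, φ l j * g j) := by
    have : (fun l => F l - A * X l - ∑ j, φ l j * g j)
        = F - A • X - fun l => ∑ j, φ l j * g j := rfl
    rw [this, map_sub, map_sub, map_smul]
    have : wedgeL (X : Fin 4 → R4 k) X = 0 := by
      rw [show wedgeL (X : Fin 4 → R4 k) X = wedge X X from rfl, wedge_eq_zero_iff]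
      exact fun i j => mul_comm _ _
    rw [this, smul_zero, sub_zero]
    rfl
  rw [h8, Pi.sub_apply, h6] at h7
  have h9 : ∑ j, (U α j - wedge X (fun l => φ l j) α) * g j
      = (∑ j, U α j * g j - wedge X F α)
        + (wedge X F α - ∑ j, wedgeL X (fun l => φ l j) α * g j) := by
    simp only [sub_mul, Finset.sum_sub_distrib]
    have : ∀ j, wedgeL X (fun l => φ l j) α = wedge X (fun l => φ l j) α := fun _ => rfl
    simp only [this]
    ring
  rw [h9]
  exact dvd_add (hU α) h7

theorem wedge_eval_eq_zero {F : Fin 4 → R4 k} (hF : ∀ α, VanishOn v (wedge X F α)) (p : Fin m) :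
    wedge (v p) (fun i => eval (v p) (F i)) = 0 := by
  funext α
  have h5 := map_wedge (eval (v p)) X F α
  simp only [eval_X] at h5
  rw [← h5, hF α p]
  rfl

theorem rowRel_low (h : PointData f n v) (hg : Gens f n v g) (hM : Syz f n g M) {e : ℤ}
    (he : e < 2) {u : Fin (3 * (n + 1)) → R4 k} (hu : FormTuple e u) (huN : u ∈ rowRel M) :
    u = 0 := by
  have hconst : ∀ u : Fin (3 * (n + 1)) → R4 k, FormTuple 0 u → u ∈ rowRel M → u = 0 := by
    intro u hu huN
    have h1 := fun j => exists_C_of_mem_forms_zero (hu j)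
    choose c hc using h1
    have h2 := hM.indep c (fun j => by
      have h3 := mem_rowRel.mp huN j
      simpa only [hc] using h3)
    funext j
    rw [hc j, h2]
    simp
  rcases lt_trichotomy e 0 with h0 | h0 | h0
  · exact funext fun j => eq_zero_of_mem_forms_neg h0 (hu j)
  · subst h0
    exact hconst u hu huN
  · obtain rfl : e = 1 := by lia
    obtain ⟨z, U, F, hz, hz', hU, hU', hF, hF', hFv⟩ := h.exists_rowRel_field hg hM h0 hu huN
    obtain ⟨A, hA⟩ := h.rigid F (by simpa using hF) (by
      rintro _ ⟨p, rfl⟩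
      exact wedge_eval_eq_zero hFv p)
    have h1 : ∀ α, U α ∈ relMod f g := by
      intro α
      have h2 := sub_wedge_mem_relMod (φ := 0) (A := A) hF' (fun l => by simpa using hA l) α
      have h3 : ∀ j, wedge X (fun l => (0 : Fin 4 → Fin (2 * n + 3) → R4 k) l j) α = 0 := by
        intro j
        fin_cases α <;> simp [wedge]
      simpa only [h3, sub_zero] using h2
    have h4 : ∀ α, U α = 0 := fun α => relMod_low hg (by norm_num) (hU α) (h1 α)
    have h5 : ∀ l, z l = 0 := fun l => hconst _ (hz l) (fun j => by
      rw [hU' l j]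
      simp only [h4]
      fin_cases l <;> simp [wedge₂])
    funext i
    rw [hz' i]
    simp [h5]

theorem exists_multiplier (h : PointData f n v) {d : ℤ} (hd : n + 2 ≤ d) {F : Fin 4 → R4 k}
    (hF : ∀ α, VanishOn v (wedge X F α)) :
    ∃ σ ∈ forms k (d - 1), ∀ l, VanishOn v (F l - σ * X l) := by
  have h1 := fun p => exists_smul_of_wedge_eq_zero (h.ne_zero p) (wedge_eval_eq_zero hF p)
  choose c hc using h1
  obtain ⟨σ, hσ, hσ'⟩ := h.exists_form (d := d - 1) (by lia) c
  refine ⟨σ, hσ, fun l p => ?_⟩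
  have := congrFun (hc p) l
  simp only [Pi.smul_apply, smul_eq_mul] at this
  rw [map_sub, map_mul, eval_X, hσ' p, this, sub_self]

theorem rowRel_step (h : PointData f n v) (hg : Gens f n v g) (hM : Syz f n g M) {e : ℤ}
    (he : 2 < e) {u : Fin (3 * (n + 1)) → R4 k} (hu : FormTuple e u) (huN : u ∈ rowRel M) :
    ∃ u' : Fin 4 → Fin (3 * (n + 1)) → R4 k,
      (∀ l, FormTuple (e - 1) (u' l) ∧ u' l ∈ rowRel M) ∧ ∀ j, u j = ∑ l, X l * u' l j := by
  obtain ⟨z, U, F, hz, hz', hU, hU', hF, hF', hFv⟩ := h.exists_rowRel_field hg hM (by lia) hu huN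
  obtain ⟨σ, hσ, hσ'⟩ := h.exists_multiplier (d := e + n - 1) (by lia) hFv
  have h1 : FormTuple (e + n - 1) (fun l => F l - σ * X l) := fun l =>
    Submodule.sub_mem _ (hF l) (mul_mem_forms hσ (X_mem_forms l) (by ring))
  obtain ⟨φ, hφ, hφ'⟩ := h.exists_lift_tuple hg (d' := e - 2) (by ring) h1 hσ'
  have h2 := sub_wedge_mem_relMod hF' hφ'
  have h3 : ∀ α, FormTuple (e - 1) (fun j => U α j - wedge X (fun l => φ l j) α) := fun α j =>
    Submodule.sub_mem _ (hU α j) (FormTuple.wedge (fun l => hφ l j) (by ring) α)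
  have h4 := fun α => hM.span _ _ (h3 α) (h2 α)
  choose μ hμ hμ' using h4
  refine ⟨fun l i => z l i - wedge₂ X (fun α => μ α i) l, fun l => ⟨fun i =>
    Submodule.sub_mem _ (hz l i) (FormTuple.wedge₂ (fun α => hμ α i) (by ring) l), fun j => ?_⟩,
    fun j => ?_⟩
  · have h5 := map_sum_mul (wedge₂L X) μ (fun i => M i j) l
    have h6 : (fun α => ∑ i, μ α i * M i j)
        = (fun α => U α j) - wedge X (fun l => φ l j) := funext fun α => (hμ' α j).symm
    rw [h6, map_sub] at h5
    have h7 : wedge₂L X (wedge X (fun l => φ l j)) = 0 := wedge₂_wedge X _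
    rw [h7, sub_zero] at h5
    simp only [sub_mul, Finset.sum_sub_distrib]
    rw [hU' l j]
    exact sub_eq_zero.mpr h5
  · simp only [mul_sub, Finset.sum_sub_distrib]
    rw [sum_mul_wedge₂, sub_zero, hz']

theorem six_mul_finrank_rowRel (h : PointData f n v) (hg : Gens f n v g) (hM : Syz f n g M)
    (e : ℕ) : (6 : ℤ) * Module.finrank k (piece (rowRel M) ((e + 2 : ℕ) : ℤ)) =
      n * ((e + 3) * (e + 2) * (e + 1)) := by
  have e1 := finrank_rowRel (e := ((e + 2 : ℕ) : ℤ)) (e' := ((e + 2 + 1 : ℕ) : ℤ))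
    hM.form hM.mem hM.span (by push_cast; ring)
  have e2 := h.six_mul_finrank_relMod hg (e + 2)
  have e3 := six_mul_choose_three (e + 3)
  have a1 : (((e + 2 : ℕ) : ℤ) + 3).toNat = e + 3 + 2 := by lia
  rw [a1] at e1
  zify at e1 e2 e3
  push_cast at *
  linear_combination 6 * e1 - e2 + 3 * (n + 1) * e3

theorem exists_secondSyz (h : PointData f n v) (hg : Gens f n v g) (hM : Syz f n g M) :
    ∃ N : Fin n → Fin (3 * (n + 1)) → R4 k, (∀ i, FormTuple 2 (N i)) ∧ (∀ i, N i ∈ rowRel M) ∧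
      (∀ u ∈ rowRel M, ∃ t : Fin n → R4 k, ∀ i, u i = ∑ l, t l * N l i) ∧ 
      ∀ t ∈ rowRel N, t = 0 := by
  have h1 := h.six_mul_finrank_rowRel hg hM 0
  have h2 : Module.finrank k (piece (rowRel M) 2) = n := by
    have : (((0 + 2 : ℕ)) : ℤ) = 2 := rfl
    rw [this] at h1
    push_cast at h1
    lia
  obtain ⟨N, hN, hNM, _, hs⟩ := exists_rows h2
    (fun e he w hw hwN => h.rowRel_low hg hM he hw hwN)
    (fun e he w hw hwN => h.rowRel_step hg hM he hw hwN)
  refine ⟨N, hN, hNM, fun u hu => exists_rows_of_mem (graded_rowRel hM.form) hs u hu,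
    fun t ht => ?_⟩
  have h3 : ∀ e : ℕ, piece (rowRel N) (e : ℤ) = ⊥ := by
    intro e
    have e1 := finrank_rowRel (e := (e : ℤ)) (e' := ((e + 2 : ℕ) : ℤ)) hN hNM hs rfl
    have e2 := h.six_mul_finrank_rowRel hg hM e
    have e3 := six_mul_choose_three (e + 1)
    have a1 : ((e : ℤ) + 3).toNat = e + 1 + 2 := by lia
    rw [a1] at e1
    have e4 : (6 : ℤ) * Module.finrank k (piece (rowRel N) (e : ℤ)) = 0 := by
      zify at e1 e3
      push_cast at *
      linear_combination 6 * e1 - e2 + n * e3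
    have e5 : Module.finrank k (piece (rowRel N) (e : ℤ)) = 0 := by lia
    exact Submodule.finrank_eq_zero.mp e5
  funext l
  rw [← sum_comp (t l) (Nat.lt_succ_self _)]
  refine Finset.sum_eq_zero fun d _ => ?_
  have h4 := graded_rowRel hN t ht d
  have h5 : (fun l => (⟨comp k d (t l), comp_mem _ _⟩ : forms k d)) ∈ piece (rowRel N) d := h4
  rw [h3, Submodule.mem_bot] at h5
  exact congrArg Subtype.val (congrFun h5 l)

end PointData

end

section

variable {k : Type} [Field k]

theorem eval_smul_of_isHomogeneous {σ : Type*} [Fintype σ] {p : MvPolynomial σ k} {d : ℕ}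
    (hp : p.IsHomogeneous d) (c : k) (v : σ → k) : eval (c • v) p = c ^ d * eval v p := by
  rw [eval_eq', eval_eq', Finset.mul_sum]
  refine Finset.sum_congr rfl fun s hs => ?_
  have h1 : ∑ i, s i = d := by
    have := hp (mem_support_iff.mp hs)
    rw [Finsupp.weight_apply, Finsupp.sum_fintype _ _ (by simp)] at this
    simpa using this
  simp only [Pi.smul_apply, smul_eq_mul, mul_pow, Finset.prod_mul_distrib, Finset.prod_pow_eq_pow_sum,
    h1]
  ring

theorem vanishesAt_mk_of_isHomogeneous {p : R4 k} {d : ℕ} (hp : p.IsHomogeneous d) {v : Fin 4 → k}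
    (hv : v ≠ 0) (h : eval v p = 0) : VanishesAt k p (Projectivization.mk k v hv) := by
  intro w hw hmk
  rw [Projectivization.mk_eq_mk_iff'] at hmk
  obtain ⟨c, rfl⟩ := hmk
  rw [eval_smul_of_isHomogeneous hp, h, mul_zero]

theorem eval_comp_eq_zero [Infinite k] {p : R4 k} {v : Fin 4 → k}
    (hv : v ≠ 0) (h : VanishesAt k p (Projectivization.mk k v hv)) (d : ℕ) :
    eval v (comp k d p) = 0 := by
  let N := p.totalDegree + 1
  let q : Polynomial k := ∑ i ∈ Finset.range N, Polynomial.C (eval v (comp k i p)) * Polynomial.X ^ i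
  have h1 : ∀ c : k, q.eval c = eval (c • v) p := by
    intro c
    conv_rhs => rw [← sum_comp p (Nat.lt_succ_self _)]
    rw [map_sum, Polynomial.eval_finsetSum]
    refine Finset.sum_congr rfl fun i _ => ?_
    rw [eval_smul_of_isHomogeneous (mem_forms_natCast.mp (comp_mem _ _))]
    rw [Polynomial.eval_mul, Polynomial.eval_C, Polynomial.eval_pow, Polynomial.eval_X, mul_comm]
  have h2 : Polynomial.X * q = 0 := by
    refine Polynomial.funext fun c => ?_
    rw [Polynomial.eval_mul, Polynomial.eval_X, Polynomial.eval_zero, h1]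
    by_cases hc : c = 0
    · rw [hc, zero_mul]
    · rw [h (c • v) (smul_ne_zero hc hv), mul_zero]
      rw [Projectivization.mk_eq_mk_iff']
      exact ⟨c, rfl⟩
  have h3 : q = 0 := by simpa using h2
  rcases lt_or_ge d N with hd | hd
  · have h4 : q.coeff d = eval v (comp k d p) := by
      simp only [q, Polynomial.finsetSum_coeff, Polynomial.coeff_C_mul_X_pow]
      rw [Finset.sum_ite_eq (Finset.range N) d, if_pos (Finset.mem_range.mpr hd)]
    rw [← h4, h3, Polynomial.coeff_zero]
  · have h4 : comp k d p = 0 := by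
      ext m
      rw [coeff_comp, coeff_zero]
      split_ifs with hm
      · by_contra hne
        have := le_totalDegree (mem_support_iff.mpr hne)
        change m.degree ≤ _ at this
        have : d < N := by lia
        lia
      · rfl
    rw [h4, map_zero]

theorem entryOk_of_mem_forms {c e d : ℕ} (hc : 0 < c) (hd : d = e + c) {q : R4 k}
    (hq : q ∈ forms k c) : EntryOk k d e q := by
  refine ⟨Or.inr ⟨c, hd, mem_forms_natCast.mp hq⟩, ?_⟩
  by_contra h
  have := hq 0 h
  simp at this
  lia

theorem PointData.hasMinFreeRes3 [Infinite k] {f : R4 k} {n m : ℕ} {v : Fin m → Fin 4 → k}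
    (h : PointData f n v) (hv : ∀ i, v i ≠ 0) {Z : Fin m → P3 k}
    (hZ : ∀ i, Projectivization.mk k (v i) (hv i) = Z i) :
    HasMinFreeRes3 k (Ideal.span {f}) (pointsIdeal k (Set.range Z))
      (fun _ : Fin (2 * n + 3) => n + 1) (fun _ : Fin (3 * (n + 1)) => n + 2)
      (fun _ : Fin n => n + 4) := by
  obtain ⟨g, hg⟩ := h.exists_gens
  obtain ⟨M, hM⟩ := h.exists_syz hg
  obtain ⟨N, hN, hNM, hspan, hinj⟩ := h.exists_secondSyz hg hM
  have hgf : ∀ j, (g j).IsHomogeneous (n + 1) := fun j =>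
    mem_forms_natCast.mp (by exact_mod_cast hg.form j)
  refine ⟨g, M, N, fun j => ⟨?_, hgf j⟩, fun x hx => ?_, fun i j => ?_, fun i j => ?_,
    fun w => ?_, fun u => ⟨fun hu => hspan u hu, ?_⟩, fun t ht => hinj t ht⟩
  · rintro _ ⟨p, rfl⟩
    rw [← hZ p]
    exact vanishesAt_mk_of_isHomogeneous (hgf j) (hv p) (hg.vanish j p)
  · have h1 : ∀ d : ℕ, VanishOn v (comp k d x) := by
      intro d p
      have := hx (Z p) ⟨p, rfl⟩
      rw [← hZ p] at this
      exact eval_comp_eq_zero (hv p) this d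
    have h2 := fun d : ℕ => h.exists_lift hg (sub_add_cancel (d : ℤ) _) (comp_mem _ x) (h1 d)
    choose u _ hu using h2
    refine ⟨fun j => ∑ d ∈ Finset.range (x.totalDegree + 1), u d j, ?_⟩
    rw [Ideal.mem_span_singleton]
    have h3 : x - ∑ j, (∑ d ∈ Finset.range (x.totalDegree + 1), u d j) * g j
        = ∑ d ∈ Finset.range (x.totalDegree + 1), (comp k d x - ∑ j, u d j * g j) := by
      rw [Finset.sum_sub_distrib, sum_comp x (Nat.lt_succ_self _), Finset.sum_comm]
      simp only [Finset.sum_mul]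
    rw [h3]
    exact Finset.dvd_sum fun d _ => hu d
  · exact entryOk_of_mem_forms one_pos rfl (hM.form i j)
  · exact entryOk_of_mem_forms two_pos rfl (hN i j)
  · rw [Ideal.mem_span_singleton]
    constructor
    · intro hw
      exact exists_rows_of_mem (graded_relMod h.mem hg.form) hM.span w hw
    · rintro ⟨u, hu⟩
      have : w = ∑ i, u i • M i := by
        funext j
        simp [hu j]
      exact mem_relMod.mp (this ▸ Submodule.sum_mem _ fun i _ => Submodule.smul_mem _ _ (hM.mem i))
  · rintro ⟨t, ht⟩
    have : u = ∑ i, t i • N i := by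
      funext j
      simp [ht j]
    exact mem_rowRel.mp (this ▸ Submodule.sum_mem _ fun i _ => Submodule.smul_mem _ _ (hNM i))

end

section

variable {k : Type} [Field k]

/-- The conditions imposed by a point on a vector field, as polynomials in the points. -/
noncomputable def genericWedge (t : ℕ) (F : Fin 4 → R4 k) (p : Fin t) (α : Fin 6) :
    MvPolynomial (Fin t × Fin 4) k :=
  wedge (fun i => X (p, i)) (fun i => rename (fun l => (p, l)) (F i)) α

theorem eval_genericWedge {t : ℕ} (F : Fin 4 → R4 k) (p : Fin t) (α : Fin 6)
    (v : Fin t → Fin 4 → k) :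
    eval (fun q : Fin t × Fin 4 => v q.1 q.2) (genericWedge t F p α)
      = wedge (v p) (fun i => eval (v p) (F i)) α := by
  unfold genericWedge
  rw [map_wedge]
  simp only [eval_X, eval_rename]
  rfl

/-- The wedges of the values of a vector field with the points. -/
noncomputable def wedgeEval (k : Type) [Field k] (n : ℤ) {t : ℕ} (v : Fin t → Fin 4 → k) :
    (Fin 4 → forms k n) →ₗ[k] (Fin t × Fin 6 → k) where
  toFun F q := wedge (v q.1) (fun i => eval (v q.1) (F i : R4 k)) q.2
  map_add' F G := by
    funext q
    have : (fun i => eval (v q.1) ((F + G) i : R4 k))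
        = (fun i => eval (v q.1) (F i : R4 k)) + fun i => eval (v q.1) (G i : R4 k) := by
      funext i
      simp
    rw [this, wedge_add]
    rfl
  map_smul' c F := by
    funext q
    have : (fun i => eval (v q.1) ((c • F) i : R4 k))
        = c • fun i => eval (v q.1) (F i : R4 k) := by
      funext i
      simp [smul_eval]
    rw [this, wedge_smul]
    rfl

theorem wedgeEval_apply {n : ℤ} {t : ℕ} (v : Fin t → Fin 4 → k) (F : Fin 4 → forms k n)
    (q : Fin t × Fin 6) :
    wedgeEval k n v F q = wedge (v q.1) (fun i => eval (v q.1) (F i : R4 k)) q.2 := rfl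

theorem wedgeEval_eq_zero_of_mem_radial {f : R4 k} {n : ℤ} {t : ℕ} {v : Fin t → Fin 4 → k}
    (hv : ∀ p, eval (v p) f = 0) {F : Fin 4 → forms k n} (hF : F ∈ radial f n) :
    wedgeEval k n v F = 0 := by
  obtain ⟨A, hA⟩ := hF
  funext q
  have h1 : (fun i => eval (v q.1) (F i : R4 k)) = fun i => eval (v q.1) A * v q.1 i := by
    funext i
    obtain ⟨s, hs⟩ := hA i
    have := congrArg (eval (v q.1)) hs
    rw [map_sub, map_mul, map_mul, hv, zero_mul, eval_X, sub_eq_zero] at this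
    exact this
  rw [wedgeEval_apply, h1, wedge_smul_self]
  rfl

theorem rigid_range_iff {f : R4 k} {n : ℤ} {t : ℕ} {v : Fin t → Fin 4 → k} :
    Rigid f n (Set.range v) ↔ ∀ F, wedgeEval k n v F = 0 → F ∈ radial f n := by
  constructor
  · intro h F hF
    refine h (fun i => F i) (fun i => (F i).2) ?_
    rintro _ ⟨p, rfl⟩
    funext α
    exact congrFun hF (p, α)
  · intro h F hF hv
    refine h (fun i => ⟨F i, hF i⟩) (funext fun q => ?_)
    exact congrFun (hv _ ⟨q.1, rfl⟩) q.2

theorem exists_matrix_leftInverse {E ι : Type*} [AddCommGroup E] [Module k E]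
    [FiniteDimensional k E] [Fintype ι] {J : Submodule k E} {Φ : E →ₗ[k] (ι → k)}
    (h : ∀ x, Φ x = 0 → x ∈ J) :
    ∃ (N : ℕ) (b : Fin N → E) (P : Matrix (Fin N) ι k),
      (∀ x, ∃ c : Fin N → k, x - ∑ j, c j • b j ∈ J) ∧
      P * Matrix.of (fun q j => Φ (b j) q) = 1 := by
  classical
  obtain ⟨D, hD⟩ := Submodule.exists_isCompl J
  let b := Module.finBasis k D
  have h1 : LinearMap.ker (Φ ∘ₗ D.subtype) = ⊥ := by
    rw [LinearMap.ker_eq_bot']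
    intro F hF
    have h2 : (F : E) ∈ J ⊓ D := ⟨h _ hF, F.2⟩
    rw [hD.inf_eq_bot, Submodule.mem_bot] at h2
    exact Subtype.ext h2
  obtain ⟨π, hπ⟩ := LinearMap.exists_leftInverse_of_injective _ h1
  refine ⟨_, fun j => b j, LinearMap.toMatrix (Pi.basisFun k _) b π, fun x => ?_, ?_⟩
  · obtain ⟨r, hr, d, hd, rfl⟩ := Submodule.mem_sup.mp
      (show x ∈ J ⊔ D by rw [hD.sup_eq_top]; trivial)
    refine ⟨b.repr ⟨d, hd⟩, ?_⟩
    have h3 := congrArg Subtype.val (b.sum_repr ⟨d, hd⟩)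
    rw [Submodule.coe_sum] at h3
    simp only [Submodule.coe_smul] at h3
    rw [h3, add_sub_cancel_right]
    exact hr
  · rw [← LinearMap.toMatrix_id b, ← hπ, LinearMap.toMatrix_comp b (Pi.basisFun k _) b]
    congr 1
    ext q j
    rw [LinearMap.toMatrix_apply, Pi.basisFun_repr]
    rfl

theorem exists_eval_eq_det {σ ι : Type*} [Fintype ι] {N : ℕ} (P : Matrix (Fin N) ι k)
    (Φ : Matrix ι (Fin N) (MvPolynomial σ k)) :
    ∃ g : MvPolynomial σ k, ∀ x : σ → k, eval x g = (P * Φ.map (eval x)).det := by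
  refine ⟨Matrix.det (Matrix.of fun i j => ∑ q, C (P i q) * Φ q j), fun x => ?_⟩
  rw [RingHom.map_det]
  congr 1
  ext i j
  simp [Matrix.mul_apply]

/-- Rigidity is an open condition on the points. -/
theorem exists_rigid_open {f : R4 k} {n : ℤ} {t : ℕ} {v₀ : Fin t → Fin 4 → k}
    (h : Rigid f n (Set.range v₀)) :
    ∃ g : MvPolynomial (Fin t × Fin 4) k,
      eval (fun q : Fin t × Fin 4 => v₀ q.1 q.2) g ≠ 0 ∧
      ∀ v : Fin t → Fin 4 → k, (∀ p, eval (v p) f = 0) →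
        eval (fun q : Fin t × Fin 4 => v q.1 q.2) g ≠ 0 → Rigid f n (Set.range v) := by
  rw [rigid_range_iff] at h
  obtain ⟨N, b, P, hb, hP⟩ := exists_matrix_leftInverse h
  let Φ : Matrix (Fin t × Fin 6) (Fin N) (MvPolynomial (Fin t × Fin 4) k) :=
    Matrix.of fun q j => genericWedge t (fun i => (b j i : R4 k)) q.1 q.2
  have h2 : ∀ v : Fin t → Fin 4 → k, Φ.map (eval (fun q : Fin t × Fin 4 => v q.1 q.2))
      = Matrix.of (fun q j => wedgeEval k n v (b j) q) := by
    intro v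
    ext q j
    exact eval_genericWedge (fun i => (b j i : R4 k)) q.1 q.2 v
  obtain ⟨g, hg⟩ := exists_eval_eq_det P Φ
  refine ⟨g, ?_, fun v hv hg' => ?_⟩
  · rw [hg, h2, hP, Matrix.det_one]
    exact one_ne_zero
  · rw [hg, h2] at hg'
    rw [rigid_range_iff]
    intro F hF
    obtain ⟨c, hc⟩ := hb F
    have h3 := wedgeEval_eq_zero_of_mem_radial hv hc
    rw [map_sub, hF, zero_sub, neg_eq_zero, map_sum] at h3
    have h4 : (P * Matrix.of (fun q j => wedgeEval k n v (b j) q)).mulVec c = 0 := by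
      rw [← Matrix.mulVec_mulVec]
      have h5 : (Matrix.of (fun q j => wedgeEval k n v (b j) q)).mulVec c = 0 := by
        rw [← h3]
        funext q
        simp [Matrix.mulVec, dotProduct, Finset.sum_apply, mul_comm]
      rw [h5, Matrix.mulVec_zero]
    have h6 := Matrix.eq_zero_of_mulVec_eq_zero hg' h4
    simpa [h6] using hc

theorem smul_wedge_smul {A : Type*} [CommRing A] (c d : A) (x F : Fin 4 → A) :
    wedge (c • x) (d • F) = (c * d) • wedge x F := by
  funext i
  fin_cases i <;> simp [wedge] <;> ring

theorem Rigid.mono {f : R4 k} {n : ℕ} {Z Z' : Set (Fin 4 → k)} (h : Rigid f n Z)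
    (hZ : ∀ v ∈ Z, v ≠ 0 → ∃ c : k, ∃ w ∈ Z', v = c • w) : Rigid f n Z' := by
  intro F hF hv
  refine h F hF fun v hvZ => ?_
  by_cases hv0 : v = 0
  · subst hv0
    funext i
    fin_cases i <;> simp [wedge]
  · obtain ⟨c, w, hw, rfl⟩ := hZ v hvZ hv0
    have h1 : (fun i => eval (c • w) (F i)) = c ^ n • fun i => eval w (F i) := by
      funext i
      rw [eval_smul_of_isHomogeneous (mem_forms_natCast.mp (hF i))]
      rfl
    rw [h1, smul_wedge_smul, hv w hw, smul_zero]

theorem PointData.exists_of_rigid {f : R4 k} (hf : f ∈ forms k 3) (hp : Prime f) {n : ℕ}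
    (hn : 1 ≤ n) {m : ℕ} (hm : m = 3 * ((n + 1) * n / 2) + (n + 1))
    {Z : Finset (Fin 4 → k)} (hcard : Z.card ≤ m)
    (hZf : ∀ v ∈ Z, eval v f = 0) (hZ : Rigid f n Z) :
    ∃ (v : Fin m → Fin 4 → k) (hv : ∀ p, v p ≠ 0),
      PointData f n v ∧ Function.Injective fun p => Projectivization.mk k (v p) (hv p) := by
  classical
  let T : Finset (P3 k) := (Z.subtype fun v => v ≠ 0).image fun v => Projectivization.mk k v.1 v.2
  have hT : ∀ p ∈ T, ∃ w : Fin 4 → k, ∃ hw : w ≠ 0, Projectivization.mk k w hw = p ∧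
      eval w f = 0 := by
    intro p hp
    obtain ⟨⟨w, hw⟩, hwZ, rfl⟩ := Finset.mem_image.mp hp
    exact ⟨w, hw, rfl, hZf w (Finset.mem_subtype.mp hwZ)⟩
  have hTc : T.card ≤ m := by
    refine le_trans Finset.card_image_le (le_trans ?_ hcard)
    rw [Finset.card_subtype]
    exact Finset.card_filter_le _ _
  let e := T.equivFin
  have h1 := fun i => hT (e.symm i) (e.symm i).2
  choose v hv hv' hvf using h1
  have hinj : Function.Injective fun p => Projectivization.mk k (v p) (hv p) := by
    intro i j hij
    simp only [hv'] at hij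
    exact e.symm.injective (Subtype.ext hij)
  have hR : Rigid f n (Set.range v) := by
    refine hZ.mono fun w hw hw0 => ?_
    have h2 : Projectivization.mk k w hw0 ∈ T :=
      Finset.mem_image.mpr ⟨⟨w, hw0⟩, Finset.mem_subtype.mpr hw, rfl⟩
    have h3 := hv' (e ⟨_, h2⟩)
    rw [e.symm_apply_apply] at h3
    obtain ⟨c, hc⟩ := (Projectivization.mk_eq_mk_iff' ..).mp h3.symm
    exact ⟨c, _, ⟨e ⟨_, h2⟩, rfl⟩, hc.symm⟩
  have hc1 := four_mul_choose_le hf hp.ne_zero hv hR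
  have hc2 := choose_three_identity hn hm
  obtain rfl : m = T.card := by lia
  exact ⟨v, hv, ⟨hf, hp, hn, hv, hvf, hR, hm⟩, hinj⟩

/-- It suffices to exhibit one rigid configuration. -/
theorem generalPointsSatisfy_of_rigid [Infinite k] (S : SmoothCubicSurface k) {n : ℕ} (hn : 1 ≤ n)
    {m : ℕ} (hm : m = 3 * ((n + 1) * n / 2) + (n + 1)) {Z : Finset (Fin 4 → k)}
    (hcard : Z.card ≤ m) (hZf : ∀ v ∈ Z, eval v S.f = 0) (hZ : Rigid S.f n Z) :
    GeneralPointsSatisfy k S m (fun Z =>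
      HasMinFreeRes3 k (Ideal.span {S.f}) (pointsIdeal k (Set.range Z))
        (fun _ : Fin (2 * n + 3) => n + 1) (fun _ : Fin (3 * (n + 1)) => n + 2)
        (fun _ : Fin n => n + 4)) := by
  have hf : S.f ∈ forms k 3 := by exact_mod_cast mem_forms_natCast.mpr S.homog
  have hp : Prime S.f := S.irred.prime
  obtain ⟨v₀, hv₀, h₀, hinj⟩ := PointData.exists_of_rigid hf hp hn hm hcard hZf hZ
  obtain ⟨g, hg, hopen⟩ := exists_rigid_open h₀.rigid
  refine ⟨g, ⟨_, ⟨hinj, fun i => ?_⟩, v₀, fun i => ⟨hv₀ i, rfl⟩, hg⟩, ?_⟩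
  · exact vanishesAt_mk_of_isHomogeneous S.homog (hv₀ i) (h₀.eval_eq i)
  · rintro Z ⟨_, hZS⟩ ⟨v, hv, hgv⟩
    choose hv0 hvZ using hv
    have hvf : ∀ p, eval (v p) S.f = 0 := fun p => hZS p (v p) (hv0 p) (hvZ p)
    exact PointData.hasMinFreeRes3 ⟨hf, hp, hn, hv0, hvf, hopen v hvf hgv, hm⟩ hv0 hvZ

end

section

variable {k : Type} [Field k]

/-- Combinations of the monomials of degree `n` of degree at most two in `X 0` which are not
divisible by `X 2 * X 3`. -/
noncomputable def lowForm (k : Type) [Field k] (n : ℕ) :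
    ((Fin 3 → ℕ → k) × (Fin 3 → ℕ → k)) →ₗ[k] R4 k where
  toFun c := ∑ i : Fin 3, X 0 ^ (i : ℕ) *
    (∑ j ∈ Finset.range (n - i + 1), C (c.1 i j) * (X 1 ^ j * X 3 ^ (n - i - j)) +
      ∑ j ∈ Finset.range (n - i), C (c.2 i j) * (X 1 ^ j * X 2 ^ (n - i - j)))
  map_add' c d := by
    rw [← Finset.sum_add_distrib]
    refine Finset.sum_congr rfl fun i _ => ?_
    simp only [Prod.fst_add, Prod.snd_add, Pi.add_apply, C_add, add_mul, Finset.sum_add_distrib]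
    ring
  map_smul' a c := by
    rw [RingHom.id_apply, smul_eq_C_mul, Finset.mul_sum]
    refine Finset.sum_congr rfl fun i _ => ?_
    simp only [Prod.smul_fst, Prod.smul_snd, Pi.smul_apply, smul_eq_mul, C_mul, mul_assoc,
      ← Finset.mul_sum]
    ring

theorem lowForm_apply (n : ℕ) (c : (Fin 3 → ℕ → k) × (Fin 3 → ℕ → k)) :
    lowForm k n c = ∑ i : Fin 3, X 0 ^ (i : ℕ) *
    (∑ j ∈ Finset.range (n - i + 1), C (c.1 i j) * (X 1 ^ j * X 3 ^ (n - i - j)) +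
      ∑ j ∈ Finset.range (n - i), C (c.2 i j) * (X 1 ^ j * X 2 ^ (n - i - j))) := rfl

theorem monomial_one_eq (m : Fin 4 →₀ ℕ) :
    (monomial m 1 : R4 k) = X 0 ^ m 0 * X 1 ^ m 1 * X 2 ^ m 2 * X 3 ^ m 3 := by
  rw [monomial_eq, C_1, one_mul, Finsupp.prod_fintype _ _ (fun i => pow_zero _),
    Fin.prod_univ_four]

/-- The forms which are congruent to a combination of low monomials. -/
noncomputable def reducible₃ (f : R4 k) (n : ℕ) : Submodule k (R4 k) :=
  LinearMap.range (lowForm k n) ⊔ (Ideal.span {f, X 2 * X 3}).restrictScalars k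

theorem mem_reducible₃_of_mem {f : R4 k} {n : ℕ} {G : R4 k}
    (h : G ∈ Ideal.span {f, X 2 * X 3}) : G ∈ reducible₃ f n :=
  Submodule.mem_sup_right h

theorem monomial_mem_range_lowForm {n : ℕ} {m : Fin 4 →₀ ℕ} (h3 : m 0 < 3)
    (hm : m 0 + m 1 + m 2 + m 3 = n) (h : m 2 = 0 ∨ m 3 = 0) :
    (monomial m 1 : R4 k) ∈ LinearMap.range (lowForm k n) := by
  have key : ∀ c : (Fin 3 → ℕ → k) × (Fin 3 → ℕ → k),
      (∀ (i : Fin 3) (j : ℕ), (i : ℕ) ≠ m 0 ∨ j ≠ m 1 → c.1 i j = 0 ∧ c.2 i j = 0) →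
      lowForm k n c = X 0 ^ m 0 *
        ((if m 1 < n - m 0 + 1 then C (c.1 ⟨m 0, h3⟩ (m 1)) * (X 1 ^ m 1 * X 3 ^ (n - m 0 - m 1))
          else 0) +
        (if m 1 < n - m 0 then C (c.2 ⟨m 0, h3⟩ (m 1)) * (X 1 ^ m 1 * X 2 ^ (n - m 0 - m 1))
          else 0)) := by
    intro c hc
    have hs : ∀ (N : ℕ) (g : ℕ → R4 k), (∀ j, j ≠ m 1 → g j = 0) →
        ∑ j ∈ Finset.range N, g j = if m 1 < N then g (m 1) else 0 := by
      intro N g hg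
      rw [Finset.sum_eq_ite (m 1) fun j _ hj => hg j hj]
      simp only [Finset.mem_range]
    rw [lowForm_apply, Finset.sum_eq_single (⟨m 0, h3⟩ : Fin 3)]
    · rw [hs, hs]
      · intro j hj
        rw [(hc _ _ (Or.inr hj)).2, C_0, zero_mul]
      · intro j hj
        rw [(hc _ _ (Or.inr hj)).1, C_0, zero_mul]
    · intro i _ hi
      have h1 : (i : ℕ) ≠ m 0 := fun h => hi (Fin.ext h)
      have h2 := fun j => hc i j (Or.inl h1)
      simp only [(h2 _).1, (h2 _).2, C_0, zero_mul, Finset.sum_const_zero, add_zero, mul_zero]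
    · intro h
      exact absurd (Finset.mem_univ _) h
  classical
  by_cases h2 : m 2 = 0
  · refine ⟨(fun i j => if (i : ℕ) = m 0 ∧ j = m 1 then 1 else 0, 0), ?_⟩
    rw [key, if_pos (by lia)]
    · have h6 : n - m 0 - m 1 = m 3 := by lia
      simp only [monomial_one_eq, h2, h6, and_self, if_true, C_1, Pi.zero_apply, C_0, zero_mul,
        ite_self]
      ring
    · intro i j hij
      refine ⟨if_neg (by tauto), rfl⟩
  · have h3 : m 3 = 0 := by tauto
    refine ⟨(0, fun i j => if (i : ℕ) = m 0 ∧ j = m 1 then 1 else 0), ?_⟩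
    rw [key, if_pos (by lia : m 1 < n - m 0)]
    · have h6 : n - m 0 - m 1 = m 2 := by lia
      simp only [monomial_one_eq, h3, h6, and_self, if_true, C_1, Pi.zero_apply, C_0, zero_mul,
        ite_self]
      ring
    · intro i j hij
      refine ⟨rfl, if_neg (by tauto)⟩

theorem monomial_mem_reducible₃ {f : R4 k} (hf : f ∈ forms k 3)
    (h0 : coeff (Finsupp.single 0 3) f ≠ 0) {n : ℕ} (d : ℕ) (m : Fin 4 →₀ ℕ)
    (hd : m 0 = d) (hm : m 0 + m 1 + m 2 + m 3 = n) : (monomial m 1 : R4 k) ∈ reducible₃ f n := by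
  induction d using Nat.strong_induction_on generalizing m with
  | _ d ih =>
  subst hd
  by_cases h2 : m 2 ≠ 0 ∧ m 3 ≠ 0
  · obtain ⟨a, ha⟩ := Nat.exists_eq_succ_of_ne_zero h2.1
    obtain ⟨b, hb⟩ := Nat.exists_eq_succ_of_ne_zero h2.2
    have h3 : (monomial m 1 : R4 k) = X 0 ^ m 0 * X 1 ^ m 1 * X 2 ^ a * X 3 ^ b * (X 2 * X 3) := by
      rw [monomial_one_eq, ha, hb, pow_succ, pow_succ]
      ring
    rw [h3]
    exact mem_reducible₃_of_mem (Ideal.mul_mem_left _ _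
      (Ideal.subset_span (Set.mem_insert_of_mem _ rfl)))
  by_cases h3 : m 0 < 3
  · refine Submodule.mem_sup_left (monomial_mem_range_lowForm h3 hm ?_)
    tauto
  · push Not at h3
    set c := coeff (Finsupp.single 0 3) f with hc
    obtain ⟨m', rfl⟩ : ∃ m', m = Finsupp.single 0 3 + m' := ⟨m - Finsupp.single 0 3, by
      ext i
      fin_cases i <;> simp <;> lia⟩
    have h4 : f = C c * monomial (Finsupp.single 0 3) 1 +
        ∑ e ∈ f.support.erase (Finsupp.single 0 3), C (coeff e f) * monomial e 1 := by
      have h5 : Finsupp.single 0 3 ∈ f.support := mem_support_iff.mpr h0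
      conv_lhs => rw [f.as_sum, ← Finset.add_sum_erase _ _ h5]
      simp only [C_mul_monomial, mul_one, hc]
    have h5 : (monomial (Finsupp.single 0 3 + m') 1 : R4 k) = C c⁻¹ * (f * monomial m' 1) -
        ∑ e ∈ f.support.erase (Finsupp.single 0 3),
          (c⁻¹ * coeff e f) • (monomial (e + m') 1 : R4 k) := by
      have h6 : ∀ e, (monomial (e + m') 1 : R4 k) = monomial e 1 * monomial m' 1 := fun e => by
        rw [monomial_mul, mul_one]
      have h7 : C c⁻¹ * C c = (1 : R4 k) := by rw [← C_mul, inv_mul_cancel₀ h0, C_1]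
      have h8 : ∑ e ∈ f.support.erase (Finsupp.single 0 3),
          (c⁻¹ * coeff e f) • (monomial (e + m') 1 : R4 k) = C c⁻¹ *
            ((∑ e ∈ f.support.erase (Finsupp.single 0 3), C (coeff e f) * monomial e 1) *
              monomial m' 1) := by
        simp only [h6, smul_eq_C_mul, C_mul, Finset.mul_sum, Finset.sum_mul, mul_assoc]
      rw [h8, h6]
      linear_combination (-(monomial (Finsupp.single 0 3) 1) * monomial m' 1 : R4 k) * h7
        + (-C c⁻¹ * monomial m' 1 : R4 k) * h4
    rw [h5]
    refine Submodule.sub_mem _ (mem_reducible₃_of_mem ?_) (Submodule.sum_mem _ fun e he =>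
      Submodule.smul_mem _ _ ?_)
    · exact Ideal.mul_mem_left _ _ (Ideal.mul_mem_right _ _
        (Ideal.subset_span (Set.mem_insert _ _)))
    · rw [Finset.mem_erase, mem_support_iff] at he
      have h6 : (e.degree : ℤ) = 3 := hf e he.2
      have h6' : e.degree = 3 := by exact_mod_cast h6
      rw [Finsupp.degree_eq_sum, Fin.sum_univ_four] at h6'
      have h7 : e 0 ≠ 3 := by
        intro h
        apply he.1
        ext i
        fin_cases i <;> simp <;> lia
      simp at hm
      refine ih (e 0 + m' 0) ?_ _ ?_ ?_
      · simp
        lia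
      · simp
      · simp
        lia

theorem mem_reducible₃ {f : R4 k} (hf : f ∈ forms k 3)
    (h0 : coeff (Finsupp.single 0 3) f ≠ 0) {n : ℕ} {G : R4 k} (hG : G ∈ forms k n) :
    G ∈ reducible₃ f n := by
  rw [G.as_sum]
  refine Submodule.sum_mem _ fun m hm => ?_
  have h1 : (m.degree : ℤ) = n := hG m (mem_support_iff.mp hm)
  rw [Nat.cast_inj, Finsupp.degree_eq_sum, Fin.sum_univ_four] at h1
  rw [← mul_one (coeff m G), ← smul_eq_mul, ← smul_monomial]
  exact Submodule.smul_mem _ _ (monomial_mem_reducible₃ hf h0 _ m rfl h1)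

end

section

variable {k : Type} [Field k]

/-- The restrictions of a form `G` of degree `n` to the curves `f = 0` in the planes `X 2 = 0` and
`X 3 = 0`. -/
structure NormalForm (f G : R4 k) (n : ℕ) (r s : Fin 3 → Polynomial k) : Prop where
  natDegree_fst : ∀ i, (r i).natDegree ≤ n - i
  natDegree_snd : ∀ i, (s i).natDegree ≤ n - i
  coeff_eq : ∀ i : Fin 3, (r i).coeff (n - i) = (s i).coeff (n - i)
  eval_fst : ∀ η ξ, eval ![η, ξ, 0, 1] f = 0 →
    eval ![η, ξ, 0, 1] G = ∑ i : Fin 3, η ^ (i : ℕ) * (r i).eval ξ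
  eval_snd : ∀ η ξ, eval ![η, ξ, 1, 0] f = 0 →
    eval ![η, ξ, 1, 0] G = ∑ i : Fin 3, η ^ (i : ℕ) * (s i).eval ξ
  exists_of_eq_zero : (∀ i, r i = 0) → (∀ i, s i = 0) → ∃ Q H, G = f * Q + X 2 * X 3 * H
  exists_of_coeff_zero : (∀ i, (r i).coeff 0 = 0) → (∀ i, (s i).coeff 0 = 0) →
    ∃ Q H A, G = f * Q + X 2 * X 3 * H + A * X 1

theorem coeff_sum_range (a : ℕ → k) (N j : ℕ) :
    (∑ i ∈ Finset.range N, Polynomial.C (a i) * Polynomial.X ^ i).coeff j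
      = if j < N then a j else 0 := by
  simp [Polynomial.finsetSum_coeff, Polynomial.coeff_X_pow]

theorem natDegree_sum_range_le (a : ℕ → k) (N : ℕ) :
    (∑ i ∈ Finset.range (N + 1), Polynomial.C (a i) * Polynomial.X ^ i).natDegree ≤ N := by
  rw [Polynomial.natDegree_le_iff_coeff_eq_zero]
  intro j hj
  rw [coeff_sum_range, if_neg (by lia)]

theorem exists_normalForm {f : R4 k} (hf : f ∈ forms k 3)
    (h0 : coeff (Finsupp.single 0 3) f ≠ 0) {n : ℕ} {G : R4 k} (hG : G ∈ forms k n) :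
    ∃ r s, NormalForm f G n r s := by
  obtain ⟨L, ⟨c, rfl⟩, J, hJ, hGJ⟩ := Submodule.mem_sup.mp (mem_reducible₃ hf h0 hG)
  obtain ⟨α, β⟩ := c
  obtain ⟨Q, H, hQ⟩ := Ideal.mem_span_pair.mp hJ
  have hG' : G = f * Q + X 2 * X 3 * H + lowForm k n (α, β) := by
    linear_combination (-1 : R4 k) * hGJ + (-1 : R4 k) * hQ
  let γ : Fin 3 → ℕ → k := fun i j => if j = n - i then α i j else β i j
  have hγ : ∀ i : Fin 3, ∑ j ∈ Finset.range (n - i + 1), Polynomial.C (γ i j) * Polynomial.X ^ j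
      = ∑ j ∈ Finset.range (n - i), Polynomial.C (β i j) * Polynomial.X ^ j
        + Polynomial.C (α i (n - i)) * Polynomial.X ^ (n - i : ℕ) := by
    intro i
    rw [Finset.sum_range_succ]
    congr 1
    · refine Finset.sum_congr rfl fun j hj => ?_
      have : j ≠ n - i := (Finset.mem_range.mp hj).ne
      simp only [γ, if_neg this]
    · simp only [γ, if_pos rfl]
  refine ⟨fun i => ∑ j ∈ Finset.range (n - i + 1), Polynomial.C (α i j) * Polynomial.X ^ j,
    fun i => ∑ j ∈ Finset.range (n - i + 1), Polynomial.C (γ i j) * Polynomial.X ^ j,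
    fun i => natDegree_sum_range_le _ _, fun i => natDegree_sum_range_le _ _, fun i => ?_,
    fun η ξ h => ?_, fun η ξ h => ?_, fun hr hs => ?_, fun hr hs => ?_⟩
  · simp only [coeff_sum_range, γ, if_true, if_pos (Nat.lt_succ_self (n - i))]
  · rw [hG', lowForm_apply]
    simp only [map_add, map_mul, h, map_sum, map_pow, eval_X, eval_C, Polynomial.eval_finsetSum,
      Polynomial.eval_mul, Polynomial.eval_C, Polynomial.eval_pow, Polynomial.eval_X]
    simp only [Matrix.cons_val, zero_mul, zero_add, one_pow, mul_one]
    refine Finset.sum_congr rfl fun i _ => ?_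
    congr 1
    rw [add_eq_left]
    refine Finset.sum_eq_zero fun j hj => ?_
    rw [zero_pow (by have := Finset.mem_range.mp hj; lia), mul_zero, mul_zero]
  · rw [hG', lowForm_apply]
    simp only [hγ]
    simp only [map_add, map_mul, h, map_sum, map_pow, eval_X, eval_C, Polynomial.eval_finsetSum,
      Polynomial.eval_add,
      Polynomial.eval_mul, Polynomial.eval_C, Polynomial.eval_pow, Polynomial.eval_X]
    simp only [Matrix.cons_val, zero_mul, mul_zero, zero_add, one_pow, mul_one]
    refine Finset.sum_congr rfl fun i _ => ?_
    congr 1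
    rw [Finset.sum_range_succ, Nat.sub_self, pow_zero, mul_one, add_comm, add_right_inj,
      add_eq_right]
    refine Finset.sum_eq_zero fun j hj => ?_
    rw [zero_pow (by have := Finset.mem_range.mp hj; lia), mul_zero, mul_zero]
  · refine ⟨Q, H, ?_⟩
    rw [hG', lowForm_apply, add_eq_left]
    refine Finset.sum_eq_zero fun i _ => ?_
    rw [Finset.sum_eq_zero, Finset.sum_eq_zero, add_zero, mul_zero]
    · intro j hj
      have h1 := congrArg (fun p => Polynomial.coeff p j) (hs i)
      have hj := Finset.mem_range.mp hj
      simp only [coeff_sum_range, γ, if_neg hj.ne, if_pos (hj.trans (Nat.lt_succ_self _)),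
        Polynomial.coeff_zero] at h1
      simp only [h1, C_0, zero_mul]
    · intro j hj
      have h1 := congrArg (fun p => Polynomial.coeff p j) (hr i)
      simp only [coeff_sum_range, if_pos (Finset.mem_range.mp hj), Polynomial.coeff_zero] at h1
      simp only [h1, C_0, zero_mul]
  · have hd : (X 1 : R4 k) ∣ lowForm k n (α, β) := by
      rw [lowForm_apply]
      refine Finset.dvd_sum fun i _ => Dvd.dvd.mul_left (dvd_add (Finset.dvd_sum fun j hj => ?_)
        (Finset.dvd_sum fun j hj => ?_)) _
      · rcases Nat.eq_zero_or_pos j with rfl | hj'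
        · have h1 := hr i
          simp only [coeff_sum_range, if_pos (Finset.mem_range.mp hj)] at h1
          simp only [h1, C_0, zero_mul, dvd_zero]
        · exact Dvd.dvd.mul_left (Dvd.dvd.mul_right (dvd_pow_self _ hj'.ne') _) _
      · rcases Nat.eq_zero_or_pos j with rfl | hj'
        · have h1 := hs i
          have hj := Finset.mem_range.mp hj
          simp only [coeff_sum_range, γ, if_neg hj.ne, if_pos (hj.trans (Nat.lt_succ_self _))] at h1
          simp only [h1, C_0, zero_mul, dvd_zero]
        · exact Dvd.dvd.mul_left (Dvd.dvd.mul_right (dvd_pow_self _ hj'.ne') _) _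
    obtain ⟨A, hA⟩ := hd
    exact ⟨Q, H, A, by rw [hG', hA, mul_comm A]⟩

/-- A quadratic polynomial with three distinct roots vanishes. -/
theorem eq_zero_of_three_roots {a b c : k} {ω : Fin 3 → k} (hω : Function.Injective ω)
    (h : ∀ i, a * ω i ^ 2 + b * ω i + c = 0) : a = 0 ∧ b = 0 ∧ c = 0 := by
  have h01 : ω 0 - ω 1 ≠ 0 := sub_ne_zero.mpr fun h => by simpa using hω h
  have h02 : ω 0 - ω 2 ≠ 0 := sub_ne_zero.mpr fun h => by simpa using hω h
  have h12 : ω 1 - ω 2 ≠ 0 := sub_ne_zero.mpr fun h => by simpa using hω h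
  have h3 : a * (ω 0 + ω 1) + b = 0 := by
    refine (mul_eq_zero.mp ?_).resolve_left h01
    linear_combination h 0 - h 1
  have h4 : a * (ω 0 + ω 2) + b = 0 := by
    refine (mul_eq_zero.mp ?_).resolve_left h02
    linear_combination h 0 - h 2
  have ha : a = 0 := by
    refine (mul_eq_zero.mp ?_).resolve_left h12
    linear_combination h3 - h4
  subst ha
  have hb : b = 0 := by linear_combination h3
  subst hb
  exact ⟨rfl, rfl, by linear_combination h 0⟩

theorem eq_zero_of_two_roots {a b ξ ξ' : k} (hξ : ξ ≠ ξ') (h : a * ξ + b = 0)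
    (h' : a * ξ' + b = 0) : a = 0 ∧ b = 0 := by
  have ha : a = 0 := by
    refine (mul_eq_zero.mp ?_).resolve_left (sub_ne_zero.mpr hξ)
    linear_combination h - h'
  subst ha
  exact ⟨rfl, by linear_combination h⟩

end

section

variable {k : Type} [Field k]

/-- The monic polynomial with simple roots at the points of `S`. -/
noncomputable def rootsPoly (S : Finset k) : Polynomial k :=
  ∏ c ∈ S, (Polynomial.X - Polynomial.C c)

theorem rootsPoly_monic (S : Finset k) : (rootsPoly S).Monic :=
  Polynomial.monic_prod_X_sub_C _ _

theorem natDegree_rootsPoly (S : Finset k) : (rootsPoly S).natDegree = S.card :=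
  Polynomial.natDegree_finsetProd_X_sub_C_eq_card S id

theorem eval_rootsPoly_ne_zero {S : Finset k} {ξ : k} (h : ξ ∉ S) : (rootsPoly S).eval ξ ≠ 0 := by
  rw [rootsPoly, Polynomial.eval_prod, Finset.prod_ne_zero_iff]
  intro c hc
  rw [Polynomial.eval_sub, Polynomial.eval_X, Polynomial.eval_C, sub_ne_zero]
  rintro rfl
  exact h hc

theorem exists_eq_rootsPoly_mul {S : Finset k} {p : Polynomial k} {d : ℕ}
    (hp : p.natDegree ≤ S.card + d) (h : ∀ c ∈ S, p.eval c = 0) :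
    ∃ t : Polynomial k, p = rootsPoly S * t ∧ t.natDegree ≤ d ∧
      p.coeff (S.card + d) = t.coeff d := by
  have h1 : rootsPoly S ∣ p := by
    refine Finset.prod_dvd_of_coprime ?_ fun c hc => Polynomial.dvd_iff_isRoot.mpr (h c hc)
    intro a _ b _ hab
    exact Polynomial.pairwise_coprime_X_sub_C (s := id) Function.injective_id hab
  obtain ⟨t, rfl⟩ := h1
  have ht : t.natDegree ≤ d := by
    by_cases ht : t = 0
    · simp [ht]
    · rw [(rootsPoly_monic S).natDegree_mul' ht, natDegree_rootsPoly] at hp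
      lia
  refine ⟨t, rfl, ht, ?_⟩
  rw [Polynomial.coeff_mul_add_eq_of_natDegree_le (natDegree_rootsPoly S).le ht]
  have := (rootsPoly_monic S).coeff_natDegree
  rw [natDegree_rootsPoly] at this
  rw [this, one_mul]

/-- Three distinct points of the surface `f = 0` on the line joining the point with coordinates
`ξ, y, z` in the plane `X 0 = 0` to the first coordinate point. -/
def IsFiber (f : R4 k) (ξ y z : k) (ω : Fin 3 → k) : Prop :=
  Function.Injective ω ∧ ∀ i, eval ![ω i, ξ, y, z] f = 0

/-- After removing the factors `P` and `P'`, the restrictions of `G` to `X 2 = 0` and to `X 3 = 0`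
are conics. -/
structure ConicForm (f G : R4 k) (P P' : Polynomial k) (a b c : Fin 3 → k) : Prop where
  eval_fst : ∀ η ξ, eval ![η, ξ, 0, 1] f = 0 → eval ![η, ξ, 0, 1] G =
    P.eval ξ * (a 0 * η ^ 2 + a 1 * η * ξ + a 2 * ξ ^ 2 + b 0 * η + b 1 * ξ + b 2)
  eval_snd : ∀ η ξ, eval ![η, ξ, 1, 0] f = 0 → eval ![η, ξ, 1, 0] G =
    P'.eval ξ * (a 0 * η ^ 2 + a 1 * η * ξ + a 2 * ξ ^ 2 + c 0 * η + c 1 * ξ + c 2)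
  exists_of_eq_zero : a = 0 → b = 0 → c = 0 → ∃ Q H, G = f * Q + X 2 * X 3 * H

theorem eq_C_add_of_natDegree_le_two {t : Polynomial k} (h : t.natDegree ≤ 2) :
    t = Polynomial.C (t.coeff 0) + Polynomial.C (t.coeff 1) * Polynomial.X
      + Polynomial.C (t.coeff 2) * Polynomial.X ^ 2 := by
  ext i
  rcases i with _ | _ | _ | i
  · simp [Polynomial.coeff_X_pow]
  · simp [Polynomial.coeff_X_pow, Polynomial.coeff_C]
  · simp [Polynomial.coeff_X_pow]
  · rw [Polynomial.coeff_eq_zero_of_natDegree_lt (by lia)]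
    simp

theorem exists_conicForm {f : R4 k} (hf : f ∈ forms k 3)
    (h0 : coeff (Finsupp.single 0 3) f ≠ 0) {S S' : Finset k} {N : ℕ} (hS : S.card = N)
    (hS' : S'.card = N) {G : R4 k} (hG : G ∈ forms k (N + 2 : ℕ))
    (hGS : ∀ ξ ∈ S, ∃ ω, IsFiber f ξ 0 1 ω ∧ ∀ i, eval ![ω i, ξ, 0, 1] G = 0)
    (hGS' : ∀ ξ ∈ S', ∃ ω, IsFiber f ξ 1 0 ω ∧ ∀ i, eval ![ω i, ξ, 1, 0] G = 0) :
    ∃ a b c, ConicForm f G (rootsPoly S) (rootsPoly S') a b c := by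
  obtain ⟨r, s, h⟩ := exists_normalForm hf h0 hG
  have hr : ∀ i : Fin 3, ∀ ξ ∈ S, (r i).eval ξ = 0 := by
    intro i ξ hξ
    obtain ⟨ω, hω, hωG⟩ := hGS ξ hξ
    have h1 := eq_zero_of_three_roots (a := (r 2).eval ξ) (b := (r 1).eval ξ) (c := (r 0).eval ξ)
      hω.1 fun i => by
        have h2 := h.eval_fst _ _ (hω.2 i)
        rw [hωG, Fin.sum_univ_three] at h2
        simp at h2
        linear_combination -h2
    fin_cases i
    · exact h1.2.2
    · exact h1.2.1
    · exact h1.1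
  have hs : ∀ i : Fin 3, ∀ ξ ∈ S', (s i).eval ξ = 0 := by
    intro i ξ hξ
    obtain ⟨ω, hω, hωG⟩ := hGS' ξ hξ
    have h1 := eq_zero_of_three_roots (a := (s 2).eval ξ) (b := (s 1).eval ξ) (c := (s 0).eval ξ)
      hω.1 fun i => by
        have h2 := h.eval_snd _ _ (hω.2 i)
        rw [hωG, Fin.sum_univ_three] at h2
        simp at h2
        linear_combination -h2
    fin_cases i
    · exact h1.2.2
    · exact h1.2.1
    · exact h1.1
  have hN : ∀ i : Fin 3, N + 2 - i = N + (2 - i) := fun i => by lia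
  have hr' : ∀ i, ∃ t : Polynomial k, r i = rootsPoly S * t ∧ t.natDegree ≤ 2 - i ∧
      (r i).coeff (N + (2 - i)) = t.coeff (2 - i) := by
    intro i
    have := h.natDegree_fst i
    rw [hN, ← hS] at this
    have := exists_eq_rootsPoly_mul this (hr i)
    rwa [hS] at this
  have hs' : ∀ i, ∃ t : Polynomial k, s i = rootsPoly S' * t ∧ t.natDegree ≤ 2 - i ∧
      (s i).coeff (N + (2 - i)) = t.coeff (2 - i) := by
    intro i
    have := h.natDegree_snd i
    rw [hN, ← hS'] at this
    have := exists_eq_rootsPoly_mul this (hs i)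
    rwa [hS'] at this
  choose p hp hpd hpc using hr'
  choose q hq hqd hqc using hs'
  have hpq : ∀ i : Fin 3, (q i).coeff (2 - i) = (p i).coeff (2 - i) := by
    intro i
    rw [← hpc, ← hqc, ← hN, h.coeff_eq]
  have hpe : ∀ i, p i = _ := fun i =>
    eq_C_add_of_natDegree_le_two ((hpd i).trans (Nat.sub_le _ _))
  have hqe : ∀ i, q i = _ := fun i =>
    eq_C_add_of_natDegree_le_two ((hqd i).trans (Nat.sub_le _ _))
  have hp12 : (p 1).coeff 2 = 0 := Polynomial.coeff_eq_zero_of_natDegree_lt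
    ((hpd 1).trans_lt (by decide))
  have hp21 : (p 2).coeff 1 = 0 := Polynomial.coeff_eq_zero_of_natDegree_lt
    ((hpd 2).trans_lt (by decide))
  have hp22 : (p 2).coeff 2 = 0 := Polynomial.coeff_eq_zero_of_natDegree_lt
    ((hpd 2).trans_lt (by decide))
  have hq12 : (q 1).coeff 2 = 0 := Polynomial.coeff_eq_zero_of_natDegree_lt
    ((hqd 1).trans_lt (by decide))
  have hq21 : (q 2).coeff 1 = 0 := Polynomial.coeff_eq_zero_of_natDegree_lt
    ((hqd 2).trans_lt (by decide))
  have hq22 : (q 2).coeff 2 = 0 := Polynomial.coeff_eq_zero_of_natDegree_lt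
    ((hqd 2).trans_lt (by decide))
  have e0 : (q 0).coeff 2 = (p 0).coeff 2 := hpq 0
  have e1 : (q 1).coeff 1 = (p 1).coeff 1 := hpq 1
  have e2 : (q 2).coeff 0 = (p 2).coeff 0 := hpq 2
  refine ⟨![(p 2).coeff 0, (p 1).coeff 1, (p 0).coeff 2],
    ![(p 1).coeff 0, (p 0).coeff 1, (p 0).coeff 0],
    ![(q 1).coeff 0, (q 0).coeff 1, (q 0).coeff 0], fun η ξ hη => ?_, fun η ξ hη => ?_,
    fun ha hb hc => ?_⟩
  · rw [h.eval_fst _ _ hη, Fin.sum_univ_three]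
    simp only [hp, Polynomial.eval_mul]
    rw [hpe 0, hpe 1, hpe 2]
    simp [hp12, hp21, hp22]
    ring
  · rw [h.eval_snd _ _ hη, Fin.sum_univ_three]
    simp only [hq, Polynomial.eval_mul]
    rw [hqe 0, hqe 1, hqe 2]
    simp [hq12, hq21, hq22, e0, e1, e2]
    ring
  · have ha := fun i => congrFun ha i
    have hb := fun i => congrFun hb i
    have hc := fun i => congrFun hc i
    have a0 := ha 0
    have a1 := ha 1
    have a2 := ha 2
    have b0 := hb 0
    have b1 := hb 1
    have b2 := hb 2
    have c0 := hc 0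
    have c1 := hc 1
    have c2 := hc 2
    simp at a0 a1 a2 b0 b1 b2 c0 c1 c2
    refine h.exists_of_eq_zero (fun i => ?_) (fun i => ?_)
    · rw [hp, hpe]
      fin_cases i <;> simp [a0, a1, a2, b0, b1, b2, hp12, hp21, hp22]
    · rw [hq, hqe]
      fin_cases i <;> simp [a0, a1, a2, c0, c1, c2, e0, e1, e2, hq12, hq21, hq22]

end

section

variable {k : Type} [Field k]

/-- The pair of conic conditions at three points which are not collinear. -/
theorem conic_coeff_eq_zero {η ξ : Fin 3 → k} (hξ : ∀ j, ξ j ≠ 0)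
    (hnc : ∀ α β γ : k, (∀ j, α * η j + β * ξ j + γ = 0) → α = 0 ∧ β = 0 ∧ γ = 0)
    {l κ κ₁ κ₂ b₁ b₂ b₃ : k} (hl : Function.Injective fun j => η j - l * ξ j)
    (h₁ : ∀ j, κ * η j * ξ j - κ * l * ξ j ^ 2 + κ₁ * η j + b₁ * ξ j + b₂ = 0)
    (h₂ : ∀ j, κ₁ * η j ^ 2 + (κ₂ - κ₁ * l) * η j * ξ j - κ₂ * l * ξ j ^ 2 + b₂ * η j
      + b₃ * ξ j = 0) :
    κ = 0 ∧ κ₁ = 0 ∧ κ₂ = 0 ∧ b₁ = 0 ∧ b₂ = 0 ∧ b₃ = 0 := by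
  obtain ⟨hκ, h3, h4⟩ := eq_zero_of_three_roots (a := κ) (b := b₁ - κ₂)
    (c := -l * b₂ - b₃) hl fun j => by
      refine (mul_eq_zero.mp ?_).resolve_left (hξ j)
      linear_combination (η j - l * ξ j) * h₁ j - h₂ j
  subst hκ
  obtain ⟨h5, h6, h7⟩ := hnc κ₁ b₁ b₂ fun j => by linear_combination h₁ j
  subst h5 h6 h7
  exact ⟨rfl, rfl, by linear_combination -h3, rfl, rfl, by linear_combination -h4⟩

/-- A vector field is tangent to the cone over every point of `Z`. -/
def Radial (F : Fin 4 → R4 k) (Z : Set (Fin 4 → k)) : Prop :=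
  ∀ v ∈ Z, ∀ i j, eval v (F i) * v j = eval v (F j) * v i

theorem radial_iff {F : Fin 4 → R4 k} {Z : Set (Fin 4 → k)} :
    Radial F Z ↔ ∀ v ∈ Z, wedge v (fun i => eval v (F i)) = 0 :=
  forall₂_congr fun _ _ => wedge_eq_zero_iff.symm

theorem Radial.sub_smul {F : Fin 4 → R4 k} {Z : Set (Fin 4 → k)} (h : Radial F Z) (A : R4 k) :
    Radial (fun i => F i - A * X i) Z := by
  intro v hv i j
  simp only [map_sub, map_mul, eval_X]
  linear_combination h v hv i j

theorem eq_zero_at {F : Fin 4 → R4 k} {Z : Set (Fin 4 → k)} (h : Radial F Z) {v : Fin 4 → k}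
    (hv : v ∈ Z) {i : Fin 4} (hi : v i ≠ 0) (hF : eval v (F i) = 0) (j : Fin 4) :
    eval v (F j) = 0 := by
  have := h v hv j i
  rw [hF, zero_mul] at this
  exact (mul_eq_zero.mp this).resolve_right hi

theorem exists_forms_of_eq {f : R4 k} (hf : f ∈ forms k 3) {n : ℤ} {G Q H A : R4 k}
    (hG : G ∈ forms k (n + 2)) (h : G = f * Q + X 2 * X 3 * H + A * X 1) :
    ∃ Q' H' : R4 k, ∃ A' ∈ forms k (n + 1), G = f * Q' + X 2 * X 3 * H' + A' * X 1 := by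
  refine ⟨comp k (n - 1) Q, comp k n H, comp k (n + 1) A, comp_mem _ _, ?_⟩
  have h1 := comp_eq_self hG
  have h2 : X 2 * X 3 ∈ forms k 2 := mul_mem_forms (X_mem_forms 2) (X_mem_forms 3) rfl
  rw [← h1, h, map_add, map_add, comp_mul hf, comp_mul h2, mul_comm A, comp_mul (X_mem_forms 1),
    mul_comm (X 1)]
  congr 4 <;> ring_nf

theorem exists_forms_of_eq' {f : R4 k} (hf : f ∈ forms k 3) {n : ℤ} {G Q H : R4 k}
    (hG : G ∈ forms k (n + 2)) (h : G = f * Q + X 2 * X 3 * H) :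
    ∃ Q' : R4 k, ∃ H' ∈ forms k n, G = f * Q' + X 2 * X 3 * H' := by
  refine ⟨comp k (n - 1) Q, comp k n H, comp_mem _ _, ?_⟩
  have h1 := comp_eq_self hG
  have h2 : X 2 * X 3 ∈ forms k 2 := mul_mem_forms (X_mem_forms 2) (X_mem_forms 3) rfl
  rw [← h1, h, map_add, comp_mul hf, comp_mul h2]
  congr 4 <;> ring_nf

/-- If a rigid configuration of degree `n` does not meet the planes `X 2 = 0` and `X 3 = 0`, then
every vector field of degree `n + 2` vanishing on these plane sections is radial. -/
theorem Rigid.exists_of_dvd {f : R4 k} (hf : f ∈ forms k 3) {n : ℤ} {Z : Set (Fin 4 → k)}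
    (hR : Rigid f n Z) (hZf : ∀ v ∈ Z, eval v f = 0) (hZ : ∀ v ∈ Z, v ≠ 0 → v 2 ≠ 0 ∧ v 3 ≠ 0)
    {F : Fin 4 → R4 k} (hF : FormTuple (n + 2) F) (hFZ : Radial F Z)
    (h : ∀ i, ∃ Q H, F i = f * Q + X 2 * X 3 * H) : ∃ A, ∀ i, f ∣ F i - A * X i := by
  choose Q H hQ using h
  choose Q' H' hH' hQ' using fun i => exists_forms_of_eq' hf (hF i) (hQ i)
  obtain ⟨A, hA⟩ := hR H' hH' <| radial_iff.mp fun v hv i j => by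
    by_cases hv0 : v = 0
    · simp [hv0]
    obtain ⟨h2, h3⟩ := hZ v hv hv0
    have h4 := hFZ v hv i j
    simp only [hQ', map_add, map_mul, hZf v hv, eval_X] at h4
    apply mul_left_cancel₀ (mul_ne_zero h2 h3)
    linear_combination h4
  refine ⟨X 2 * X 3 * A, fun i => ?_⟩
  obtain ⟨s, hs⟩ := hA i
  exact ⟨Q' i + X 2 * X 3 * s, by rw [hQ']; linear_combination X 2 * X 3 * hs⟩

end

section

variable {k : Type} [Field k]

theorem normalize {f : R4 k} (hf : f ∈ forms k 3) {n : ℕ} {Z : Set (Fin 4 → k)}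
    {F : Fin 4 → R4 k} (hF : FormTuple (n + 2 : ℕ) F) (hFZ : Radial F Z)
    (h : ∃ Q H A, F 1 = f * Q + X 2 * X 3 * H + A * X 1) :
    ∃ A, FormTuple (n + 2 : ℕ) (fun i => F i - A * X i) ∧ Radial (fun i => F i - A * X i) Z ∧
      ∃ Q H, F 1 - A * X 1 = f * Q + X 2 * X 3 * H := by
  obtain ⟨Q, H, A, h⟩ := h
  have h1 : ((n + 2 : ℕ) : ℤ) = (n : ℤ) + 2 := by push_cast; ring
  have hF1 := hF 1
  rw [h1] at hF1
  obtain ⟨Q', H', A', hA', h'⟩ := exists_forms_of_eq hf hF1 h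
  refine ⟨A', fun i => Submodule.sub_mem _ (hF i) (mul_mem_forms hA' (X_mem_forms i) ?_),
    hFZ.sub_smul A', Q', H', ?_⟩
  · push_cast
    ring
  · rw [h']
    ring

/-- A configuration which is made rigid by adding a rigid configuration of degree two less. -/
structure StepData (f : R4 k) (S S' : Finset k) (Z : Set (Fin 4 → k)) where
  zero_notMem : 0 ∉ S
  zero_notMem' : 0 ∉ S'
  fiber : ∀ ξ ∈ insert 0 (S : Set k), ∃ ω, IsFiber f ξ 0 1 ω ∧ ∀ i, ![ω i, ξ, 0, 1] ∈ Z
  fiber' : ∀ ξ ∈ insert 0 (S' : Set k), ∃ ω, IsFiber f ξ 1 0 ω ∧ ∀ i, ![ω i, ξ, 1, 0] ∈ Z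
  l : k
  m : k
  y : Fin 2 → k
  y_ne : ∀ j, y j ≠ 0
  y_notMem : ∀ j, y j ∉ S'
  y_inj : y 0 ≠ y 1
  eval_y : ∀ j, eval ![l * y j + m, y j, 1, 0] f = 0
  y_mem : ∀ j, ![l * y j + m, y j, 1, 0] ∈ Z
  η : Fin 3 → k
  ξ : Fin 3 → k
  ξ_ne : ∀ j, ξ j ≠ 0
  ξ_notMem : ∀ j, ξ j ∉ S
  eval_ξ : ∀ j, eval ![η j, ξ j, 0, 1] f = 0
  ξ_mem : ∀ j, ![η j, ξ j, 0, 1] ∈ Z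
  noncollinear : ∀ α β γ : k, (∀ j, α * η j + β * ξ j + γ = 0) → α = 0 ∧ β = 0 ∧ γ = 0
  inj : Function.Injective fun j => η j - l * ξ j

theorem StepData.exists_dvd {f : R4 k} (hf : f ∈ forms k 3)
    (h0 : coeff (Finsupp.single 0 3) f ≠ 0) {S S' : Finset k} {Z : Set (Fin 4 → k)}
    (h : StepData f S S' Z) {N : ℕ} (hS : S.card = N) (hS' : S'.card = N)
    {F : Fin 4 → R4 k} (hF : FormTuple (N + 2 : ℕ) F) (hFZ : Radial F Z)
    (h1 : ∃ Q H, F 1 = f * Q + X 2 * X 3 * H) : ∀ i, ∃ Q H, F i = f * Q + X 2 * X 3 * H := by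
  have hF1 : ∀ v, eval v f = 0 → v 2 * v 3 = 0 → eval v (F 1) = 0 := by
    obtain ⟨Q, H, hQ⟩ := h1
    intro v hv hv'
    rw [hQ, map_add, map_mul, map_mul, map_mul, hv, eval_X, eval_X, hv', zero_mul, zero_mul,
      zero_add]
  have hx : ∀ η ξ y z : k, ξ ≠ 0 → ![η, ξ, y, z] ∈ Z → eval ![η, ξ, y, z] f = 0 → y * z = 0 →
      ∀ j, eval ![η, ξ, y, z] (F j) = 0 := by
    intro η ξ y z hξ hv hvf hyz j
    exact eq_zero_at hFZ hv (i := 1) hξ (hF1 _ hvf hyz) j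
  have hconic : ∀ i, ∃ a b c, ConicForm f (F i) (rootsPoly S) (rootsPoly S') a b c := by
    intro i
    refine exists_conicForm hf h0 hS hS' (hF i) (fun ξ hξ => ?_) (fun ξ hξ => ?_)
    · obtain ⟨ω, hω, hωZ⟩ := h.fiber ξ (Or.inr hξ)
      have hne : ξ ≠ 0 := fun h' => h.zero_notMem (h' ▸ hξ)
      exact ⟨ω, hω, fun j => hx _ _ _ _ hne (hωZ j) (hω.2 j) (zero_mul _) i⟩
    · obtain ⟨ω, hω, hωZ⟩ := h.fiber' ξ (Or.inr hξ)
      have hne : ξ ≠ 0 := fun h' => h.zero_notMem' (h' ▸ hξ)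
      exact ⟨ω, hω, fun j => hx _ _ _ _ hne (hωZ j) (hω.2 j) (mul_zero _) i⟩
  choose a b c hc using hconic
  obtain ⟨ω, hω, hωZ⟩ := h.fiber 0 (Or.inl rfl)
  obtain ⟨ω', hω', hωZ'⟩ := h.fiber' 0 (Or.inl rfl)
  have hP := eval_rootsPoly_ne_zero h.zero_notMem
  have hP' := eval_rootsPoly_ne_zero h.zero_notMem'
  have ey : ∀ i, eval ![ω i, 0, 0, 1] (F 2) = 0 := fun i => by
    simpa using hFZ _ (hωZ i) 2 3
  have ew : ∀ i, eval ![ω i, 0, 0, 1] (F 0) = eval ![ω i, 0, 0, 1] (F 3) * ω i := fun i => by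
    simpa using hFZ _ (hωZ i) 0 3
  have ez' : ∀ i, eval ![ω' i, 0, 1, 0] (F 3) = 0 := fun i => by
    simpa using hFZ _ (hωZ' i) 3 2
  have ew' : ∀ i, eval ![ω' i, 0, 1, 0] (F 0) = eval ![ω' i, 0, 1, 0] (F 2) * ω' i := fun i => by
    simpa using hFZ _ (hωZ' i) 0 2
  obtain ⟨ay0, by0, by2⟩ := eq_zero_of_three_roots (a := a 2 0) (b := b 2 0) (c := b 2 2) hω.1
    fun i => by
      have := (hc 2).eval_fst _ _ (hω.2 i)
      rw [ey] at this
      apply mul_left_cancel₀ hP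
      linear_combination -this
  obtain ⟨az0, cz0, cz2⟩ := eq_zero_of_three_roots (a := a 3 0) (b := c 3 0) (c := c 3 2) hω'.1
    fun i => by
      have := (hc 3).eval_snd _ _ (hω'.2 i)
      rw [ez'] at this
      apply mul_left_cancel₀ hP'
      linear_combination -this
  obtain ⟨r1, r2, bw2⟩ := eq_zero_of_three_roots (a := a 0 0 - b 3 0) (b := b 0 0 - b 3 2)
    (c := b 0 2) hω.1 fun i => by
      have := ew i
      rw [(hc 0).eval_fst _ _ (hω.2 i), (hc 3).eval_fst _ _ (hω.2 i), az0] at this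
      apply mul_left_cancel₀ hP
      linear_combination this
  obtain ⟨r3, r4, cw2⟩ := eq_zero_of_three_roots (a := a 0 0 - c 2 0) (b := c 0 0 - c 2 2)
    (c := c 0 2) hω'.1 fun i => by
      have := ew' i
      rw [(hc 0).eval_snd _ _ (hω'.2 i), (hc 2).eval_snd _ _ (hω'.2 i), ay0] at this
      apply mul_left_cancel₀ hP'
      linear_combination this
  have hp : ∀ i j, a i 0 * h.η j ^ 2 + a i 1 * h.η j * h.ξ j + a i 2 * h.ξ j ^ 2 + b i 0 * h.η j
      + b i 1 * h.ξ j + b i 2 = 0 := by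
    intro i j
    have := (hc i).eval_fst _ _ (h.eval_ξ j)
    rw [hx _ _ _ _ (h.ξ_ne j) (h.ξ_mem j) (h.eval_ξ j) (zero_mul _)] at this
    exact (mul_eq_zero.mp this.symm).resolve_left (eval_rootsPoly_ne_zero (h.ξ_notMem j))
  have hq : ∀ i j, a i 0 * (h.l * h.y j + h.m) ^ 2 + a i 1 * (h.l * h.y j + h.m) * h.y j
      + a i 2 * h.y j ^ 2 + c i 0 * (h.l * h.y j + h.m) + c i 1 * h.y j + c i 2 = 0 := by
    intro i j
    have := (hc i).eval_snd _ _ (h.eval_y j)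
    rw [hx _ _ _ _ (h.y_ne j) (h.y_mem j) (h.eval_y j) (mul_zero _)] at this
    exact (mul_eq_zero.mp this.symm).resolve_left (eval_rootsPoly_ne_zero (h.y_notMem j))
  obtain ⟨ay1, ay2, by1⟩ := h.noncollinear (a 2 1) (a 2 2) (b 2 1) fun j => by
    apply mul_left_cancel₀ (h.ξ_ne j)
    linear_combination hp 2 j - h.η j ^ 2 * ay0 - h.η j * by0 - by2
  have hqy : ∀ j, (c 2 0 * h.l + c 2 1) * h.y j + (c 2 0 * h.m + c 2 2) = 0 := fun j => by
    have := hq 2 j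
    rw [ay0, ay1, ay2] at this
    linear_combination this
  obtain ⟨cy1, cy2⟩ := eq_zero_of_two_roots h.y_inj (hqy 0) (hqy 1)
  have hqz : ∀ j, (a 3 1 * h.l + a 3 2) * h.y j + (a 3 1 * h.m + c 3 1) = 0 := fun j => by
    have := hq 3 j
    rw [az0, cz0, cz2] at this
    apply mul_left_cancel₀ (h.y_ne j)
    linear_combination this
  obtain ⟨az2, cz1⟩ := eq_zero_of_two_roots h.y_inj (hqz 0) (hqz 1)
  have hqw : ∀ j, ((a 0 1 + a 0 0 * h.l) * h.l + a 0 2) * h.y j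
      + ((a 0 1 + a 0 0 * h.l) * h.m + c 0 1) = 0 := fun j => by
    have := hq 0 j
    apply mul_left_cancel₀ (h.y_ne j)
    linear_combination this - cw2 - (h.l * h.y j + h.m) * (r4 + cy2 + h.m * r3)
  obtain ⟨aw2, cw1⟩ := eq_zero_of_two_roots h.y_inj (hqw 0) (hqw 1)
  obtain ⟨e1, e2, e3, e4, e5, e6⟩ := conic_coeff_eq_zero h.ξ_ne h.noncollinear h.inj (κ := a 3 1)
    (κ₁ := a 0 0) (κ₂ := a 0 1 + a 0 0 * h.l) (b₁ := b 3 1) (b₂ := b 3 2) (b₃ := b 0 1)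
    (fun j => by
      linear_combination hp 3 j - h.η j ^ 2 * az0 - h.ξ j ^ 2 * az2 + h.η j * r1)
    (fun j => by
      linear_combination hp 0 j - h.ξ j ^ 2 * aw2 - h.η j * r2 - bw2)
  have z1 : c 2 0 = 0 := by linear_combination e2 - r3
  have z2 : c 2 1 = 0 := by linear_combination cy1 - h.l * z1
  have z3 : c 2 2 = 0 := by linear_combination cy2 - h.m * z1
  have z4 : a 3 2 = 0 := by linear_combination az2 - h.l * e1
  have z5 : c 3 1 = 0 := by linear_combination cz1 - h.m * e1
  have z6 : b 3 0 = 0 := by linear_combination e2 - r1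
  have z7 : a 0 1 = 0 := by linear_combination e3 - h.l * e2
  have z8 : a 0 2 = 0 := by linear_combination aw2 - h.l * e3
  have z9 : b 0 0 = 0 := by linear_combination r2 + e5
  have z10 : c 0 0 = 0 := by linear_combination r4 + z3
  have z11 : c 0 1 = 0 := by linear_combination cw1 - h.m * e3
  intro i
  fin_cases i
  · refine (hc 0).exists_of_eq_zero ?_ ?_ ?_ <;> funext j <;> fin_cases j <;> assumption
  · exact h1
  · refine (hc 2).exists_of_eq_zero ?_ ?_ ?_ <;> funext j <;> fin_cases j <;> assumption
  · refine (hc 3).exists_of_eq_zero ?_ ?_ ?_ <;> funext j <;> fin_cases j <;> assumption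

theorem StepData.rigid {f : R4 k} (hf : f ∈ forms k 3)
    (h0 : coeff (Finsupp.single 0 3) f ≠ 0) {S S' : Finset k} {Z Z' : Set (Fin 4 → k)}
    (h : StepData f S S' Z) {N : ℕ} (hS : S.card = N) (hS' : S'.card = N)
    (hZ : Z' ⊆ Z) (hR : Rigid f N Z') (hZf : ∀ v ∈ Z', eval v f = 0)
    (hZ' : ∀ v ∈ Z', v ≠ 0 → v 2 ≠ 0 ∧ v 3 ≠ 0) : Rigid f (N + 2 : ℕ) Z := by
  intro F hF hFZ
  rw [← radial_iff] at hFZ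
  obtain ⟨ω, hω, hωZ⟩ := h.fiber 0 (Or.inl rfl)
  obtain ⟨ω', hω', hωZ'⟩ := h.fiber' 0 (Or.inl rfl)
  have h1 : ∃ Q H A, F 1 = f * Q + X 2 * X 3 * H + A * X 1 := by
    obtain ⟨r, s, hrs⟩ := exists_normalForm hf h0 (hF 1)
    obtain ⟨r2, r1, r0⟩ := eq_zero_of_three_roots (a := (r 2).coeff 0) (b := (r 1).coeff 0)
      (c := (r 0).coeff 0) hω.1 fun i => by
        have e := hFZ _ (hωZ i) 1 3
        rw [hrs.eval_fst _ _ (hω.2 i), Fin.sum_univ_three] at e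
        simp [← Polynomial.coeff_zero_eq_eval_zero] at e
        linear_combination e
    obtain ⟨s2, s1, s0⟩ := eq_zero_of_three_roots (a := (s 2).coeff 0) (b := (s 1).coeff 0)
      (c := (s 0).coeff 0) hω'.1 fun i => by
        have e := hFZ _ (hωZ' i) 1 2
        rw [hrs.eval_snd _ _ (hω'.2 i), Fin.sum_univ_three] at e
        simp [← Polynomial.coeff_zero_eq_eval_zero] at e
        linear_combination e
    refine hrs.exists_of_coeff_zero (fun i => ?_) (fun i => ?_) <;> fin_cases i <;> assumption
  obtain ⟨A, hFA, hFAZ, hA⟩ := normalize hf hF hFZ h1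
  have h2 := h.exists_dvd hf h0 hS hS' hFA hFAZ hA
  have h3 : ((N + 2 : ℕ) : ℤ) = (N : ℤ) + 2 := by push_cast; ring
  rw [h3] at hFA
  obtain ⟨B, hB⟩ := hR.exists_of_dvd hf hZf hZ' hFA (fun v hv => hFAZ v (hZ hv)) h2
  refine ⟨A + B, fun i => ?_⟩
  have h4 := hB i
  rwa [show F i - (A + B) * X i = F i - A * X i - B * X i by ring]

end

section

variable {k : Type} [Field k]

/-- The linear change of coordinates given by a matrix. -/
noncomputable def subst (g : Matrix (Fin 4) (Fin 4) k) : R4 k →ₐ[k] R4 k :=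
  aeval fun i => ∑ j, C (g i j) * X j

theorem subst_X (g : Matrix (Fin 4) (Fin 4) k) (i : Fin 4) :
    subst g (X i) = ∑ j, C (g i j) * X j := by
  simp [subst]

theorem subst_C (g : Matrix (Fin 4) (Fin 4) k) (c : k) : subst g (C c) = C c := by
  simp [subst]

theorem eval_subst (g : Matrix (Fin 4) (Fin 4) k) (v : Fin 4 → k) (p : R4 k) :
    eval v (subst g p) = eval (g.mulVec v) p := by
  induction p using MvPolynomial.induction_on with
  | C a => simp [subst]
  | add p q hp hq => simp [hp, hq]
  | mul_X p i hp =>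
    rw [map_mul, map_mul, hp, subst_X, map_mul, eval_X, map_sum]
    simp [Matrix.mulVec, dotProduct]

theorem subst_subst (g h : Matrix (Fin 4) (Fin 4) k) (p : R4 k) :
    subst h (subst g p) = subst (g * h) p := by
  have : (subst h).comp (subst g) = subst (g * h) := by
    ext1 i
    rw [AlgHom.comp_apply, subst_X, subst_X, map_sum]
    simp only [map_mul, subst_C, subst_X, Matrix.mul_apply, Finset.mul_sum, map_sum,
      Finset.sum_mul]
    rw [Finset.sum_comm]
    simp only [mul_assoc]
  rw [← this, AlgHom.comp_apply]

theorem subst_one (p : R4 k) : subst 1 p = p := by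
  have : subst (1 : Matrix (Fin 4) (Fin 4) k) = AlgHom.id k _ := by
    ext1 i
    simp [subst_X, Matrix.one_apply]
  rw [this, AlgHom.id_apply]

theorem subst_isHomogeneous (g : Matrix (Fin 4) (Fin 4) k) {p : R4 k} {n : ℕ}
    (hp : p.IsHomogeneous n) : (subst g p).IsHomogeneous n := by
  have := hp.aeval (fun i => ∑ j, C (g i j) * X j : Fin 4 → R4 k) (n := 1) fun i =>
    IsHomogeneous.sum _ _ _ fun j _ => isHomogeneous_C_mul_X _ _
  rwa [one_mul] at this

theorem subst_mem_forms (g : Matrix (Fin 4) (Fin 4) k) {p : R4 k} {d : ℤ}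
    (hp : p ∈ forms k d) : subst g p ∈ forms k d := by
  rcases lt_or_ge d 0 with hd | hd
  · rw [eq_zero_of_mem_forms_neg hd hp, map_zero]
    exact Submodule.zero_mem _
  · lift d to ℕ using hd
    rw [mem_forms_natCast] at hp ⊢
    exact subst_isHomogeneous g hp

theorem irreducible_subst {g h : Matrix (Fin 4) (Fin 4) k} (hgh : g * h = 1) (hhg : h * g = 1)
    {f : R4 k} (hf : Irreducible f) : Irreducible (subst g f) := by
  let e : R4 k ≃ₐ[k] R4 k := AlgEquiv.ofAlgHom (subst g) (subst h)
    (AlgHom.ext fun p => by rw [AlgHom.comp_apply, subst_subst, hhg, subst_one, AlgHom.id_apply])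
    (AlgHom.ext fun p => by rw [AlgHom.comp_apply, subst_subst, hgh, subst_one, AlgHom.id_apply])
  exact (MulEquiv.irreducible_iff e).mpr hf

theorem coeff_single_eq_eval {f : R4 k} {n : ℕ} (hf : f.IsHomogeneous n) (i : Fin 4) :
    coeff (Finsupp.single i n) f = eval (Pi.single i 1) f := by
  rw [eval_eq', Finset.sum_eq_single (Finsupp.single i n)]
  · rw [Finset.prod_eq_one, mul_one]
    intro j _
    by_cases hj : j = i
    · subst hj; simp
    · simp [Finsupp.single_eq_of_ne hj]
  · intro d hd hne
    rw [mul_eq_zero]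
    right
    by_contra h0
    apply hne
    have h1 : ∀ j, j ≠ i → d j = 0 := by
      intro j hj
      by_contra hdj
      apply h0
      apply Finset.prod_eq_zero (Finset.mem_univ j)
      rw [Pi.single_eq_of_ne hj, zero_pow hdj]
    have h2 := hf (mem_support_iff.mp hd)
    have h3 : d = Finsupp.single i (d i) := by
      ext j
      by_cases hj : j = i
      · subst hj; simp
      · rw [h1 j hj, Finsupp.single_eq_of_ne hj]
    rw [h3, Finsupp.weight_single] at h2
    simp at h2
    rw [h3, h2]
  · intro h
    rw [notMem_support_iff.mp h, zero_mul]

theorem mulVec_mul_mulVec_comm (h : Matrix (Fin 4) (Fin 4) k) {x F : Fin 4 → k}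
    (hF : ∀ i j, F i * x j = F j * x i) (i j : Fin 4) :
    h.mulVec F i * h.mulVec x j = h.mulVec F j * h.mulVec x i := by
  simp only [Matrix.mulVec, dotProduct, Finset.sum_mul_sum]
  rw [Finset.sum_comm]
  refine Finset.sum_congr rfl fun a _ => Finset.sum_congr rfl fun b _ => ?_
  linear_combination h i b * h j a * hF b a

theorem Rigid.image {g h : Matrix (Fin 4) (Fin 4) k} (hgh : g * h = 1) (hhg : h * g = 1)
    {f : R4 k} {n : ℤ} {Z : Set (Fin 4 → k)} (hR : Rigid (subst g f) n Z) :
    Rigid f n (g.mulVec '' Z) := by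
  intro F hF hFZ
  rw [← radial_iff] at hFZ
  obtain ⟨A, hA⟩ := hR (fun i => ∑ j, C (h i j) * subst g (F j))
    (fun i => Submodule.sum_mem _ fun j _ =>
      mul_mem_forms (C_mem_forms _) (subst_mem_forms g (hF j)) (zero_add n)) (by
      rw [← radial_iff]
      intro v hv i j
      have h1 := mulVec_mul_mulVec_comm h (hFZ _ ⟨v, hv, rfl⟩) i j
      rw [Matrix.mulVec_mulVec, hhg, Matrix.one_mulVec] at h1
      simpa [Matrix.mulVec, dotProduct, eval_subst] using h1)
  refine ⟨subst h A, fun i => ?_⟩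
  have h2 : ∀ j, f ∣ ∑ l, C (h j l) * (F l - subst h A * X l) := fun j => by
    have h3 := map_dvd (subst h) (hA j)
    rw [subst_subst, hgh, subst_one, map_sub, map_sum, map_mul, subst_X] at h3
    simp only [map_mul, subst_C, subst_subst, hgh, subst_one] at h3
    convert h3 using 1
    rw [Finset.mul_sum, ← Finset.sum_sub_distrib]
    refine Finset.sum_congr rfl fun l _ => by ring
  have h4 : F i - subst h A * X i =
      ∑ j, C (g i j) * ∑ l, C (h j l) * (F l - subst h A * X l) := by
    simp only [Finset.mul_sum, ← mul_assoc, ← C_mul]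
    rw [Finset.sum_comm]
    simp only [← Finset.sum_mul, ← map_sum, ← Matrix.mul_apply, hgh, Matrix.one_apply]
    simp
  rw [h4]
  exact Finset.dvd_sum fun j _ => (h2 j).mul_left _

end

section

variable {k : Type} [Field k]

theorem dvd_of_eval_eq_zero [IsAlgClosed k] {f p : R4 k} (hf : Irreducible f)
    (h : ∀ v, eval v f = 0 → eval v p = 0) : f ∣ p := by
  have : (Ideal.span {f}).IsPrime := (Ideal.span_singleton_prime hf.ne_zero).mpr hf.prime
  rw [← Ideal.mem_span_singleton, ← IsPrime.vanishingIdeal_zeroLocus (K := k) (Ideal.span {f}),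
    mem_vanishingIdeal_iff]
  intro v hv
  rw [mem_zeroLocus_iff] at hv
  have h1 := hv f (Ideal.mem_span_singleton_self f)
  rw [aeval_eq_eval] at h1 ⊢
  exact h v h1

theorem exists_eval_ne_zero [IsAlgClosed k] {f p : R4 k} (hf : Irreducible f) (h : ¬ f ∣ p) :
    ∃ v, eval v f = 0 ∧ eval v p ≠ 0 := by
  contrapose! h
  exact dvd_of_eval_eq_zero hf h

theorem not_dvd_of_mem_forms {f p : R4 k} {d e : ℤ} (hf : f ∈ forms k d) (hp : p ∈ forms k e)
    (hde : e < d) (h : p ≠ 0) : ¬ f ∣ p := by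
  intro h'
  obtain ⟨s, hs, h1⟩ := exists_form_of_dvd hf hp h' rfl
  rw [eq_zero_of_mem_forms_neg (by lia) hs, mul_zero] at h1
  exact h h1

/-- The derivative of `p` at `v` in the direction `u`. -/
noncomputable def dir (p : R4 k) (u v : Fin 4 → k) : k := ∑ i, u i * eval v (pderiv i p)

theorem dir_X_mul (i : Fin 4) (p : R4 k) (u v : Fin 4 → k) :
    dir (X i * p) u v = u i * eval v p + v i * dir p u v := by
  simp only [dir, Derivation.leibniz, smul_eq_mul, map_add, map_mul, eval_X, mul_add,
    Finset.sum_add_distrib, pderiv_X, Pi.single_apply]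
  rw [add_comm]
  congr 1
  · rw [Finset.sum_eq_single i]
    · simp
    · intro j _ hj
      simp [hj.symm]
    · simp
  · rw [Finset.mul_sum]
    exact Finset.sum_congr rfl fun j _ => by ring

theorem dir_sum {ι : Type*} (s : Finset ι) (p : ι → R4 k) (u v : Fin 4 → k) :
    dir (∑ i ∈ s, p i) u v = ∑ i ∈ s, dir (p i) u v := by
  simp only [dir, map_sum, Finset.mul_sum]
  rw [Finset.sum_comm]

theorem dir_C (c : k) (u v : Fin 4 → k) : dir (C c) u v = 0 := by
  simp [dir]

theorem eval_add_smul_of_mem_forms_one {p : R4 k} (hp : p ∈ forms k 1) (u o : Fin 4 → k) (ω : k) :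
    eval (u + ω • o) p = eval u p + ω * eval o p ∧ dir p o u = eval o p := by
  obtain ⟨z, hz, rfl⟩ := exists_sum_X_of_forms (by norm_num) hp (sub_self 1)
  choose c hc using fun i => exists_C_of_mem_forms_zero (hz i)
  simp only [hc, dir_sum, dir_X_mul, dir_C, map_sum, map_mul, eval_X, eval_C, Pi.add_apply,
    Pi.smul_apply, smul_eq_mul, Finset.mul_sum, ← Finset.sum_add_distrib]
  exact ⟨Finset.sum_congr rfl fun j _ => by ring, Finset.sum_congr rfl fun j _ => by ring⟩

theorem eval_add_smul_of_mem_forms_two {p : R4 k} (hp : p ∈ forms k 2) (u o : Fin 4 → k) (ω : k) :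
    eval (u + ω • o) p = eval u p + ω * dir p o u + ω ^ 2 * eval o p ∧
      dir p o u = dir p u o := by
  obtain ⟨z, hz, rfl⟩ := exists_sum_X_of_forms (e := 1) (by norm_num) hp (by norm_num)
  have h1 := fun i => eval_add_smul_of_mem_forms_one (hz i) u o ω
  have h2 := fun i => (eval_add_smul_of_mem_forms_one (hz i) o u ω).2
  simp only [dir_sum, dir_X_mul, map_sum, map_mul, eval_X, Pi.add_apply, fun i => (h1 i).1,
    fun i => (h1 i).2, h2,
    Pi.smul_apply, smul_eq_mul, Finset.mul_sum, ← Finset.sum_add_distrib]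
  exact ⟨Finset.sum_congr rfl fun j _ => by ring, Finset.sum_congr rfl fun j _ => by ring⟩

theorem eval_add_smul {p : R4 k} (hp : p ∈ forms k 3) (u o : Fin 4 → k) (ω : k) :
    eval (u + ω • o) p = eval o p * ω ^ 3 + dir p u o * ω ^ 2 + dir p o u * ω + eval u p := by
  obtain ⟨z, hz, rfl⟩ := exists_sum_X_of_forms (e := 2) (by norm_num) hp (by norm_num)
  have h1 := fun i => eval_add_smul_of_mem_forms_two (hz i) u o ω
  simp only [dir_sum, dir_X_mul, map_sum, map_mul, eval_X, Pi.add_apply, fun i => (h1 i).1,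
    fun i => (h1 i).2,
    Pi.smul_apply, smul_eq_mul, Finset.sum_mul, ← Finset.sum_add_distrib]
  exact Finset.sum_congr rfl fun j _ => by ring

/-- The restriction of a cubic form to the line spanned by two points. -/
noncomputable def restr (f : R4 k) (u o : Fin 4 → k) : Cubic k :=
  ⟨eval o f, dir f u o, dir f o u, eval u f⟩

theorem exists_three_roots [IsAlgClosed k] {f : R4 k} (hf : f ∈ forms k 3) {u o : Fin 4 → k}
    (ho : eval o f ≠ 0) (hd : (restr f u o).discr ≠ 0) :
    ∃ ω : Fin 3 → k, Function.Injective ω ∧ ∀ i, eval (u + ω i • o) f = 0 := by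
  classical
  have hs : ((restr f u o).toPoly.map (RingHom.id k)).Splits := IsAlgClosed.splits _
  have h3 := Cubic.card_roots_of_discr_ne_zero ho hs hd
  let e := (Finset.equivFinOfCardEq h3).symm
  refine ⟨fun i => e i, Subtype.val_injective.comp e.injective, fun i => ?_⟩
  have h4 := (e i).2
  rw [Multiset.mem_toFinset, Cubic.mem_roots_iff (Cubic.ne_zero_of_a_ne_zero ho)] at h4
  rw [eval_add_smul hf]
  exact h4

theorem pderiv_mem_forms {f : R4 k} (hf : f ∈ forms k 3) (i : Fin 4) :
    pderiv i f ∈ forms k 2 := by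
  have : f ∈ forms k (3 : ℕ) := hf
  rw [mem_forms_natCast] at this
  have h1 := this.pderiv (i := i)
  exact mem_forms_natCast.mpr h1

theorem exists_discr_ne_zero [IsAlgClosed k] (S : SmoothCubicSurface k) :
    ∃ u o, (restr S.f u o).discr ≠ 0 := by
  have hf : S.f ∈ forms k 3 := mem_forms_natCast.mpr S.homog
  have : Infinite k := IsAlgClosed.instInfinite
  obtain ⟨q, hq, hq0⟩ := exists_eval_ne_zero S.irred (not_dvd_X hf 0)
  have hq1 : q ≠ 0 := by
    rintro rfl
    simp at hq0
  let L : (Fin 4 → k) → R4 k := fun q => ∑ i, C (eval q (pderiv i S.f)) * X i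
  have hL : ∀ q, L q ∈ forms k 1 := fun q => Submodule.sum_mem _ fun i _ =>
    mul_mem_forms (C_mem_forms _) (X_mem_forms i) (by norm_num)
  have eL : ∀ q o, eval o (L q) = dir S.f o q := fun q o => by simp [L, dir, mul_comm]
  have hL0 : ∀ q ≠ 0, eval q S.f = 0 → L q ≠ 0 := by
    intro q hq0 hq h0
    obtain ⟨i, hi⟩ := S.smooth q hq0 hq
    apply hi
    have h1 : eval (Pi.single i 1) (L q) = eval q (pderiv i S.f) := by
      simp [L, Pi.single_apply]
    rw [← h1, h0, map_zero]
  obtain ⟨r, hr, hr1⟩ := exists_eval_ne_zero S.irred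
    (not_dvd_of_mem_forms hf (hL q) (by norm_num) (hL0 q hq1 hq))
  have hr0 : r ≠ 0 := by
    rintro rfl
    rw [eL] at hr1
    simp [dir] at hr1
  let B : R4 k := ∑ i, C (r i) * pderiv i S.f
  have hB : B ∈ forms k 2 := Submodule.sum_mem _ fun i _ =>
    mul_mem_forms (C_mem_forms _) (pderiv_mem_forms hf i) (by norm_num)
  have eB : ∀ o, eval o B = dir S.f r o := fun o => by simp [B, dir]
  have hB0 : B ≠ 0 := by
    intro h
    rw [eL, ← eB, h, map_zero] at hr1
    exact hr1 rfl
  have h1 : L r ^ 2 * (B ^ 2 - 4 * (L r * S.f)) ≠ 0 ∨ L r ^ 2 * (B ^ 2 - 4 * (L r * S.f)) = 0 :=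
    ne_or_eq _ _
  rcases h1 with h1 | h1
  · by_contra! hcon
    apply h1
    apply MvPolynomial.funext
    intro o
    have := hcon r o
    rw [map_zero, ← this]
    simp only [Cubic.discr, restr, hr, ← eB, ← eL]
    simp only [map_mul, map_sub, map_pow, map_ofNat]
    ring
  · exfalso
    have h2 := (mul_eq_zero.mp h1).resolve_left (pow_ne_zero 2 (hL0 r hr0 hr))
    have h3 : S.f ∣ B ^ 2 := ⟨4 * L r, by linear_combination h2⟩
    exact not_dvd_of_mem_forms hf hB (by norm_num) hB0 (S.irred.prime.dvd_of_dvd_pow h3)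

end

section

variable {k : Type} [Field k]

theorem exists_linearMap_of_mem_forms_one {p : R4 k} (hp : p ∈ forms k 1) :
    ∃ φ : (Fin 4 → k) →ₗ[k] k, ∀ v, φ v = eval v p := by
  have h1 : p.IsHomogeneous 1 := mem_forms_natCast.mp hp
  refine ⟨⟨⟨fun v => eval v p, fun u v => ?_⟩, fun c v => ?_⟩, fun v => rfl⟩
  · have := (eval_add_smul_of_mem_forms_one hp u v 1).1
    rwa [one_smul, one_mul] at this
  · have := eval_smul_of_isHomogeneous h1 c v
    rwa [pow_one] at this

/-- The form of degree one associated with a linear functional. -/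
noncomputable def linForm (φ : (Fin 4 → k) →ₗ[k] k) : R4 k := ∑ i, C (φ (Pi.single i 1)) * X i

theorem linForm_mem (φ : (Fin 4 → k) →ₗ[k] k) : linForm φ ∈ forms k 1 :=
  Submodule.sum_mem _ fun i _ => mul_mem_forms (C_mem_forms _) (X_mem_forms i) (by norm_num)

theorem eval_linForm (φ : (Fin 4 → k) →ₗ[k] k) (v : Fin 4 → k) : eval v (linForm φ) = φ v := by
  conv_rhs => rw [← Finset.univ_sum_single v, map_sum]
  simp only [linForm, map_sum, map_mul, eval_C, eval_X]
  refine Finset.sum_congr rfl fun i _ => ?_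
  rw [show Pi.single i (v i) = v i • (Pi.single i 1 : Fin 4 → k) by
    rw [← Pi.single_smul]; simp, map_smul, smul_eq_mul, mul_comm]

theorem not_dvd_linForm {f : R4 k} (hf : f ∈ forms k 3) {φ : (Fin 4 → k) →ₗ[k] k} (hφ : φ ≠ 0) :
    ¬ f ∣ linForm φ := by
  refine not_dvd_of_mem_forms hf (linForm_mem φ) (by norm_num) fun h => hφ ?_
  refine LinearMap.ext fun v => ?_
  rw [← eval_linForm, h, map_zero, LinearMap.zero_apply]

variable [IsAlgClosed k]

theorem exists_basis_of_points {f : R4 k} (hf : f ∈ forms k 3) (hi : Irreducible f) :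
    ∃ b : Module.Basis (Fin 4) k (Fin 4 → k), ∀ i, eval (b i) f = 0 := by
  have h : ⊤ ≤ Submodule.span k {v | eval v f = 0} := by
    by_contra h
    obtain ⟨φ, hφ, h1⟩ := Submodule.exists_le_ker_of_lt_top _ (lt_top_iff_ne_top.mpr
      fun h2 => h h2.ge)
    obtain ⟨v, hv, hv1⟩ := exists_eval_ne_zero hi (not_dvd_linForm hf hφ)
    rw [eval_linForm] at hv1
    exact hv1 (h1 (Submodule.subset_span hv))
  let b := Module.Basis.ofSpan h
  let e := b.indexEquiv (Pi.basisFun k (Fin 4))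
  refine ⟨b.reindex e, fun i => ?_⟩
  have h2 := Module.Basis.ofSpan_subset h (Set.mem_range_self (e.symm i))
  rwa [Module.Basis.reindex_apply]

theorem exists_rigid_one {f : R4 k} (hf : f ∈ forms k 3) (hi : Irreducible f) :
    ∃ Z : Finset (Fin 4 → k), Z.card ≤ 5 ∧ (∀ v ∈ Z, eval v f = 0) ∧
      Rigid f (1 : ℕ) Z := by
  classical
  obtain ⟨b, hb⟩ := exists_basis_of_points hf hi
  have h1 : ¬ f ∣ ∏ i, linForm (b.coord i) := by
    rw [Prime.dvd_finsetProd_iff hi.prime]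
    rintro ⟨i, -, h⟩
    refine not_dvd_linForm hf (fun h0 => ?_) h
    have := LinearMap.congr_fun h0 (b i)
    simp at this
  obtain ⟨v, hv, hv1⟩ := exists_eval_ne_zero hi h1
  rw [map_prod, Finset.prod_ne_zero_iff] at hv1
  refine ⟨insert v (Finset.univ.image b), ?_, ?_, ?_⟩
  · refine (Finset.card_insert_le _ _).trans ?_
    have := Finset.card_image_le (s := Finset.univ) (f := b)
    simp only [Finset.card_univ, Fintype.card_fin] at this
    lia
  · intro w hw
    rw [Finset.mem_insert, Finset.mem_image] at hw
    rcases hw with rfl | ⟨i, -, rfl⟩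
    · exact hv
    · exact hb i
  · intro F hF hFZ
    choose φ hφ using fun i => exists_linearMap_of_mem_forms_one (hF i)
    let T : (Fin 4 → k) →ₗ[k] (Fin 4 → k) := LinearMap.pi φ
    have hT : ∀ w, T w = fun i => eval w (F i) := fun w => funext fun i => hφ i w
    have h2 : ∀ i, ∃ c, T (b i) = c • b i := fun i => by
      rw [hT]
      exact exists_smul_of_wedge_eq_zero (b.ne_zero i) (hFZ _ (by simp))
    choose c hc using h2
    have hv0 : v ≠ 0 := by
      rintro rfl
      have := hv1 0 (Finset.mem_univ _)
      rw [eval_linForm, map_zero] at this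
      exact this rfl
    obtain ⟨c', hc'⟩ := exists_smul_of_wedge_eq_zero hv0 (hFZ v (by simp))
    rw [← hT] at hc'
    have h3 : ∀ i, c i = c' := by
      intro i
      have h4 := congrArg (b.coord i) hc'
      rw [← b.sum_repr v, map_sum] at h4
      simp only [map_smul, hc, map_sum, Module.Basis.coord_apply,
        Module.Basis.repr_self, smul_eq_mul, Finset.smul_sum] at h4
      have h5 := hv1 i (Finset.mem_univ _)
      rw [eval_linForm, Module.Basis.coord_apply] at h5
      apply mul_left_cancel₀ h5
      simpa [Finsupp.single_apply, mul_comm] using h4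
    have h6 : T = c' • LinearMap.id := b.ext fun i => by
      rw [hc, h3, LinearMap.smul_apply, LinearMap.id_apply]
    refine ⟨C c', fun i => ?_⟩
    have h7 : F i - C c' * X i = 0 := by
      have : Infinite k := IsAlgClosed.instInfinite
      apply MvPolynomial.funext
      intro w
      have h8 := congrFun (LinearMap.congr_fun h6 w) i
      rw [hT] at h8
      simp at h8
      simp [h8]
    rw [h7]
    exact dvd_zero f

end

section

variable {k : Type} [Field k] {σ : Type}

/-- Polynomial functions on `σ → k`. -/
def IsPoly (φ : (σ → k) → k) : Prop := ∃ p : MvPolynomial σ k, ∀ x, eval x p = φ x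

namespace IsPoly

theorem const (c : k) : IsPoly fun _ : σ → k => c := ⟨C c, fun _ => eval_C _⟩

theorem coord (i : σ) : IsPoly fun x : σ → k => x i := ⟨X i, fun _ => eval_X _⟩

variable {φ ψ : (σ → k) → k}

theorem add (hφ : IsPoly φ) (hψ : IsPoly ψ) : IsPoly fun x => φ x + ψ x := by
  obtain ⟨p, hp⟩ := hφ
  obtain ⟨q, hq⟩ := hψ
  exact ⟨p + q, fun x => by rw [map_add, hp, hq]⟩

theorem sub (hφ : IsPoly φ) (hψ : IsPoly ψ) : IsPoly fun x => φ x - ψ x := by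
  obtain ⟨p, hp⟩ := hφ
  obtain ⟨q, hq⟩ := hψ
  exact ⟨p - q, fun x => by rw [map_sub, hp, hq]⟩

theorem mul (hφ : IsPoly φ) (hψ : IsPoly ψ) : IsPoly fun x => φ x * ψ x := by
  obtain ⟨p, hp⟩ := hφ
  obtain ⟨q, hq⟩ := hψ
  exact ⟨p * q, fun x => by rw [map_mul, hp, hq]⟩

theorem pow (hφ : IsPoly φ) (n : ℕ) : IsPoly fun x => φ x ^ n := by
  obtain ⟨p, hp⟩ := hφ
  exact ⟨p ^ n, fun x => by rw [map_pow, hp]⟩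

theorem sum {ι : Type} {s : Finset ι} {φ : ι → (σ → k) → k} (hφ : ∀ i, IsPoly (φ i)) :
    IsPoly fun x => ∑ i ∈ s, φ i x := by
  choose p hp using hφ
  exact ⟨∑ i ∈ s, p i, fun x => by simp only [map_sum, hp]⟩

theorem prod {ι : Type} {s : Finset ι} {φ : ι → (σ → k) → k} (hφ : ∀ i, IsPoly (φ i)) :
    IsPoly fun x => ∏ i ∈ s, φ i x := by
  choose p hp using hφ
  exact ⟨∏ i ∈ s, p i, fun x => by simp only [map_prod, hp]⟩

theorem eval_comp {φ : (σ → k) → Fin 4 → k} (hφ : ∀ i, IsPoly fun x => φ x i) (p : R4 k) :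
    IsPoly fun x => eval (φ x) p := by
  choose q hq using hφ
  refine ⟨aeval q p, fun x => ?_⟩
  rw [aeval_def, eval_eval₂]
  have : (fun i => eval x (q i)) = φ x := funext fun i => hq i x
  have h : (eval x).comp (algebraMap k (MvPolynomial σ k)) = RingHom.id k := by
    ext c
    simp
  rw [this, h, eval₂_id]

theorem det {M : (σ → k) → Matrix (Fin 4) (Fin 4) k} (hM : ∀ i j, IsPoly fun x => M x i j) :
    IsPoly fun x => (M x).det := by
  simp only [Matrix.det_apply']
  exact sum fun e => (const _).mul (prod fun i => hM _ _)

theorem discr {u o : (σ → k) → Fin 4 → k} (hu : ∀ i, IsPoly fun x => u x i)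
    (ho : ∀ i, IsPoly fun x => o x i) (f : R4 k) :
    IsPoly fun x => (restr f (u x) (o x)).discr := by
  have h1 : IsPoly fun x => dir f (u x) (o x) := sum fun i => (hu i).mul (eval_comp ho _)
  have h2 : IsPoly fun x => dir f (o x) (u x) := sum fun i => (ho i).mul (eval_comp hu _)
  have h3 := eval_comp hu f
  have h4 := eval_comp ho f
  exact (((((h1.pow 2).mul (h2.pow 2)).sub (((const 4).mul h4).mul (h2.pow 3))).sub
    (((const 4).mul (h1.pow 3)).mul h3)).sub (((const 27).mul (h4.pow 2)).mul (h3.pow 2))).add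
    (((((const 18).mul h4).mul h1).mul h2).mul h3)

end IsPoly

/-- A property of vectors which holds wherever some nonzero polynomial does not vanish. -/
def Generic (P : (σ → k) → Prop) : Prop := ∃ p : MvPolynomial σ k, p ≠ 0 ∧ ∀ x, eval x p ≠ 0 → P x

namespace Generic

variable {P Q : (σ → k) → Prop}

theorem of_ne_zero {φ : (σ → k) → k} (hφ : IsPoly φ) {x : σ → k} (hx : φ x ≠ 0) :
    Generic fun x => φ x ≠ 0 := by
  obtain ⟨p, hp⟩ := hφ
  refine ⟨p, ?_, fun x h => by rwa [hp] at h⟩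
  rintro rfl
  rw [← hp, map_zero] at hx
  exact hx rfl

theorem and (hP : Generic P) (hQ : Generic Q) : Generic fun x => P x ∧ Q x := by
  obtain ⟨p, hp, hp'⟩ := hP
  obtain ⟨q, hq, hq'⟩ := hQ
  refine ⟨p * q, mul_ne_zero hp hq, fun x hx => ?_⟩
  rw [map_mul] at hx
  exact ⟨hp' x (left_ne_zero_of_mul hx), hq' x (right_ne_zero_of_mul hx)⟩

theorem forall_mem {ι : Type} {s : Finset ι} {P : ι → (σ → k) → Prop}
    (hP : ∀ i ∈ s, Generic (P i)) : Generic fun x => ∀ i ∈ s, P i x := by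
  classical
  induction s using Finset.induction_on with
  | empty => exact ⟨1, one_ne_zero, by simp⟩
  | insert a s ha ih =>
    have h1 := (hP a (Finset.mem_insert_self a s)).and
      (ih fun i hi => hP i (Finset.mem_insert_of_mem hi))
    simpa only [Finset.forall_mem_insert] using h1

theorem exists_mem [Infinite k] (hP : Generic P) : ∃ x, P x := by
  obtain ⟨p, hp, hp'⟩ := hP
  by_contra! h
  apply hp
  apply MvPolynomial.funext
  intro x
  rw [map_zero]
  by_contra h1
  exact h x (hp' x h1)

end Generic

theorem generic_ne_zero (M : ℕ) : Generic fun c : Fin M → k => ∀ i ∈ Finset.univ, c i ≠ 0 := by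
  refine Generic.forall_mem fun i _ => ?_
  have h : IsPoly fun c : Fin M → k => c i := IsPoly.coord i
  exact Generic.of_ne_zero h (x := fun _ => 1) one_ne_zero

theorem generic_ne (M : ℕ) : Generic fun c : Fin M → k =>
    ∀ p ∈ (Finset.univ.filter fun p : Fin M × Fin M => p.1 ≠ p.2), c p.1 - c p.2 ≠ 0 := by
  refine Generic.forall_mem fun p hp => ?_
  have h : IsPoly fun c : Fin M → k => c p.1 - c p.2 := (IsPoly.coord p.1).sub (IsPoly.coord p.2)
  refine Generic.of_ne_zero h (x := Pi.single p.1 1) ?_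
  have := (Finset.mem_filter.mp hp).2
  rw [Pi.single_eq_same, Pi.single_eq_of_ne this.symm, sub_zero]
  exact one_ne_zero

theorem generic_discr {f : R4 k} {u o : Fin 4 → k} (hd : (restr f u o).discr ≠ 0)
    (v : Fin 4 → k) (M : ℕ) : Generic fun c : Fin M → k => ∀ i ∈ Finset.univ,
      (restr f (u + c i • v) o).discr ≠ 0 := by
  refine Generic.forall_mem fun i _ => ?_
  have h1 : ∀ j, IsPoly fun c : Fin M → k => (u + c i • v) j := fun j =>
    (IsPoly.const (u j)).add ((IsPoly.coord i).mul (IsPoly.const (v j)))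
  have h : IsPoly fun c : Fin M → k => (restr f (u + c i • v) o).discr :=
    IsPoly.discr h1 (fun j => IsPoly.const (o j)) f
  refine Generic.of_ne_zero h (x := fun _ => 0) ?_
  rwa [zero_smul, add_zero]

theorem exists_injective_roots [IsAlgClosed k] {f : R4 k} (hf : f ∈ forms k 3)
    {u o : Fin 4 → k} (ho : eval o f ≠ 0) (hd : (restr f u o).discr ≠ 0) (v : Fin 4 → k) (M : ℕ) :
    ∃ c : Fin M → k, Function.Injective c ∧ (∀ i, c i ≠ 0) ∧ ∀ i, ∃ ω : Fin 3 → k,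
      Function.Injective ω ∧ ∀ j, eval (u + c i • v + ω j • o) f = 0 := by
  have : Infinite k := IsAlgClosed.instInfinite
  obtain ⟨c, ⟨hc1, hc2⟩, hc3⟩ :=
    (((generic_ne_zero M).and (generic_discr hd v M)).and (generic_ne M)).exists_mem
  refine ⟨c, fun i j hij => ?_, fun i => hc1 i (Finset.mem_univ i), fun i =>
    exists_three_roots hf ho (hc2 i (Finset.mem_univ i))⟩
  by_contra hne
  exact hc3 (i, j) (Finset.mem_filter.mpr ⟨Finset.mem_univ _, hne⟩) (sub_eq_zero.mpr hij)

end

section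

variable {k : Type} [Field k]

theorem exists_two_ne {k : Type} {ω : Fin 3 → k} (hω : Function.Injective ω) (t : k) :
    ∃ i j, ω i ≠ ω j ∧ ω i ≠ t ∧ ω j ≠ t := by
  have h01 : ω 0 ≠ ω 1 := hω.ne (by decide)
  have h02 : ω 0 ≠ ω 2 := hω.ne (by decide)
  have h12 : ω 1 ≠ ω 2 := hω.ne (by decide)
  by_cases h0 : ω 0 = t
  · exact ⟨1, 2, h12, h0 ▸ h01.symm, h0 ▸ h02.symm⟩
  · by_cases h1 : ω 1 = t
    · exact ⟨0, 2, h02, h0, h1 ▸ h12.symm⟩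
    · exact ⟨0, 1, h01, h0, h1⟩

theorem noncollinear_of_ne {η₀ η₁ η₂ c c' : k} (hη : η₁ ≠ η₂) (hc : c' ≠ c) {α β γ : k}
    (h : ∀ j : Fin 3, α * ![η₀, η₁, η₂] j + β * ![c', c, c] j + γ = 0) :
    α = 0 ∧ β = 0 ∧ γ = 0 := by
  have h0 : α * η₀ + β * c' + γ = 0 := h 0
  have h1 : α * η₁ + β * c + γ = 0 := h 1
  have h2 : α * η₂ + β * c + γ = 0 := h 2
  have hα : α = 0 := (mul_eq_zero.mp (show α * (η₁ - η₂) = 0 by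
    linear_combination h1 - h2)).resolve_right (sub_ne_zero.mpr hη)
  rw [hα] at h0 h1
  have hβ : β = 0 := (mul_eq_zero.mp (show β * (c' - c) = 0 by
    linear_combination h0 - h1)).resolve_right (sub_ne_zero.mpr hc)
  rw [hβ] at h0
  exact ⟨hα, hβ, by linear_combination h0⟩

def StepData.mono {f : R4 k} {S S' : Finset k} {Z Z' : Set (Fin 4 → k)}
    (h : StepData f S S' Z) (hZ : Z ⊆ Z') : StepData f S S' Z' where
  __ := h
  fiber ξ hξ := by
    obtain ⟨ω, hω, hωZ⟩ := h.fiber ξ hξ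
    exact ⟨ω, hω, fun i => hZ (hωZ i)⟩
  fiber' ξ hξ := by
    obtain ⟨ω, hω, hωZ⟩ := h.fiber' ξ hξ
    exact ⟨ω, hω, fun i => hZ (hωZ i)⟩
  y_mem j := hZ (h.y_mem j)
  ξ_mem j := hZ (h.ξ_mem j)

theorem exists_stepData {f : R4 k} (h : ∃ ω, IsFiber f 0 0 1 ω) (h' : ∃ ω, IsFiber f 0 1 0 ω)
    (N : ℕ) {c b : Fin (N + 2) → k} (hc : Function.Injective c) (hc0 : ∀ i, c i ≠ 0)
    (hcω : ∀ i, ∃ ω, IsFiber f (c i) 0 1 ω) (hb : Function.Injective b) (hb0 : ∀ i, b i ≠ 0)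
    (hbω : ∀ i, ∃ ω, IsFiber f (b i) 1 0 ω) :
    ∃ (S S' : Finset k) (Z : Finset (Fin 4 → k)), S.card = N ∧ S'.card = N ∧
      Z.card ≤ 6 * N + 11 ∧ (∀ v ∈ Z, eval v f = 0) ∧ Nonempty (StepData f S S' Z) := by
  classical
  obtain ⟨ω₀, hω₀⟩ := h
  obtain ⟨ω₀', hω₀'⟩ := h'
  choose ω hω using hcω
  choose ω' hω' using hbω
  have hcard : ∀ {c : Fin (N + 2) → k}, Function.Injective c →
      (Finset.univ.image fun i : Fin N => c (Fin.castAdd 2 i)).card = N := fun {c} hc => by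
    have h := Finset.card_image_of_injective Finset.univ (hc.comp (Fin.castAdd_injective N 2))
    rwa [Finset.card_univ, Fintype.card_fin] at h
  have hnot : ∀ {c : Fin (N + 2) → k}, Function.Injective c → ∀ j : Fin 2,
      c (Fin.natAdd N j) ∉ Finset.univ.image fun i : Fin N => c (Fin.castAdd 2 i) := by
    intro c hc j hj
    obtain ⟨i, -, hi⟩ := Finset.mem_image.mp hj
    have := congrArg Fin.val (hc hi)
    simp at this
    lia
  have hzero : ∀ {c : Fin (N + 2) → k}, (∀ i, c i ≠ 0) →
      0 ∉ Finset.univ.image fun i : Fin N => c (Fin.castAdd 2 i) := by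
    intro c hc hj
    obtain ⟨i, -, hi⟩ := Finset.mem_image.mp hj
    exact hc _ hi
  let y : Fin 2 → k := fun j => b (Fin.natAdd N j)
  let r : Fin 2 → k := fun j => ω' (Fin.natAdd N j) 0
  have hy : y 0 ≠ y 1 := fun h => by
    have := hb h
    simp at this
  have hy' : y 0 - y 1 ≠ 0 := sub_ne_zero.mpr hy
  let l : k := (r 0 - r 1) / (y 0 - y 1)
  let m : k := r 0 - l * y 0
  have hr : ∀ j, l * y j + m = r j := by
    have h1 : l * (y 0 - y 1) = r 0 - r 1 := div_mul_cancel₀ _ hy'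
    intro j
    fin_cases j
    · change l * y 0 + (r 0 - l * y 0) = r 0
      ring
    · change l * y 1 + (r 0 - l * y 0) = r 1
      linear_combination -h1
  let p : Fin 2 → k := fun j => c (Fin.natAdd N j)
  have hp : p 1 ≠ p 0 := fun h => by
    have := hc h
    simp at this
  let η₀ : k := ω (Fin.natAdd N 1) 0
  obtain ⟨i, j, hij, hi, hj⟩ := exists_two_ne (hω (Fin.natAdd N 0)).1 (η₀ - l * p 1 + l * p 0)
  let η : Fin 3 → k := ![η₀, ω (Fin.natAdd N 0) i, ω (Fin.natAdd N 0) j]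
  let ξ : Fin 3 → k := ![p 1, p 0, p 0]
  have hξ : ∀ j, ∃ i, ξ j = p i := by
    intro j
    fin_cases j
    exacts [⟨1, rfl⟩, ⟨0, rfl⟩, ⟨0, rfl⟩]
  let pt : (Fin N × Fin 3) ⊕ Fin 3 ⊕ (Fin N × Fin 3) ⊕ Fin 3 ⊕ Fin 3 ⊕ Fin 2 → Fin 4 → k :=
    Sum.elim (fun p => ![ω (Fin.castAdd 2 p.1) p.2, c (Fin.castAdd 2 p.1), 0, 1]) <|
    Sum.elim (fun i => ![ω₀ i, 0, 0, 1]) <|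
    Sum.elim (fun p => ![ω' (Fin.castAdd 2 p.1) p.2, b (Fin.castAdd 2 p.1), 1, 0]) <|
    Sum.elim (fun i => ![ω₀' i, 0, 1, 0]) <|
    Sum.elim (fun j => ![η j, ξ j, 0, 1]) fun j => ![l * y j + m, y j, 1, 0]
  have hpt : ∀ x, eval (pt x) f = 0 := by
    rintro (x | x | x | x | x | x)
    · exact (hω _).2 _
    · exact hω₀.2 _
    · exact (hω' _).2 _
    · exact hω₀'.2 _
    · change eval ![η x, ξ x, 0, 1] f = 0
      fin_cases x
      exacts [(hω _).2 _, (hω _).2 _, (hω _).2 _]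
    · change eval ![l * y x + m, y x, 1, 0] f = 0
      rw [hr]
      exact (hω' _).2 _
  have hmem : ∀ x, pt x ∈ ((Finset.univ.image pt : Finset (Fin 4 → k)) : Set (Fin 4 → k)) :=
    fun x => Finset.mem_coe.mpr (Finset.mem_image_of_mem pt (Finset.mem_univ x))
  refine ⟨_, _, Finset.univ.image pt, hcard hc, hcard hb, ?_, ?_, ⟨?_⟩⟩
  · refine Finset.card_image_le.trans ?_
    rw [Finset.card_univ]
    simp only [Fintype.card_sum, Fintype.card_prod, Fintype.card_fin]
    lia
  · intro v hv
    obtain ⟨x, -, rfl⟩ := Finset.mem_image.mp hv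
    exact hpt x
  · exact
    { zero_notMem := hzero hc0
      zero_notMem' := hzero hb0
      fiber := by
        intro ξ hξ
        rcases hξ with rfl | hξ
        · exact ⟨ω₀, hω₀, fun i => hmem (.inr (.inl i))⟩
        · obtain ⟨i, -, rfl⟩ := Finset.mem_image.mp (Finset.mem_coe.mp hξ)
          exact ⟨ω _, hω _, fun j => hmem (.inl (i, j))⟩
      fiber' := by
        intro ξ hξ
        rcases hξ with rfl | hξ
        · exact ⟨ω₀', hω₀', fun i => hmem (.inr (.inr (.inr (.inl i))))⟩
        · obtain ⟨i, -, rfl⟩ := Finset.mem_image.mp (Finset.mem_coe.mp hξ)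
          exact ⟨ω' _, hω' _, fun j => hmem (.inr (.inr (.inl (i, j))))⟩
      l := l
      m := m
      y := y
      y_ne := fun j => hb0 _
      y_notMem := fun j => hnot hb j
      y_inj := hy
      eval_y := fun j => hpt (.inr (.inr (.inr (.inr (.inr j)))))
      y_mem := fun j => hmem (.inr (.inr (.inr (.inr (.inr j)))))
      η := η
      ξ := ξ
      ξ_ne := fun j => by
        obtain ⟨i, hi⟩ := hξ j
        exact hi ▸ hc0 _
      ξ_notMem := fun j => by
        obtain ⟨i, hi⟩ := hξ j
        exact hi ▸ hnot hc i
      eval_ξ := fun j => hpt (.inr (.inr (.inr (.inr (.inl j)))))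
      ξ_mem := fun j => hmem (.inr (.inr (.inr (.inr (.inl j)))))
      noncollinear := fun α β γ h => noncollinear_of_ne hij hp h
      inj := by
        have h01 : η 0 - l * ξ 0 ≠ η 1 - l * ξ 1 := fun h => hi (by
          change η₀ - l * p 1 = ω (Fin.natAdd N 0) i - l * p 0 at h
          linear_combination -h)
        have h02 : η 0 - l * ξ 0 ≠ η 2 - l * ξ 2 := fun h => hj (by
          change η₀ - l * p 1 = ω (Fin.natAdd N 0) j - l * p 0 at h
          linear_combination -h)
        have h12 : η 1 - l * ξ 1 ≠ η 2 - l * ξ 2 := fun h => hij (by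
          change ω (Fin.natAdd N 0) i - l * p 0 = ω (Fin.natAdd N 0) j - l * p 0 at h
          linear_combination h)
        intro a b hab
        fin_cases a <;> fin_cases b <;>
          first
          | rfl
          | exact absurd hab h01
          | exact absurd hab h02
          | exact absurd hab h12
          | exact absurd hab.symm h01
          | exact absurd hab.symm h02
          | exact absurd hab.symm h12 }

end

section

variable {k : Type} [Field k]

/-- The matrix with the given entries. -/
def mat (x : Fin 4 × Fin 4 → k) : Matrix (Fin 4) (Fin 4) k := Matrix.of fun i j => x (i, j)

theorem generic_det_ne_zero : Generic fun x : Fin 4 × Fin 4 → k => (mat x).det ≠ 0 := by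
  have h : IsPoly fun x : Fin 4 × Fin 4 → k => (mat x).det :=
    IsPoly.det fun i j => IsPoly.coord (i, j)
  refine Generic.of_ne_zero h (x := fun p => (1 : Matrix (Fin 4) (Fin 4) k) p.1 p.2) ?_
  have : mat (fun p => (1 : Matrix (Fin 4) (Fin 4) k) p.1 p.2) = 1 := rfl
  rw [this, Matrix.det_one]
  exact one_ne_zero

theorem generic_eval_ne_zero [Infinite k] {f : R4 k} (hf : f ≠ 0) (j : Fin 4) :
    Generic fun x : Fin 4 × Fin 4 → k => eval (fun i => x (i, j)) f ≠ 0 := by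
  have h : IsPoly fun x : Fin 4 × Fin 4 → k => eval (fun i => x (i, j)) f :=
    IsPoly.eval_comp (fun i => IsPoly.coord (i, j)) f
  obtain ⟨o, ho⟩ : ∃ o, eval o f ≠ 0 := by
    by_contra! h
    exact hf (MvPolynomial.funext fun o => by rw [h, map_zero])
  exact Generic.of_ne_zero h (x := fun p => o p.1) ho

theorem generic_discr_ne_zero [IsAlgClosed k] (S : SmoothCubicSurface k) {j l : Fin 4}
    (hjl : j ≠ l) : Generic fun x : Fin 4 × Fin 4 → k =>
      (restr S.f (fun i => x (i, j)) (fun i => x (i, l))).discr ≠ 0 := by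
  have h : IsPoly fun x : Fin 4 × Fin 4 → k =>
      (restr S.f (fun i => x (i, j)) (fun i => x (i, l))).discr :=
    IsPoly.discr (fun i => IsPoly.coord (i, j)) (fun i => IsPoly.coord (i, l)) S.f
  obtain ⟨u, o, huo⟩ := exists_discr_ne_zero S
  refine Generic.of_ne_zero h (x := fun p => if p.2 = j then u p.1 else o p.1) ?_
  simpa only [if_true, if_neg hjl.symm] using huo

theorem generic_cramer_ne_zero {p : Fin 4 → k} (hp : p ≠ 0) (j : Fin 4) :
    Generic fun x : Fin 4 × Fin 4 → k => (mat x).cramer p j ≠ 0 := by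
  have h : IsPoly fun x : Fin 4 × Fin 4 → k => (mat x).cramer p j := by
    simp only [Matrix.cramer_apply]
    refine IsPoly.det fun a b => ?_
    by_cases hb : b = j
    · simp only [Matrix.updateCol_apply, if_pos hb]
      exact IsPoly.const _
    · simp only [Matrix.updateCol_apply, if_neg hb]
      exact IsPoly.coord (a, b)
  obtain ⟨i, hi⟩ := Function.ne_iff.mp hp
  let e : Equiv.Perm (Fin 4) := Equiv.swap i j
  let g : Matrix (Fin 4) (Fin 4) k := e.permMatrix k
  refine Generic.of_ne_zero h (x := fun p => g p.1 p.2) ?_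
  have h1 : mat (fun p => g p.1 p.2) = g := rfl
  have h2 : g.det ≠ 0 := by
    rw [Matrix.det_permutation]
    rcases Int.units_eq_one_or (Equiv.Perm.sign e) with h | h <;> simp [h]
  have h3 : g.mulVec (g.cramer p) = g.det • p := Matrix.mulVec_cramer g p
  have h4 := congrFun h3 i
  rw [Matrix.permMatrix_mulVec] at h4
  have h5 : e i = j := Equiv.swap_apply_left i j
  rw [Function.comp_apply, h5] at h4
  rw [h1, h4]
  exact mul_ne_zero h2 hi

theorem det_inv {g : Matrix (Fin 4) (Fin 4) k} (hg : g.det ≠ 0) :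
    g * g⁻¹ = 1 ∧ g⁻¹ * g = 1 :=
  ⟨Matrix.mul_nonsing_inv g hg.isUnit, Matrix.nonsing_inv_mul g hg.isUnit⟩

theorem inv_mulVec_ne_zero {g : Matrix (Fin 4) (Fin 4) k} {p : Fin 4 → k} {j : Fin 4}
    (h : g.cramer p j ≠ 0) (hg : g.det ≠ 0) : g⁻¹.mulVec p j ≠ 0 := by
  have h1 : g.cramer p = g.det • g⁻¹.mulVec p := by
    have h2 := congrArg g⁻¹.mulVec (Matrix.mulVec_cramer g p)
    rwa [Matrix.mulVec_mulVec, (det_inv hg).2, Matrix.one_mulVec, Matrix.mulVec_smul] at h2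
  intro h2
  rw [h1, Pi.smul_apply, h2, smul_zero] at h
  exact h rfl

theorem mulVec_vec (g : Matrix (Fin 4) (Fin 4) k) (w x y z : k) :
    g.mulVec ![w, x, y, z] =
      w • g.col 0 + x • g.col 1 + y • g.col 2 + z • g.col 3 := by
  funext i
  simp [Matrix.mulVec, dotProduct, Fin.sum_univ_four, mul_comm]

theorem isFiber_subst {f : R4 k} {g : Matrix (Fin 4) (Fin 4) k} {ξ y z : k} {u : Fin 4 → k}
    (hu : ξ • g.col 1 + y • g.col 2 + z • g.col 3 = u) {ω : Fin 3 → k}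
    (hω : Function.Injective ω) (h : ∀ j, eval (u + ω j • g.col 0) f = 0) :
    IsFiber (subst g f) ξ y z ω := by
  refine ⟨hω, fun i => ?_⟩
  rw [eval_subst, mulVec_vec, ← h i, ← hu]
  congr 2
  abel

theorem coeff_subst {f : R4 k} (hf : f ∈ forms k 3) (g : Matrix (Fin 4) (Fin 4) k) (j : Fin 4) :
    coeff (Finsupp.single j 3) (subst g f) = eval (g.col j) f := by
  have h : (subst g f).IsHomogeneous 3 := subst_isHomogeneous g (mem_forms_natCast.mp hf)
  rw [coeff_single_eq_eval h, eval_subst, Matrix.mulVec_single_one]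

theorem Rigid.exists_add_two [IsAlgClosed k] (S : SmoothCubicSurface k) {N : ℕ}
    {Z' : Finset (Fin 4 → k)} (hZ' : ∀ v ∈ Z', eval v S.f = 0) (hR : Rigid S.f N Z') :
    ∃ Z : Finset (Fin 4 → k), Z.card ≤ Z'.card + (6 * N + 11) ∧ (∀ v ∈ Z, eval v S.f = 0) ∧
      Rigid S.f (N + 2 : ℕ) Z := by
  classical
  have hinf : Infinite k := IsAlgClosed.instInfinite
  have hf : S.f ∈ forms k 3 := mem_forms_natCast.mpr S.homog
  have hgen : Generic fun x : Fin 4 × Fin 4 → k => ∀ p ∈ Z'.filter (· ≠ 0),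
      (mat x).cramer p 2 ≠ 0 ∧ (mat x).cramer p 3 ≠ 0 := by
    refine Generic.forall_mem fun p hp => ?_
    have hp := (Finset.mem_filter.mp hp).2
    exact (generic_cramer_ne_zero hp 2).and (generic_cramer_ne_zero hp 3)
  obtain ⟨x, ⟨⟨⟨hdet, h0⟩, h30⟩, h20⟩, hp⟩ := ((((generic_det_ne_zero (k := k)).and
    (generic_eval_ne_zero S.irred.ne_zero 0)).and
    (generic_discr_ne_zero S (show (3 : Fin 4) ≠ 0 by decide))).and
    (generic_discr_ne_zero S (show (2 : Fin 4) ≠ 0 by decide))).and hgen |>.exists_mem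
  let g := mat x
  have hg0 : eval (g.col 0) S.f ≠ 0 := h0
  have hg3 : (restr S.f (g.col 3) (g.col 0)).discr ≠ 0 := h30
  have hg2 : (restr S.f (g.col 2) (g.col 0)).discr ≠ 0 := h20
  obtain ⟨hgh, hhg⟩ := det_inv hdet
  change g * g⁻¹ = 1 at hgh
  change g⁻¹ * g = 1 at hhg
  have hfg : subst g S.f ∈ forms k 3 := subst_mem_forms g hf
  have hfib : ∃ ω, IsFiber (subst g S.f) 0 0 1 ω := by
    obtain ⟨ω, hω, h⟩ := exists_three_roots hf hg0 hg3
    exact ⟨ω, isFiber_subst (by simp) hω h⟩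
  have hfib' : ∃ ω, IsFiber (subst g S.f) 0 1 0 ω := by
    obtain ⟨ω, hω, h⟩ := exists_three_roots hf hg0 hg2
    exact ⟨ω, isFiber_subst (by simp) hω h⟩
  obtain ⟨c, hc, hc0, hcω⟩ := exists_injective_roots hf hg0 hg3 (g.col 1) (N + 2)
  obtain ⟨b, hb, hb0, hbω⟩ := exists_injective_roots hf hg0 hg2 (g.col 1) (N + 2)
  obtain ⟨T, T', Y, hT, hT', hY, hYf, ⟨hstep⟩⟩ := exists_stepData hfib hfib' N hc hc0
    (fun i => by
      obtain ⟨ω, hω, h⟩ := hcω i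
      exact ⟨ω, isFiber_subst (by rw [zero_smul, add_zero, one_smul, add_comm]) hω h⟩) hb hb0
    (fun i => by
      obtain ⟨ω, hω, h⟩ := hbω i
      exact ⟨ω, isFiber_subst (by rw [zero_smul, add_zero, one_smul, add_comm]) hω h⟩)
  have hmul : ∀ v, g.mulVec (g⁻¹.mulVec v) = v := fun v => by
    rw [Matrix.mulVec_mulVec, hgh, Matrix.one_mulVec]
  have hR' : Rigid (subst g S.f) N (g⁻¹.mulVec '' Z') := by
    refine Rigid.image hhg hgh ?_
    rwa [subst_subst, hgh, subst_one]
  have hrig := StepData.rigid (Z := (Y : Set (Fin 4 → k)) ∪ g⁻¹.mulVec '' Z') hfg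
    ((coeff_subst hf g 0).trans_ne hg0) (hstep.mono Set.subset_union_left) hT hT'
    Set.subset_union_right hR' (by
      rintro _ ⟨v, hv, rfl⟩
      rw [eval_subst, hmul]
      exact hZ' v hv) (by
      rintro _ ⟨v, hv, rfl⟩ hv0
      have hv1 : v ≠ 0 := by
        rintro rfl
        exact hv0 (Matrix.mulVec_zero _)
      have h1 := hp v (Finset.mem_filter.mpr ⟨hv, hv1⟩)
      exact ⟨inv_mulVec_ne_zero h1.1 hdet, inv_mulVec_ne_zero h1.2 hdet⟩)
  refine ⟨Y.image g.mulVec ∪ Z', ?_, ?_, ?_⟩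
  · refine (Finset.card_union_le _ _).trans ?_
    have := Finset.card_image_le (s := Y) (f := g.mulVec)
    lia
  · intro v hv
    rcases Finset.mem_union.mp hv with hv | hv
    · obtain ⟨w, hw, rfl⟩ := Finset.mem_image.mp hv
      rw [← eval_subst]
      exact hYf w hw
    · exact hZ' v hv
  · have h1 := Rigid.image hgh hhg hrig
    convert h1 using 1
    rw [Finset.coe_union, Finset.coe_image, Set.image_union, Set.image_image]
    simp only [hmul, Set.image_id']

end

section

variable {k : Type} [Field k]

theorem exists_quadratic {G : R4 k} (hG : G ∈ forms k 2) : ∃ (a b c : Fin 3 → k) (h : k),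
    G = C (a 0) * X 0 ^ 2 + C (a 1) * X 0 * X 1 + C (a 2) * X 1 ^ 2
      + (C (b 0) * X 0 + C (b 1) * X 1 + C (b 2) * X 3) * X 3
      + (C (c 0) * X 0 + C (c 1) * X 1 + C (c 2) * X 2) * X 2 + C h * (X 2 * X 3) := by
  obtain ⟨z, hz, rfl⟩ := exists_sum_X_of_forms (e := 1) (by norm_num) hG (by norm_num)
  have h1 : ∀ i, ∃ c : Fin 4 → k, z i = ∑ j, X j * C (c j) := by
    intro i
    obtain ⟨w, hw, h⟩ := exists_sum_X_of_forms (by norm_num) (hz i) (sub_self 1)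
    choose c hc using fun j => exists_C_of_mem_forms_zero (hw j)
    exact ⟨c, by simp only [h, hc]⟩
  choose q hq using h1
  refine ⟨![q 0 0, q 0 1 + q 1 0, q 1 1], ![q 0 3 + q 3 0, q 1 3 + q 3 1, q 3 3],
    ![q 0 2 + q 2 0, q 1 2 + q 2 1, q 2 2], q 2 3 + q 3 2, ?_⟩
  simp only [hq, Fin.sum_univ_four, Matrix.cons_val_zero, Matrix.cons_val_one,
    Matrix.cons_val, C_add]
  ring

/-- A configuration of eleven points which becomes rigid in degree two after adding one point of
the surface in general position. -/
structure BaseData (Z : Set (Fin 4 → k)) where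
  ω : Fin 3 → k
  ω_inj : Function.Injective ω
  ω_mem : ∀ i, ![ω i, 0, 0, 1] ∈ Z
  ω' : Fin 2 → k
  ω'_inj : ω' 0 ≠ ω' 1
  ω'_ne : ∀ i, ω' i ≠ 0
  ω'_mem : ∀ i, ![ω' i, 0, 1, 0] ∈ Z
  η : Fin 3 → k
  ξ : Fin 3 → k
  ξ_ne : ∀ j, ξ j ≠ 0
  ξ_mem : ∀ j, ![η j, ξ j, 0, 1] ∈ Z
  noncollinear : ∀ α β γ : k, (∀ j, α * η j + β * ξ j + γ = 0) → α = 0 ∧ β = 0 ∧ γ = 0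
  η_inj : Function.Injective η
  y : Fin 2 → k
  y_ne : ∀ j, y j ≠ 0
  y_inj : y 0 ≠ y 1
  y_mem : ∀ j, ![0, y j, 1, 0] ∈ Z
  ν : Fin 4 → k
  ν_one : ν 1 ≠ 0
  ν_two : ν 2 ≠ 0
  ν_three : ν 3 ≠ 0
  ν_mem : ν ∈ Z
  eq_ν : ∀ v ∈ Z, v 2 * v 3 ≠ 0 → v = ν

variable {Z : Set (Fin 4 → k)}

theorem BaseData.exists_sub_mul_X (h : BaseData Z) {F : Fin 4 → R4 k} (hF : FormTuple 2 F)
    (hFZ : Radial F Z) :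
    ∃ A ∈ forms k 1, ∃ κ, F 1 - A * X 1 = C κ * (X 2 * X 3) := by
  obtain ⟨a, b, c, e, hq⟩ := exists_quadratic (hF 1)
  obtain ⟨a0, b0, b2⟩ := eq_zero_of_three_roots (a := a 0) (b := b 0) (c := b 2) h.ω_inj
    fun i => by
      have := hFZ _ (h.ω_mem i) 1 3
      rw [hq] at this
      simpa [add_assoc] using this
  have h1 : ∀ i, c 0 * h.ω' i + c 2 = 0 := fun i => by
    have := hFZ _ (h.ω'_mem i) 1 2
    rw [hq, a0] at this
    simpa using this
  obtain ⟨c0, c2⟩ := eq_zero_of_two_roots h.ω'_inj (h1 0) (h1 1)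
  refine ⟨C (a 1) * X 0 + C (a 2) * X 1 + C (b 1) * X 3 + C (c 1) * X 2, ?_, e, ?_⟩
  · exact Submodule.add_mem _ (Submodule.add_mem _ (Submodule.add_mem _
      (mul_mem_forms (C_mem_forms _) (X_mem_forms 0) (zero_add 1))
      (mul_mem_forms (C_mem_forms _) (X_mem_forms 1) (zero_add 1)))
      (mul_mem_forms (C_mem_forms _) (X_mem_forms 3) (zero_add 1)))
      (mul_mem_forms (C_mem_forms _) (X_mem_forms 2) (zero_add 1))
  · rw [hq, a0, b0, b2, c0, c2, C_0]
    ring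

theorem BaseData.eval_two_eq_zero (h : BaseData Z) {G : Fin 4 → R4 k} (hG : FormTuple 2 G)
    (hG1 : G 1 = 0) (hGZ : Radial G Z) : eval ![0, 1, 0, 0] (G 2) = 0 ∧
      (eval ![0, 1, 0, 0] (G 3) = 0 → eval ![0, 1, 0, 0] (G 0) = 0 → G = 0) := by
  choose a b c e hq using fun i => exists_quadratic (hG i)
  have hr : ∀ i, eval ![0, 1, 0, 0] (G i) = a i 2 := fun i => by
    rw [hq i]
    simp
  have hG1' : ∀ v, eval v (G 1) = 0 := fun v => by rw [hG1, map_zero]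
  obtain ⟨ay0, by0, by2⟩ := eq_zero_of_three_roots (a := a 2 0) (b := b 2 0) (c := b 2 2)
    h.ω_inj fun i => by
      have := hGZ _ (h.ω_mem i) 2 3
      rw [hq 2] at this
      simpa [add_assoc] using this
  have hp : ∀ i j, a i 0 * h.η j ^ 2 + a i 1 * h.η j * h.ξ j + a i 2 * h.ξ j ^ 2
      + (b i 0 * h.η j + b i 1 * h.ξ j + b i 2) = 0 := fun i j => by
    have := eq_zero_at hGZ (h.ξ_mem j) (i := 1) (h.ξ_ne j) (hG1' _) i
    rw [hq i] at this
    simpa using this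
  have hy : ∀ i j, a i 2 * h.y j ^ 2 + (c i 1 * h.y j + c i 2) = 0 := fun i j => by
    have := eq_zero_at hGZ (h.y_mem j) (i := 1) (h.y_ne j) (hG1' _) i
    rw [hq i] at this
    simpa using this
  obtain ⟨ay1, ay2, by1⟩ := h.noncollinear (a 2 1) (a 2 2) (b 2 1) fun j => by
    apply mul_left_cancel₀ (h.ξ_ne j)
    linear_combination hp 2 j - h.η j ^ 2 * ay0 - h.η j * by0 - by2
  refine ⟨(hr 2).trans ay2, fun hz hw => ?_⟩
  have az2 := (hr 3).symm.trans hz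
  have aw2 := (hr 0).symm.trans hw
  have hy' : ∀ i, a i 2 = 0 → c i 1 = 0 ∧ c i 2 = 0 := fun i hi => by
    refine eq_zero_of_two_roots h.y_inj ?_ ?_
    · linear_combination hy i 0 - h.y 0 ^ 2 * hi
    · linear_combination hy i 1 - h.y 1 ^ 2 * hi
  obtain ⟨cy1, cy2⟩ := hy' 2 ay2
  obtain ⟨cz1, cz2⟩ := hy' 3 az2
  obtain ⟨cw1, cw2⟩ := hy' 0 aw2
  have ez : ∀ i, a 3 0 * h.ω' i + c 3 0 = 0 := fun i => by
    have := hGZ _ (h.ω'_mem i) 3 2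
    rw [hq 3, cz1, cz2] at this
    apply mul_left_cancel₀ (h.ω'_ne i)
    simp at this
    linear_combination this
  obtain ⟨az0, cz0⟩ := eq_zero_of_two_roots h.ω'_inj (ez 0) (ez 1)
  have ew : ∀ i, (a 0 0 - c 2 0) * h.ω' i + c 0 0 = 0 := fun i => by
    have := hGZ _ (h.ω'_mem i) 0 2
    rw [hq 0, hq 2, cy2, cw2, ay0] at this
    apply mul_left_cancel₀ (h.ω'_ne i)
    simp at this
    linear_combination this
  obtain ⟨aw0, cw0⟩ := eq_zero_of_two_roots h.ω'_inj (ew 0) (ew 1)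
  obtain ⟨r1, r2, bw2⟩ := eq_zero_of_three_roots (a := a 0 0 - b 3 0) (b := b 0 0 - b 3 2)
    (c := b 0 2) h.ω_inj fun i => by
      have := hGZ _ (h.ω_mem i) 0 3
      rw [hq 0, hq 3, az0] at this
      simp at this
      linear_combination this
  obtain ⟨e1, e2, e3, e4, e5, e6⟩ := conic_coeff_eq_zero (l := 0) h.ξ_ne h.noncollinear
    (by simpa using h.η_inj) (κ := a 3 1) (κ₁ := a 0 0) (κ₂ := a 0 1) (b₁ := b 3 1)
    (b₂ := b 3 2) (b₃ := b 0 1)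
    (fun j => by
      linear_combination hp 3 j - h.η j ^ 2 * az0 - h.ξ j ^ 2 * az2 + h.η j * r1)
    (fun j => by
      linear_combination hp 0 j - h.ξ j ^ 2 * aw2 - h.η j * r2 - bw2)
  have z1 : b 3 0 = 0 := by linear_combination e2 - r1
  have z2 : b 0 0 = 0 := by linear_combination r2 + e5
  have z3 : c 2 0 = 0 := by linear_combination e2 - aw0
  have q2 : G 2 = C (e 2) * (X 2 * X 3) := by
    rw [hq 2, ay0, ay1, ay2, by0, by1, by2, z3, cy1, cy2, C_0]
    ring
  have q3 : G 3 = C (e 3) * (X 2 * X 3) := by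
    rw [hq 3, az0, e1, az2, z1, e4, e5, cz0, cz1, cz2, C_0]
    ring
  have q0 : G 0 = C (e 0) * (X 2 * X 3) := by
    rw [hq 0, e2, e3, aw2, z2, e6, bw2, cw0, cw1, cw2, C_0]
    ring
  have hν : ∀ i, eval h.ν (G i) = 0 := eq_zero_at hGZ h.ν_mem (i := 1) h.ν_one (hG1' _)
  have hzero : ∀ i, G i = C (e i) * (X 2 * X 3) → G i = 0 := by
    intro i hi
    have h1 := hν i
    rw [hi, map_mul, eval_C, map_mul, eval_X, eval_X] at h1
    rw [hi, (mul_eq_zero.mp h1).resolve_right (mul_ne_zero h.ν_two h.ν_three), C_0, zero_mul]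
  funext i
  fin_cases i
  exacts [hzero 0 q0, hG1, hzero 2 q2, hzero 3 q3]

/-- The vector fields of degree two with vanishing second component which are radial on `Z`. -/
def normalFields (Z : Set (Fin 4 → k)) : Submodule k (Fin 4 → R4 k) where
  carrier := {G | FormTuple 2 G ∧ G 1 = 0 ∧ Radial G Z}
  zero_mem' := ⟨fun i => Submodule.zero_mem _, rfl, fun v _ i j => by simp⟩
  add_mem' := by
    rintro F G ⟨h1, h2, h3⟩ ⟨h1', h2', h3'⟩
    refine ⟨fun i => Submodule.add_mem _ (h1 i) (h1' i), ?_, fun v hv i j => ?_⟩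
    · rw [Pi.add_apply, h2, h2', add_zero]
    · simp only [Pi.add_apply, map_add]
      linear_combination h3 v hv i j + h3' v hv i j
  smul_mem' := by
    rintro c F ⟨h1, h2, h3⟩
    refine ⟨fun i => Submodule.smul_mem _ c (h1 i), ?_, fun v hv i j => ?_⟩
    · rw [Pi.smul_apply, h2, smul_zero]
    · simp only [Pi.smul_apply, smul_eval]
      linear_combination c * h3 v hv i j

theorem exists_spanning {V : Type} [AddCommGroup V] [Module k V] (U : Submodule k V)
    (ρ : V →ₗ[k] (Fin 2 → k)) (hρ : ∀ G ∈ U, ρ G = 0 → G = 0) :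
    ∃ B : Fin 2 → V, (∀ j, B j ∈ U) ∧ ∀ G ∈ U, G = ρ G 0 • B 0 + ρ G 1 • B 1 := by
  have hinj : LinearMap.ker (ρ.comp U.subtype) = ⊥ := by
    rw [LinearMap.ker_eq_bot']
    intro G hG
    exact Subtype.ext (hρ G G.2 hG)
  obtain ⟨s, hs⟩ := LinearMap.exists_leftInverse_of_injective _ hinj
  refine ⟨fun j => s (Pi.single j 1), fun j => (s _).2, fun G hG => ?_⟩
  have h1 := LinearMap.congr_fun hs ⟨G, hG⟩
  have h2 : ρ G = ρ G 0 • Pi.single 0 1 + ρ G 1 • Pi.single 1 1 := by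
    funext j
    fin_cases j <;> simp
  have h3 : s (ρ G) = ⟨G, hG⟩ := h1
  have h4 : ((s (ρ G) : U) : V) = G := by rw [h3]
  rw [h2, map_add, map_smul, map_smul] at h4
  exact h4.symm

end

section

variable {k : Type} [Field k] {Z : Set (Fin 4 → k)}

/-- The values at the second coordinate point of the last and of the first component. -/
noncomputable def evalEnds (k : Type) [Field k] : (Fin 4 → R4 k) →ₗ[k] (Fin 2 → k) where
  toFun G := ![eval ![0, 1, 0, 0] (G 3), eval ![0, 1, 0, 0] (G 0)]
  map_add' F G := by
    funext j
    fin_cases j <;> simp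
  map_smul' c F := by
    funext j
    fin_cases j <;> simp [smul_eval]

theorem BaseData.exists_fields (h : BaseData Z) : ∃ Φ : Fin 2 → Fin 4 → R4 k,
    (∀ i, eval ![0, 1, 0, 0] (Φ 0 i) = ![0, 0, 0, 1] i) ∧
    (∀ i, eval ![0, 1, 0, 0] (Φ 1 i) = ![1, 0, 0, 0] i) ∧
    ∀ G ∈ normalFields Z, ∃ α β : k, ∀ i, G i = C α * Φ 0 i + C β * Φ 1 i := by
  obtain ⟨B, hB, hspan⟩ := exists_spanning (normalFields Z) (evalEnds k) fun G hG h0 => by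
    obtain ⟨h1, h2, h3⟩ := hG
    exact (h.eval_two_eq_zero h1 h2 h3).2 (congrFun h0 0) (congrFun h0 1)
  have hB2 : ∀ j, eval ![0, 1, 0, 0] (B j 2) = 0 := fun j => by
    obtain ⟨h1, h2, h3⟩ := hB j
    exact (h.eval_two_eq_zero h1 h2 h3).1
  let r : Fin 4 → k := ![0, 1, 0, 0]
  refine ⟨![![B 0 0 - C (eval r (B 0 0)) * X 1 ^ 2, 0, B 0 2,
      B 0 3 + C (1 - eval r (B 0 3)) * X 1 ^ 2],
    ![B 1 0 + C (1 - eval r (B 1 0)) * X 1 ^ 2, 0, B 1 2,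
      B 1 3 - C (eval r (B 1 3)) * X 1 ^ 2]], ?_, ?_, ?_⟩
  · intro i
    fin_cases i <;> simp [r, hB2]
  · intro i
    fin_cases i <;> simp [r, hB2]
  · intro G hG
    have h1 := hspan G hG
    set α := evalEnds k G 0 with hα
    set β := evalEnds k G 1 with hβ
    have h2 : ∀ i, G i = C α * B 0 i + C β * B 1 i := fun i => by
      have := congrFun h1 i
      rwa [Pi.add_apply, Pi.smul_apply, Pi.smul_apply, smul_eq_C_mul, smul_eq_C_mul] at this
    have hα' : eval r (G 3) = α := rfl
    have hβ' : eval r (G 0) = β := rfl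
    refine ⟨α, β, fun i => ?_⟩
    fin_cases i
    · have h3 : α * eval r (B 0 0) = β * (1 - eval r (B 1 0)) := by
        rw [h2 0, map_add, map_mul, map_mul, eval_C, eval_C] at hβ'
        linear_combination hβ'
      have h4 := congrArg (C : k → R4 k) h3
      rw [C_mul, C_mul] at h4
      change G 0 = C α * (B 0 0 - C (eval r (B 0 0)) * X 1 ^ 2)
        + C β * (B 1 0 + C (1 - eval r (B 1 0)) * X 1 ^ 2)
      linear_combination h2 0 + X 1 ^ 2 * h4
    · change G 1 = C α * 0 + C β * 0
      rw [hG.2.1]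
      ring
    · exact h2 2
    · have h3 : β * eval r (B 1 3) = α * (1 - eval r (B 0 3)) := by
        rw [h2 3, map_add, map_mul, map_mul, eval_C, eval_C] at hα'
        linear_combination hα'
      have h4 := congrArg (C : k → R4 k) h3
      rw [C_mul, C_mul] at h4
      change G 3 = C α * (B 0 3 + C (1 - eval r (B 0 3)) * X 1 ^ 2)
        + C β * (B 1 3 - C (eval r (B 1 3)) * X 1 ^ 2)
      linear_combination h2 3 + X 1 ^ 2 * h4

theorem BaseData.exists_rigid [IsAlgClosed k] {f : R4 k} (hf : f ∈ forms k 3)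
    (hi : Irreducible f) (hr : eval ![0, 1, 0, 0] f = 0) (h : BaseData Z) :
    ∃ t, eval t f = 0 ∧ Rigid f 2 (insert t Z) := by
  obtain ⟨Φ, hΦ0, hΦ1, hΦ⟩ := h.exists_fields
  let M : Matrix (Fin 4) (Fin 4) (R4 k) := Matrix.of ![fun i => C (h.ν i), Φ 0, Φ 1, X]
  have hD : ¬ f ∣ M.det := by
    rintro ⟨s, hs⟩
    have h1 := congrArg (eval ![0, 1, 0, 0]) hs
    rw [map_mul, hr, zero_mul, RingHom.map_det] at h1
    have h2 : (eval ![0, 1, 0, 0]).mapMatrix M = Matrix.of ![h.ν, ![0, 0, 0, 1], ![1, 0, 0, 0],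
        ![0, 1, 0, 0]] := by
      ext i j
      fin_cases i
      · exact eval_C _
      · exact hΦ0 j
      · exact hΦ1 j
      · exact eval_X _
    rw [h2] at h1
    have h3 : (Matrix.of ![h.ν, ![0, 0, 0, 1], ![1, 0, 0, 0],
        ![0, 1, 0, 0]] : Matrix (Fin 4) (Fin 4) k).det = h.ν 2 := by
      simp [Matrix.det_succ_row_zero, Fin.sum_univ_succ, Fin.succAbove]
    exact h.ν_two (h3.symm.trans h1)
  obtain ⟨t, ht, ht'⟩ : ∃ t, eval t f = 0 ∧ eval t (M.det * (X 2 * X 3)) ≠ 0 := by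
    refine exists_eval_ne_zero hi fun h1 => ?_
    rcases hi.prime.dvd_or_dvd h1 with h1 | h1
    · exact hD h1
    · rcases hi.prime.dvd_or_dvd h1 with h1 | h1
      · exact not_dvd_X hf 2 h1
      · exact not_dvd_X hf 3 h1
  rw [map_mul, map_mul, eval_X, eval_X, RingHom.map_det] at ht'
  have ht1 := left_ne_zero_of_mul ht'
  have ht23 := right_ne_zero_of_mul ht'
  refine ⟨t, ht, fun F hF hFZ => ?_⟩
  rw [← radial_iff] at hFZ
  have hFZ' : Radial F Z := fun v hv => hFZ v (Set.mem_insert_of_mem t hv)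
  obtain ⟨A, hA, κ, hκ⟩ := h.exists_sub_mul_X hF hFZ'
  let F' : Fin 4 → R4 k := fun i => F i - A * X i
  have hF' : FormTuple 2 F' := fun i => Submodule.sub_mem _ (hF i)
    (mul_mem_forms hA (X_mem_forms i) (by norm_num))
  have hFZ1 : Radial F' (insert t Z) := hFZ.sub_smul A
  let G : Fin 4 → R4 k := fun i => F' i - C (κ / h.ν 1 * h.ν i) * (X 2 * X 3)
  have hG : G ∈ normalFields Z := by
    refine ⟨fun i => Submodule.sub_mem _ (hF' i) (mul_mem_forms (C_mem_forms _)
      (mul_mem_forms (X_mem_forms 2) (X_mem_forms 3) rfl) (by norm_num)), ?_, ?_⟩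
    · change F 1 - A * X 1 - C (κ / h.ν 1 * h.ν 1) * (X 2 * X 3) = 0
      rw [hκ, div_mul_cancel₀ _ h.ν_one, sub_self]
    · intro v hv i j
      have h1 := hFZ1 v (Set.mem_insert_of_mem t hv) i j
      simp only [G, map_sub, map_mul, eval_C, eval_X]
      by_cases h23 : v 2 * v 3 = 0
      · rw [h23, mul_zero, mul_zero, sub_zero, sub_zero]
        exact h1
      · rw [h.eq_ν v hv h23] at h1 ⊢
        linear_combination h1
  obtain ⟨α, β, hαβ⟩ := hΦ G hG
  have ht2 : t 2 ≠ 0 := left_ne_zero_of_mul ht23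
  let μ : k := eval t (F' 2) / t 2
  have hμ : ∀ i, eval t (F' i) = μ * t i := fun i => by
    have h1 := hFZ1 t (Set.mem_insert t Z) i 2
    apply mul_right_cancel₀ ht2
    rw [h1, ← div_mul_cancel₀ (eval t (F' 2)) ht2]
    ring
  have hvec : Matrix.vecMul ![κ / h.ν 1 * (t 2 * t 3), α, β, -μ] ((eval t).mapMatrix M) = 0 := by
    funext i
    have h1 := hμ i
    have h2 := congrArg (eval t) (hαβ i)
    simp only [G, map_sub, map_add, map_mul, eval_C, eval_X] at h2
    simp [Matrix.vecMul, dotProduct, Fin.sum_univ_four, M]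
    linear_combination h1 - h2
  have hzero := Matrix.eq_zero_of_vecMul_eq_zero ht1 hvec
  have hα : α = 0 := congrFun hzero 1
  have hβ : β = 0 := congrFun hzero 2
  have hκ0 : κ / h.ν 1 = 0 := (mul_eq_zero.mp (congrFun hzero 0)).resolve_right ht23
  refine ⟨A, fun i => ?_⟩
  have h1 := hαβ i
  simp only [G, hα, hβ, hκ0, zero_mul, C_0, sub_zero, add_zero] at h1
  change f ∣ F' i
  rw [h1]
  exact dvd_zero f

end

section

variable {k : Type} [Field k]

theorem exists_baseData [IsAlgClosed k] {f : R4 k} (hf : f ∈ forms k 3) (hi : Irreducible f)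
    {ω ω' : Fin 3 → k} (hω : IsFiber f 0 0 1 ω) (hω' : IsFiber f 0 1 0 ω') {c : Fin 2 → k}
    (hc : Function.Injective c) (hc0 : ∀ i, c i ≠ 0) (hcω : ∀ i, ∃ ω, IsFiber f (c i) 0 1 ω)
    {y : Fin 2 → k} (hy : y 0 ≠ y 1) (hy0 : ∀ j, y j ≠ 0) (hyf : ∀ j, eval ![0, y j, 1, 0] f = 0) :
    ∃ Z : Finset (Fin 4 → k), Z.card ≤ 11 ∧ (∀ v ∈ Z, eval v f = 0) ∧
      Nonempty (BaseData (Z : Set (Fin 4 → k))) := by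
  classical
  obtain ⟨i', j', hij', hi', hj'⟩ := exists_two_ne hω'.1 0
  choose η hη using hcω
  obtain ⟨i, j, hij, hi1, hj1⟩ := exists_two_ne (hη 1).1 (η 0 0)
  obtain ⟨ν, hν, hν'⟩ : ∃ ν, eval ν f = 0 ∧ eval ν (X 1 * (X 2 * X 3)) ≠ 0 := by
    refine exists_eval_ne_zero hi fun h1 => ?_
    rcases hi.prime.dvd_or_dvd h1 with h1 | h1
    · exact not_dvd_X hf 1 h1
    · rcases hi.prime.dvd_or_dvd h1 with h1 | h1
      · exact not_dvd_X hf 2 h1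
      · exact not_dvd_X hf 3 h1
  simp only [map_mul, eval_X, ne_eq, mul_eq_zero, not_or] at hν'
  let p : Fin 3 → Fin 4 → k := ![![η 0 0, c 0, 0, 1], ![η 1 i, c 1, 0, 1], ![η 1 j, c 1, 0, 1]]
  let pt : Fin 3 ⊕ Fin 2 ⊕ Fin 3 ⊕ Fin 2 ⊕ Unit → Fin 4 → k :=
    Sum.elim (fun i => ![ω i, 0, 0, 1]) <| Sum.elim (fun a => ![![ω' i', ω' j'] a, 0, 1, 0]) <|
      Sum.elim p <| Sum.elim (fun j => ![0, y j, 1, 0]) fun _ => ν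
  have hmem : ∀ x, pt x ∈ ((Finset.univ.image pt : Finset (Fin 4 → k)) : Set (Fin 4 → k)) :=
    fun x => Finset.mem_coe.mpr (Finset.mem_image_of_mem pt (Finset.mem_univ x))
  refine ⟨Finset.univ.image pt, ?_, ?_, ⟨?_⟩⟩
  · refine Finset.card_image_le.trans ?_
    rw [Finset.card_univ]
    simp only [Fintype.card_sum, Fintype.card_fin, Fintype.card_unit]
    lia
  · intro v hv
    obtain ⟨x, -, rfl⟩ := Finset.mem_image.mp hv
    rcases x with x | x | x | x | x
    · exact hω.2 x
    · fin_cases x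
      exacts [hω'.2 i', hω'.2 j']
    · fin_cases x
      exacts [(hη 0).2 0, (hη 1).2 i, (hη 1).2 j]
    · exact hyf x
    · exact hν
  · exact
    { ω := ω
      ω_inj := hω.1
      ω_mem := fun i => hmem (.inl i)
      ω' := ![ω' i', ω' j']
      ω'_inj := hij'
      ω'_ne := by
        intro a
        fin_cases a
        exacts [hi', hj']
      ω'_mem := fun i => hmem (.inr (.inl i))
      η := ![η 0 0, η 1 i, η 1 j]
      ξ := ![c 0, c 1, c 1]
      ξ_ne := by
        intro a
        fin_cases a
        exacts [hc0 0, hc0 1, hc0 1]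
      ξ_mem := by
        intro a
        fin_cases a
        exacts [hmem (.inr (.inr (.inl 0))), hmem (.inr (.inr (.inl 1))),
          hmem (.inr (.inr (.inl 2)))]
      noncollinear := fun α β γ h => noncollinear_of_ne hij (hc.ne (by decide)) h
      η_inj := by
        intro a b hab
        fin_cases a <;> fin_cases b <;>
          first
          | rfl
          | exact absurd hab hi1
          | exact absurd hab hi1.symm
          | exact absurd hab hj1
          | exact absurd hab hj1.symm
          | exact absurd hab hij
          | exact absurd hab hij.symm
      y := y
      y_ne := hy0
      y_inj := hy
      y_mem := fun j => hmem (.inr (.inr (.inr (.inl j))))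
      ν := ν
      ν_one := hν'.1
      ν_two := hν'.2.1
      ν_three := hν'.2.2
      ν_mem := hmem (.inr (.inr (.inr (.inr ()))))
      eq_ν := by
        intro v hv h23
        obtain ⟨x, -, rfl⟩ := Finset.mem_image.mp hv
        rcases x with x | x | x | x | x
        · simp [pt] at h23
        · simp [pt] at h23
        · fin_cases x <;> simp [pt, p] at h23
        · simp [pt] at h23
        · rfl }

theorem exists_frame [IsAlgClosed k] (S : SmoothCubicSurface k) :
    ∃ g : Matrix (Fin 4) (Fin 4) k, g.det ≠ 0 ∧ eval (g.col 0) S.f ≠ 0 ∧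
      eval (g.col 1) S.f = 0 ∧ (restr S.f (g.col 3) (g.col 0)).discr ≠ 0 ∧
      (restr S.f (g.col 2) (g.col 0)).discr ≠ 0 ∧ ∃ y : Fin 2 → k, y 0 ≠ y 1 ∧ (∀ j, y j ≠ 0) ∧
      ∀ j, eval (y j • g.col 1 + g.col 2) S.f = 0 := by
  have hinf : Infinite k := IsAlgClosed.instInfinite
  have hf : S.f ∈ forms k 3 := mem_forms_natCast.mpr S.homog
  obtain ⟨x, ⟨⟨⟨⟨hdet, h0⟩, h2⟩, h30⟩, h20⟩, h12⟩ := (((((generic_det_ne_zero (k := k)).and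
    (generic_eval_ne_zero S.irred.ne_zero 0)).and
    (generic_eval_ne_zero S.irred.ne_zero 2)).and
    (generic_discr_ne_zero S (show (3 : Fin 4) ≠ 0 by decide))).and
    (generic_discr_ne_zero S (show (2 : Fin 4) ≠ 0 by decide))).and
    (generic_discr_ne_zero S (show (1 : Fin 4) ≠ 2 by decide)) |>.exists_mem
  obtain ⟨ω, hω, h⟩ := exists_three_roots hf h2 h12
  let g : Matrix (Fin 4) (Fin 4) k :=
    (mat x).updateCol 1 fun i => mat x i 1 + ω 0 • mat x i 2
  have hg0 : g.col 0 = fun i => x (i, 0) := by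
    funext i
    simp [g, mat, Matrix.col]
  have hg1 : g.col 1 = (fun i => x (i, 1)) + ω 0 • fun i => x (i, 2) := by
    funext i
    simp [g, mat, Matrix.col]
  have hg2 : g.col 2 = fun i => x (i, 2) := by
    funext i
    simp [g, mat, Matrix.col]
  have hg3 : g.col 3 = fun i => x (i, 3) := by
    funext i
    simp [g, mat, Matrix.col]
  have hsub : ∀ i, i ≠ 0 → ω i - ω 0 ≠ 0 := fun i hi => sub_ne_zero.mpr (hω.ne hi)
  have hroot : ∀ i, i ≠ 0 → eval ((ω i - ω 0)⁻¹ • g.col 1 + g.col 2) S.f = 0 := fun i hi => by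
    have h1 : (ω i - ω 0)⁻¹ • g.col 1 + g.col 2 =
        (ω i - ω 0)⁻¹ • ((fun i => x (i, 1)) + ω i • fun i => x (i, 2)) := by
      rw [hg1, hg2]
      funext l
      have := hsub i hi
      simp only [Pi.add_apply, Pi.smul_apply, smul_eq_mul]
      field_simp
      ring
    rw [h1, eval_smul_of_isHomogeneous S.homog, h, mul_zero]
  refine ⟨g, ?_, ?_, ?_, ?_, ?_, ![(ω 1 - ω 0)⁻¹, (ω 2 - ω 0)⁻¹], ?_, ?_, ?_⟩
  · rwa [Matrix.det_updateCol_add_smul_self _ (by decide)]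
  · rwa [hg0]
  · rw [hg1]
    exact h 0
  · rwa [hg3, hg0]
  · rwa [hg2, hg0]
  · intro h1
    have h2 : ω 1 = ω 2 := sub_left_injective (inv_injective h1)
    exact absurd (hω h2) (by decide)
  · intro j
    fin_cases j
    exacts [inv_ne_zero (hsub 1 (by decide)), inv_ne_zero (hsub 2 (by decide))]
  · intro j
    fin_cases j
    exacts [hroot 1 (by decide), hroot 2 (by decide)]

theorem exists_rigid_two [IsAlgClosed k] (S : SmoothCubicSurface k) :
    ∃ Z : Finset (Fin 4 → k), Z.card ≤ 12 ∧ (∀ v ∈ Z, eval v S.f = 0) ∧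
      Rigid S.f (2 : ℕ) Z := by
  classical
  have hf : S.f ∈ forms k 3 := mem_forms_natCast.mpr S.homog
  obtain ⟨g, hdet, hg0, hg1, hg3, hg2, y, hy, hy0, hyf⟩ := exists_frame S
  obtain ⟨hgh, hhg⟩ := det_inv hdet
  have hfg : subst g S.f ∈ forms k 3 := subst_mem_forms g hf
  have hig : Irreducible (subst g S.f) := irreducible_subst hgh hhg S.irred
  obtain ⟨ω, hω, h⟩ := exists_three_roots hf hg0 hg3
  obtain ⟨ω', hω', h'⟩ := exists_three_roots hf hg0 hg2
  obtain ⟨c, hc, hc0, hcω⟩ := exists_injective_roots hf hg0 hg3 (g.col 1) 2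
  obtain ⟨Z, hZ, hZf, ⟨hbase⟩⟩ := exists_baseData hfg hig
    (isFiber_subst (by simp) hω h) (isFiber_subst (by simp) hω' h') hc hc0
    (fun i => by
      obtain ⟨ω, hω, h⟩ := hcω i
      exact ⟨ω, isFiber_subst (by rw [zero_smul, add_zero, one_smul, add_comm]) hω h⟩) hy hy0
    (fun j => by
      rw [eval_subst, mulVec_vec, zero_smul, zero_smul, zero_add, add_zero, one_smul]
      exact hyf j)
  obtain ⟨t, ht, hrig⟩ := hbase.exists_rigid hfg hig (by
    rw [eval_subst, mulVec_vec]
    simpa using hg1)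
  refine ⟨(insert t Z).image g.mulVec, ?_, ?_, ?_⟩
  · have h1 := Finset.card_image_le (s := insert t Z) (f := g.mulVec)
    have h2 := Finset.card_insert_le t Z
    lia
  · intro v hv
    obtain ⟨w, hw, rfl⟩ := Finset.mem_image.mp hv
    rw [← eval_subst]
    rcases Finset.mem_insert.mp hw with rfl | hw
    exacts [ht, hZf w hw]
  · rw [Finset.coe_image, Finset.coe_insert]
    exact Rigid.image hgh hhg hrig

theorem exists_rigid [IsAlgClosed k] (S : SmoothCubicSurface k) (n : ℕ) :
    ∃ Z : Finset (Fin 4 → k), Z.card ≤ 3 * ((n + 2) * (n + 1) / 2) + (n + 2) ∧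
      (∀ v ∈ Z, eval v S.f = 0) ∧ Rigid S.f (n + 1 : ℕ) Z := by
  induction n using Nat.twoStepInduction with
  | zero => exact exists_rigid_one (mem_forms_natCast.mpr S.homog) S.irred
  | one => exact exists_rigid_two S
  | more n ih _ =>
    obtain ⟨Z', hZ', hZf', hR⟩ := ih
    obtain ⟨Z, hZ, hZf, hR⟩ := Rigid.exists_add_two S hZf' hR
    refine ⟨Z, hZ.trans ?_, hZf, hR⟩
    have h1 : (n + 2 + 2) * (n + 2 + 1) = (n + 2) * (n + 1) + (2 * n + 5) * 2 := by ring
    rw [h1, Nat.add_mul_div_right _ _ two_pos]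
    lia

theorem generalPointsSatisfy_hasMinFreeRes [IsAlgClosed k] (S : SmoothCubicSurface k) (a : ℕ)
    (ha : 2 ≤ a) :
    GeneralPointsSatisfy k S (3 * (a * (a - 1) / 2) + a) (fun Z =>
      HasMinFreeRes3 k (Ideal.span {S.f}) (pointsIdeal k (Set.range Z))
        (fun _ : Fin (2 * a + 1) => a) (fun _ : Fin (3 * a) => a + 1)
        (fun _ : Fin (a - 1) => a + 3)) := by
  have hinf : Infinite k := IsAlgClosed.instInfinite
  obtain ⟨n, rfl⟩ := Nat.exists_eq_add_of_le' ha
  obtain ⟨Z, hZ, hZf, hR⟩ := exists_rigid S n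
  exact generalPointsSatisfy_of_rigid S (Nat.le_add_left 1 n) rfl hZ hZf hR

end

end CubicPoints

/-- the Claim.  For every `a ≥ 2`, the ideal `I_(Z,X) ⊂ R_X` of a general
set of `m(a)` points on a smooth cubic surface `X` has graded minimal free resolution over `R`
`0 → R(-a-3)^(a-1) → R(-a-1)^(3a) → R(-a)^(2a+1) → I_(Z,X) → 0`. -/
theorem claim_resolution_m_on_X (k : Type) [Field k] [IsAlgClosed k]
    (S : SmoothCubicSurface k) (a : ℕ) (ha : 2 ≤ a) :
    GeneralPointsSatisfy k S (3 * (a * (a - 1) / 2) + a) (fun Z =>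
      HasMinFreeRes3 k (Ideal.span {S.f}) (pointsIdeal k (Set.range Z))
        (fun _ : Fin (2 * a + 1) => a) (fun _ : Fin (3 * a) => a + 1) (fun _ : Fin (a - 1) => a + 3)) := by
  exact CubicPoints.generalPointsSatisfy_hasMinFreeRes S a ha
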